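/- arXiv:2502.12357 — 4 statements merged into one kernel-verified Lean document; each statement's English description precedes it below -/
import Mathlib

section
/- Let D be a Prüfer domain, let P = D[x_1,…,x_n] be a polynomial D-algebra in finitely many variables, and let B be an integral domain containing P that is finite as a P-module. Assume that for every maximal ideal 𝔪 of D, the localization of B at the multiplicative set P ∖ 𝔪P (where 𝔪P denotes the prime ideal of P generated by 𝔪) is integrally closed in the fraction field of B. Then B is N-1. -/
set_option synthInstance.maxHeartbeats 400000
set_option maxHeartbeats 800000

universe u v

/-- An integral domain `S` is N-1 if the integral closure of `S` in its fraction
field is a finitely generated `S`-module. -/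
def IsN1 (S : Type u) [CommRing S] [IsDomain S] : Prop :=
  Module.Finite S (integralClosure S (FractionRing S))

/-- A Prüfer domain is an integral domain whose localization at every prime ideal
is a valuation ring. -/
def IsPruferDomain (D : Type u) [CommRing D] [IsDomain D] : Prop :=
  ∀ (P : Ideal D) [P.IsPrime], ValuationRing (Localization.AtPrime P)

/-- The extension of a prime ideal of `D` to a polynomial ring over `D` is prime. -/
lemma isPrime_map_C {D : Type u} [CommRing D] {𝔪 : Ideal D} (h : 𝔪.IsPrime)
    (σ : Type v) :
    (Ideal.map (MvPolynomial.C : D →+* MvPolynomial σ D) 𝔪).IsPrime := by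
  haveI := h
  rw [← Ideal.Quotient.isDomain_iff_prime]
  exact Function.Injective.isDomain
    ((MvPolynomial.quotientEquivQuotientMvPolynomial (σ := σ) 𝔪).symm.toRingEquiv.toRingHom)
    (MvPolynomial.quotientEquivQuotientMvPolynomial 𝔪).symm.injective

section PruferLinearAlgebra

variable {D : Type u} [CommRing D] [IsDomain D]

lemma IsPruferDomain.dvd_or_dvd (hD : IsPruferDomain D) (p : Ideal D) [p.IsPrime] (a b : D) :
    (∃ d ∉ p, a ∣ d * b) ∨ ∃ d ∉ p, b ∣ d * a := by
  have key : ∀ a b : D, algebraMap D (Localization.AtPrime p) a ∣ algebraMap D _ b →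
      ∃ d ∉ p, a ∣ d * b := by
    rintro a b ⟨c, hc⟩
    obtain ⟨⟨x, s⟩, hx⟩ := IsLocalization.surj p.primeCompl c
    refine ⟨s, s.2, x, ?_⟩
    apply IsLocalization.injective (Localization.AtPrime p) p.primeCompl_le_nonZeroDivisors
    simp only at hx
    rw [map_mul, map_mul, ← hx, hc]
    ring
  have := hD p
  rcases (ValuationRing.dvd_total (algebraMap D (Localization.AtPrime p) a)
    (algebraMap D (Localization.AtPrime p) b)) with h | h
  · exact Or.inl (key _ _ h)
  · exact Or.inr (key _ _ h)

lemma IsPruferDomain.exists_local_divisor {ι : Type*} (hD : IsPruferDomain D) (p : Ideal D)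
    [p.IsPrime] (s : Finset ι) (hs : s.Nonempty) (v : ι → D) :
    ∃ i ∈ s, ∃ d ∉ p, ∀ j ∈ s, v i ∣ d * v j := by
  classical
  induction hs using Finset.Nonempty.cons_induction with
  | singleton a => exact ⟨a, by simp, 1, p.one_notMem, by simp⟩
  | cons a s has hs ih =>
    obtain ⟨i, hi, d, hd, h⟩ := ih
    rcases hD.dvd_or_dvd p (v a) (v i) with ⟨c, hc, hac⟩ | ⟨c, hc, hic⟩
    · refine ⟨a, by simp, d * c, ‹p.IsPrime›.mul_notMem hd hc, fun j hj => ?_⟩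
      rcases Finset.mem_cons.1 hj with rfl | hj
      · exact Dvd.intro_left _ rfl
      · calc v a ∣ c * v i := hac
          _ ∣ c * (d * v j) := mul_dvd_mul_left _ (h j hj)
          _ = d * c * v j := by ring
    · refine ⟨i, by simp [hi], d * c, ‹p.IsPrime›.mul_notMem hd hc, fun j hj => ?_⟩
      rcases Finset.mem_cons.1 hj with rfl | hj
      · rw [mul_assoc]; exact hic.mul_left _
      · rw [mul_right_comm]; exact (h j hj).mul_right _

/-- A nonzero vector over a Prüfer domain is, locally at `p`, a multiple of a vector which is
nonzero modulo `p`. -/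
lemma IsPruferDomain.exists_primitive {ι : Type*} (hD : IsPruferDomain D) (p : Ideal D)
    [p.IsPrime] (s : Finset ι) (v : ι → D) (hv : ∃ i ∈ s, v i ≠ 0) :
    ∃ c ≠ 0, ∃ d ∉ p, ∃ e : ι → D, (∃ i ∈ s, e i ∉ p) ∧ (∃ i ∈ s, c = v i) ∧
      (∀ j ∉ s, e j = 0) ∧ ∀ j ∈ s, d * v j = c * e j := by
  classical
  obtain ⟨j₀, hj₀, hvj₀⟩ := hv
  obtain ⟨i, hi, d, hd, h⟩ := hD.exists_local_divisor p s ⟨j₀, hj₀⟩ v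
  have hd0 : d ≠ 0 := fun h0 => hd (h0 ▸ p.zero_mem)
  have hvi : v i ≠ 0 := by
    intro h0
    have := h j₀ hj₀
    rw [h0, zero_dvd_iff] at this
    exact (mul_ne_zero hd0 hvj₀) this
  choose! e he using h
  refine ⟨v i, hvi, d, hd, fun j => if j ∈ s then e j else 0, ⟨i, hi, ?_⟩, ⟨i, hi, rfl⟩, ?_, ?_⟩
  · have : e i = d := by
      have := he i hi
      rw [mul_comm] at this
      exact (mul_left_cancel₀ hvi this).symm
    simpa [hi, this] using hd
  · intro j hj; simp [hj]
  · intro j hj; simpa [hj] using he j hj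

/-- `t` is the leading position, modulo `p`, of some vector of `V`. -/
def IsPivot {ι : Type*} [LT ι] (V : Submodule D (ι → D)) (p : Ideal D) (t : ι) : Prop :=
  ∃ z ∈ V, z t ∉ p ∧ ∀ t', t < t' → z t' ∈ p

lemma det_pivots_notMem {D : Type*} [CommRing D] {ι : Type*} [LinearOrder ι]
    {V : Submodule D (ι → D)} {p : Ideal D} [p.IsPrime] (z : {t // IsPivot V p t} → ι → D)
    [Fintype {t // IsPivot V p t}]
    (hz : ∀ t, z t t ∉ p) (hz' : ∀ t, ∀ t', t.1 < t' → z t t' ∈ p) :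
    (Matrix.of fun t t' : {t // IsPivot V p t} => z t t').det ∉ p := by
  classical
  rw [← Ideal.Quotient.eq_zero_iff_mem, RingHom.map_det, Matrix.det_of_isLowerTriangular,
    Finset.prod_eq_zero_iff]
  · rintro ⟨t, -, ht⟩
    exact hz t (Ideal.Quotient.eq_zero_iff_mem.1 ht)
  · intro t t' h
    exact Ideal.Quotient.eq_zero_iff_mem.2 (hz' t t' h)

variable {ι : Type*} [Fintype ι] [LinearOrder ι] {V : Submodule D (ι → D)} {p : Ideal D}

lemma linearIndependent_pivots [p.IsPrime] (z : {t // IsPivot V p t} → ι → D)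
    (hz : ∀ t, z t t ∉ p) (hz' : ∀ t, ∀ t', t.1 < t' → z t t' ∈ p) :
    LinearIndependent D z := by
  classical
  have hdet := det_pivots_notMem z hz hz'
  rw [Fintype.linearIndependent_iff]
  intro a ha
  have : a = 0 := by
    apply Matrix.eq_zero_of_vecMul_eq_zero (M := Matrix.of fun t t' => z t t'.1)
    · intro h0; rw [h0] at hdet; exact hdet p.zero_mem
    · ext t
      have := congrFun ha t
      simpa [Matrix.vecMul, dotProduct] using this
  intro i; rw [this]; rfl

lemma exists_smul_mem_span_pivots (hD : IsPruferDomain D) [p.IsPrime]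
    (hV : ∀ c : D, c ≠ 0 → ∀ v, c • v ∈ V → v ∈ V) (z : {t // IsPivot V p t} → ι → D)
    (hzV : ∀ t, z t ∈ V)
    (hz : ∀ t, z t t ∉ p) (hz' : ∀ t, ∀ t', t.1 < t' → z t t' ∈ p) :
    ∃ s ∉ p, ∀ w ∈ V, s • w ∈ Submodule.span D (Set.range z) := by
  classical
  set M := Matrix.of fun t t' : {t // IsPivot V p t} => z t t' with hM
  refine ⟨M.det, det_pivots_notMem z hz hz', fun w hw => ?_⟩
  set a := Matrix.vecMul (fun t : {t // IsPivot V p t} => w t) M.adjugate with ha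
  have hw' : M.det • w - ∑ t, a t • z t = 0 := by
    by_contra hne
    set w' := M.det • w - ∑ t, a t • z t with hw'
    have hw'V : w' ∈ V := V.sub_mem (V.smul_mem _ hw)
      (V.sum_mem fun t _ => V.smul_mem _ (hzV t))
    have hvan : ∀ t, IsPivot V p t → w' t = 0 := by
      intro t ht
      have h1 : Matrix.vecMul a M = M.det • fun t : {t // IsPivot V p t} => w t := by
        rw [ha, Matrix.vecMul_vecMul, Matrix.adjugate_mul, Matrix.vecMul_smul, Matrix.vecMul_one]
      have h2 := congrFun h1 ⟨t, ht⟩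
      simp only [Matrix.vecMul, dotProduct, hM, Matrix.of_apply, Pi.smul_apply] at h2
      simp only [hw', Pi.sub_apply, Finset.sum_apply, Pi.smul_apply, smul_eq_mul, hM] at h2 ⊢
      rw [h2, sub_self]
    have hex : ∃ i ∈ Finset.univ, w' i ≠ 0 := by
      by_contra! h
      exact hne (funext fun i => h i (Finset.mem_univ _))
    obtain ⟨c, hc, d, hd, e, ⟨i, -, hi⟩, -, -, he⟩ := hD.exists_primitive p Finset.univ w' hex
    have heV : e ∈ V := by
      apply hV c hc
      have : c • e = d • w' := funext fun j => (he j (Finset.mem_univ _)).symm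
      rw [this]; exact V.smul_mem _ hw'V
    obtain ⟨t, ht, hmax⟩ := (Finset.univ.filter fun t => e t ∉ p).exists_max_image id
      ⟨i, by simpa using hi⟩
    simp only [Finset.mem_filter, Finset.mem_univ, true_and, id] at ht hmax
    have hp : IsPivot V p t := ⟨e, heV, ht, fun t' htt' => by
      by_contra h; exact absurd (hmax t' h) (not_le.2 htt')⟩
    have := he t (Finset.mem_univ _)
    rw [hvan t hp, mul_zero] at this
    rcases mul_eq_zero.1 this.symm with h | h
    · exact hc h
    · exact ht (h ▸ p.zero_mem)
  rw [sub_eq_zero.1 hw']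
  exact Submodule.sum_mem _ fun t _ =>
    Submodule.smul_mem _ _ (Submodule.subset_span ⟨t, rfl⟩)

lemma ncard_pivots_le (hD : IsPruferDomain D)
    (hV : ∀ c : D, c ≠ 0 → ∀ v, c • v ∈ V → v ∈ V) (p q : Ideal D) [p.IsPrime] [q.IsPrime] :
    {t | IsPivot V p t}.ncard ≤ {t | IsPivot V q t}.ncard := by
  classical
  choose z hzV hz hz' using fun t : {t // IsPivot V p t} => t.2
  choose y hyV hy hy' using fun t : {t // IsPivot V q t} => t.2
  obtain ⟨s, hs, h⟩ := exists_smul_mem_span_pivots hD hV y hyV hy hy'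
  have hs0 : s ≠ 0 := fun h0 => hs (h0 ▸ q.zero_mem)
  have hind : LinearIndependent D (fun t => s • z t) := by
    have := linearIndependent_pivots z hz hz'
    rw [Fintype.linearIndependent_iff] at this ⊢
    intro g hg i
    have h1 := this (fun i => g i * s) (by simpa [smul_smul] using hg) i
    exact (mul_eq_zero.1 h1).resolve_right hs0
  have h1 := linearIndependent_le_span' _ hind (Set.range y) (by
    rintro _ ⟨t, rfl⟩
    exact h _ (hzV t))
  have h2 : Fintype.card (Set.range y) ≤ Fintype.card {t // IsPivot V q t} :=
    Fintype.card_range_le y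
  rw [Cardinal.mk_fintype] at h1
  have h3 : Fintype.card {t // IsPivot V p t} ≤ Fintype.card {t // IsPivot V q t} :=
    le_trans (by exact_mod_cast h1) h2
  rw [← Nat.card_coe_set_eq, ← Nat.card_coe_set_eq]
  change Nat.card {t // IsPivot V p t} ≤ Nat.card {t // IsPivot V q t}
  simpa only [Nat.card_eq_fintype_card] using h3

/-- A saturated submodule of a finite free module over a Prüfer domain is finitely generated. -/
lemma IsPruferDomain.fg_of_saturated (hD : IsPruferDomain D)
    (hV : ∀ c : D, c ≠ 0 → ∀ v, c • v ∈ V → v ∈ V) : V.FG := by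
  classical
  let I : Ideal D :=
    { carrier := {s | ∃ Z : Submodule D (ι → D), Z.FG ∧ Z ≤ V ∧ ∀ w ∈ V, s • w ∈ Z}
      zero_mem' := ⟨⊥, Submodule.fg_bot, bot_le, fun w _ => by simp⟩
      add_mem' := by
        rintro a b ⟨Z, hZ, hZV, ha⟩ ⟨Y, hY, hYV, hb⟩
        refine ⟨Z ⊔ Y, hZ.sup hY, sup_le hZV hYV, fun w hw => ?_⟩
        rw [add_smul]
        exact Submodule.add_mem_sup (ha w hw) (hb w hw)
      smul_mem' := by
        rintro c a ⟨Z, hZ, hZV, ha⟩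
        refine ⟨Z, hZ, hZV, fun w hw => ?_⟩
        rw [smul_eq_mul, mul_smul]
        exact Z.smul_mem _ (ha w hw) }
  have hI : I = ⊤ := by
    by_contra hne
    obtain ⟨m, hm, hIm⟩ := I.exists_le_maximal hne
    have := hm.isPrime
    choose z hzV hz hz' using fun t : {t // IsPivot V m t} => t.2
    obtain ⟨s, hs, h⟩ := exists_smul_mem_span_pivots hD hV z hzV hz hz'
    refine hs (hIm ⟨_, Submodule.fg_span (Set.finite_range z), ?_, h⟩)
    rw [Submodule.span_le]; rintro _ ⟨t, rfl⟩; exact hzV t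
  obtain ⟨Z, hZ, hZV, h⟩ : (1 : D) ∈ I := hI ▸ Submodule.mem_top
  have : V = Z := le_antisymm (fun w hw => by simpa using h w hw) hZV
  rwa [this]

end PruferLinearAlgebra

section UpperSets

lemma WellQuasiOrdered.exists_uniform_degree_bound {Q : Type*} {r : Q → Q → Prop}
    (hr : WellQuasiOrdered r) (hrefl : ∀ x, r x x) (htrans : ∀ x y z, r x y → r y z → r x z)
    (deg : Q → ℕ) (hfin : ∀ e, {q | deg q = e}.Finite) (𝒯 : Set (Set Q))
    (hup : ∀ T ∈ 𝒯, ∀ x ∈ T, ∀ y, r x y → y ∈ T)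
    (hcard : ∀ S ∈ 𝒯, ∀ T ∈ 𝒯, ∀ e, {q ∈ S | deg q = e}.ncard = {q ∈ T | deg q = e}.ncard) :
    ∃ d, ∀ T ∈ 𝒯, ∀ t ∈ T, ∃ t' ∈ T, deg t' ≤ d ∧ r t' t := by
  classical
  by_contra! hbad
  let U := {S : Set Q // ∀ x ∈ S, ∀ y, r x y → y ∈ S}
  have hwf : WellFounded (fun S T : U => T.1 ⊂ S.1) := by
    rw [wellFounded_iff_isEmpty_descending_chain]
    refine ⟨fun ⟨f, hf⟩ => ?_⟩
    choose x hx hx' using fun n => Set.exists_of_ssubset (hf n)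
    obtain ⟨i, j, hij, h⟩ := hr x
    have hmono : Monotone fun n => (f n).1 := monotone_nat_of_le_succ fun n => (hf n).subset
    exact hx' j (hmono (Nat.succ_le_of_lt hij) ((f (i + 1)).2 _ (hx i) _ h))
  let Bad (d : ℕ) (T : Set Q) : Prop := ∃ t ∈ T, ∀ t' ∈ T, deg t' ≤ d → ¬ r t' t
  have hBad : ∀ d d' T, d ≤ d' → Bad d' T → Bad d T := by
    rintro d d' T hdd ⟨t, ht, h⟩
    exact ⟨t, ht, fun t' ht' hd => h t' ht' (hd.trans hdd)⟩
  obtain ⟨S, hS, hmax⟩ := hwf.has_min {S : U | ∀ d, ∃ T ∈ 𝒯, Bad d T ∧ S.1 ⊆ T}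
    ⟨⟨∅, by simp⟩, fun d => by
      obtain ⟨T, hT, t, ht, h⟩ := hbad d
      exact ⟨T, hT, ⟨t, ht, h⟩, by simp⟩⟩
  by_cases hc : ∃ e, ∃ T ∈ 𝒯, {q ∈ S.1 | deg q = e}.ncard < {q ∈ T | deg q = e}.ncard
  · obtain ⟨e, T₀, hT₀, hlt⟩ := hc
    have hq : ∀ q ∉ S.1, ∃ d, ∀ T ∈ 𝒯, Bad d T → S.1 ⊆ T → q ∉ T := by
      intro q hqS
      by_contra! hcon
      refine hmax ⟨S.1 ∪ {y | r q y}, ?_⟩ ?_ ?_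
      · rintro x (hx | hx) y hxy
        · exact Or.inl (S.2 x hx y hxy)
        · exact Or.inr (htrans _ _ _ hx hxy)
      · intro d
        obtain ⟨T, hT, hTb, hST, hqT⟩ := hcon d
        exact ⟨T, hT, hTb, Set.union_subset hST fun y hy => hup T hT q hqT y hy⟩
      · refine ⟨Set.subset_union_left, fun h => hqS (h (Or.inr (hrefl q)))⟩
    choose! d hd using hq
    obtain ⟨T, hT, hTb, hST⟩ := hS ((hfin e).toFinset.sup d)
    rw [hcard T₀ hT₀ T hT e] at hlt
    obtain ⟨q, ⟨hqT, hqe⟩, hqS⟩ := Set.exists_mem_notMem_of_ncard_lt_ncard hlt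
      ((hfin e).subset fun q hq => hq.2)
    have hqS' : q ∉ S.1 := fun h => hqS ⟨h, hqe⟩
    refine hd q hqS' T hT (hBad _ _ T ?_ hTb) hST hqT
    exact Finset.le_sup (f := d) (by simpa using hqe)
  · push Not at hc
    have hST : ∀ T ∈ 𝒯, S.1 ⊆ T → S.1 = T := by
      intro T hT hsub
      refine hsub.antisymm fun q hq => ?_
      have := Set.eq_of_subset_of_ncard_le (s := {q' ∈ S.1 | deg q' = deg q})
        (t := {q' ∈ T | deg q' = deg q}) (fun x hx => ⟨hsub hx.1, hx.2⟩) (hc _ T hT)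
        ((hfin (deg q)).subset fun q hq => hq.2)
      have h2 : q ∈ {q' ∈ T | deg q' = deg q} := ⟨hq, rfl⟩
      rw [← this] at h2
      exact h2.1
    let W (d : ℕ) : U := ⟨{y | ∃ x ∈ S.1, deg x ≤ d ∧ r x y}, by
      rintro y ⟨x, hx, hxd, hxy⟩ y' hyy'
      exact ⟨x, hx, hxd, htrans _ _ _ hxy hyy'⟩⟩
    obtain ⟨_, ⟨d, rfl⟩, hd⟩ := hwf.has_min (Set.range W) ⟨_, 0, rfl⟩
    obtain ⟨T, hT, ⟨t, ht, hb⟩, hsub⟩ := hS d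
    rw [← hST T hT hsub] at ht hb
    refine hd (W (max d (deg t))) ⟨_, rfl⟩ ⟨?_, fun h => ?_⟩
    · rintro y ⟨x, hx, hxd, hxy⟩
      exact ⟨x, hx, hxd.trans (le_max_left _ _), hxy⟩
    · obtain ⟨x, hx, hxd, hxt⟩ := h ⟨t, ht, le_max_right _ _, hrefl t⟩
      exact hb x hx hxd hxt

end UpperSets

section Coherence

open MvPolynomial

variable {m n : ℕ}

/-- A monomial with a basis vector of a free module of rank `m`, and a slack variable used to
homogenize. -/
abbrev HTerm (m n : ℕ) := Fin m × (ℕ × (Fin n →₀ ℕ))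

/-- The total degree of a homogenized term. -/
noncomputable def HTerm.deg (q : HTerm m n) : ℕ := q.2.1 + q.2.2.degree

/-- Divisibility of homogenized terms. -/
def HTerm.Dvd (q q' : HTerm m n) : Prop := q.1 = q'.1 ∧ q.2 ≤ q'.2

lemma HTerm.wellQuasiOrdered_dvd : WellQuasiOrdered (HTerm.Dvd (m := m) (n := n)) :=
  WellQuasiOrdered.prod (r := fun i j : Fin m => i = j) (Finite.wellQuasiOrdered _)
    wellQuasiOrdered_le

/-- The homogenized terms of degree `e`. -/
def HLevel (m n e : ℕ) := {q : HTerm m n // q.deg = e}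

lemma HTerm.finite_deg_eq (e : ℕ) : {q : HTerm m n | q.deg = e}.Finite := by
  have h1 : {a : Fin n →₀ ℕ | a.degree ≤ e}.Finite := Finsupp.finite_of_degree_le e
  refine ((Set.finite_univ (α := Fin m)).prod ((Set.finite_Iic e).prod h1)).subset ?_
  rintro ⟨i, k, a⟩ h
  simp only [HTerm.deg, Set.mem_ofPred_eq] at h
  simp only [Set.mem_prod, Set.mem_univ, Set.mem_Iic, Set.mem_ofPred_eq, true_and]
  omega

noncomputable instance (e : ℕ) : Fintype (HLevel m n e) :=
  (HTerm.finite_deg_eq e).fintype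

/-- The sorting key on terms: first the lexicographic order on monomials, then the basis vector. -/
noncomputable def HLevel.key {e : ℕ} (q : HLevel m n e) :
    (MonomialOrder.lex (σ := Fin n)).syn ×ₗ Fin m :=
  toLex (MonomialOrder.lex.toSyn q.1.2.2, q.1.1)

lemma HLevel.ext_key {e : ℕ} {q q' : HLevel m n e} (h1 : q.1.1 = q'.1.1)
    (h2 : q.1.2.2 = q'.1.2.2) : q = q' := by
  obtain ⟨⟨i, k, a⟩, h⟩ := q
  obtain ⟨⟨i', k', a'⟩, h'⟩ := q'
  simp only [HTerm.deg] at h h' h1 h2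
  subst h1 h2
  have : k = k' := by omega
  subst this
  rfl

lemma HLevel.key_injective {e : ℕ} :
    Function.Injective (HLevel.key (m := m) (n := n) (e := e)) := by
  intro q q' h
  have h' := toLex.injective h
  rw [Prod.mk.injEq] at h'
  exact HLevel.ext_key h'.2 (MonomialOrder.lex.toSyn.injective h'.1)

noncomputable instance (e : ℕ) : LinearOrder (HLevel m n e) :=
  LinearOrder.lift' HLevel.key HLevel.key_injective

lemma HLevel.lt_iff {e : ℕ} {q q' : HLevel m n e} : q < q' ↔
    MonomialOrder.lex.toSyn q.1.2.2 < MonomialOrder.lex.toSyn q'.1.2.2 ∨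
      MonomialOrder.lex.toSyn q.1.2.2 = MonomialOrder.lex.toSyn q'.1.2.2 ∧ q.1.1 < q'.1.1 := by
  change HLevel.key q < HLevel.key q' ↔ _
  exact Prod.Lex.toLex_lt_toLex

variable {D : Type u} [CommRing D]

/-- The vector of polynomials of degree at most `e` with prescribed coefficients. -/
noncomputable def assemble (e : ℕ) :
    (HLevel m n e → D) →ₗ[D] (Fin m → MvPolynomial (Fin n) D) where
  toFun f i := ∑ q : HLevel m n e, if q.1.1 = i then monomial q.1.2.2 (f q) else 0
  map_add' f g := by
    ext1 i
    simp only [Pi.add_apply, map_add, ← Finset.sum_add_distrib]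
    exact Finset.sum_congr rfl fun q _ => by split_ifs <;> simp
  map_smul' c f := by
    ext1 i
    simp only [Pi.smul_apply, smul_eq_mul, RingHom.id_apply, Finset.smul_sum]
    exact Finset.sum_congr rfl fun q _ => by split_ifs <;> simp [smul_monomial]

lemma coeff_assemble {e : ℕ} (f : HLevel m n e → D) (q : HLevel m n e) :
    coeff q.1.2.2 (assemble e f q.1.1) = f q := by
  classical
  simp only [assemble, LinearMap.coe_mk, AddHom.coe_mk, coeff_sum]
  rw [Finset.sum_eq_single q]
  · simp
  · intro q' _ hne
    split_ifs with h
    · rw [coeff_monomial, if_neg fun h2 => hne (HLevel.ext_key h h2)]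
    · simp
  · simp

lemma coeff_assemble_eq_zero {e : ℕ} (f : HLevel m n e → D) (i : Fin m) (a : Fin n →₀ ℕ)
    (ha : e < a.degree) : coeff a (assemble e f i) = 0 := by
  classical
  simp only [assemble, LinearMap.coe_mk, AddHom.coe_mk, coeff_sum]
  refine Finset.sum_eq_zero fun q _ => ?_
  split_ifs
  · rw [coeff_monomial, if_neg]
    rintro rfl
    have := q.2
    simp only [HTerm.deg] at this
    omega
  · simp

lemma assemble_coeff {e : ℕ} (z : Fin m → MvPolynomial (Fin n) D)
    (hz : ∀ i, ∀ a : Fin n →₀ ℕ, e < a.degree → coeff a (z i) = 0) :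
    assemble e (fun q => coeff q.1.2.2 (z q.1.1)) = z := by
  ext i a
  rcases lt_or_ge e a.degree with h | h
  · rw [hz i a h, coeff_assemble_eq_zero _ _ _ h]
  · exact coeff_assemble (fun q : HLevel m n e => coeff q.1.2.2 (z q.1.1))
      ⟨(i, e - a.degree, a), by simp only [HTerm.deg]; omega⟩

/-- The coefficient vectors of the elements of degree at most `e` of a submodule. -/
noncomputable def levelPart
    (N : Submodule (MvPolynomial (Fin n) D) (Fin m → MvPolynomial (Fin n) D)) (e : ℕ) :
    Submodule D (HLevel m n e → D) :=
  (N.restrictScalars D).comap (assemble e)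

variable {N : Submodule (MvPolynomial (Fin n) D) (Fin m → MvPolynomial (Fin n) D)}

lemma mem_levelPart {e : ℕ} {f : HLevel m n e → D} : f ∈ levelPart N e ↔ assemble e f ∈ N :=
  Iff.rfl

lemma exists_assemble_eq (w : Fin m → MvPolynomial (Fin n) D) :
    ∃ d, ∀ e, d ≤ e → ∃ f : HLevel m n e → D, assemble e f = w := by
  refine ⟨Finset.univ.sup fun i => (w i).totalDegree, fun e he => ⟨_, assemble_coeff w ?_⟩⟩
  intro i a ha
  apply coeff_eq_zero_of_totalDegree_lt
  have : (w i).totalDegree ≤ e := le_trans (Finset.le_sup (f := fun i => (w i).totalDegree)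
    (Finset.mem_univ i)) he
  exact lt_of_le_of_lt this ha

lemma exists_assemble_eq_of_le {d e : ℕ} (hde : d ≤ e) (f : HLevel m n d → D) :
    ∃ g : HLevel m n e → D, assemble e g = assemble d f :=
  ⟨_, assemble_coeff _ fun i a ha => coeff_assemble_eq_zero f i a (hde.trans_lt ha)⟩

lemma saturated_levelPart [IsDomain D]
    (hN : ∀ c : MvPolynomial (Fin n) D, c ≠ 0 → ∀ v, c • v ∈ N → v ∈ N) (e : ℕ) (c : D)
    (hc : c ≠ 0) (v) (hv : c • v ∈ levelPart N e) : v ∈ levelPart N e := by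
  rw [mem_levelPart] at hv ⊢
  refine hN (C c) (by simpa using hc) _ ?_
  rw [map_smul] at hv
  convert hv using 1
  ext1 i
  simp [C_mul']

/-- Multiplying by monomials moves leading terms along divisibility. -/
lemma exists_shift {p : Ideal D} (q q' : HTerm m n) (h : q.Dvd q')
    (f : HLevel m n q.deg → D) (hf : f ∈ levelPart N q.deg) (h1 : f ⟨q, rfl⟩ ∉ p)
    (h2 : ∀ t, ⟨q, rfl⟩ < t → f t ∈ p) :
    ∃ g : HLevel m n q'.deg → D, assemble _ g = monomial (q'.2.2 - q.2.2) (1 : D) • assemble _ f ∧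
      g ∈ levelPart N q'.deg ∧ g ⟨q', rfl⟩ ∉ p ∧ ∀ t, ⟨q', rfl⟩ < t → g t ∈ p := by
  classical
  obtain ⟨i, k, a⟩ := q
  obtain ⟨i', k', a'⟩ := q'
  obtain ⟨hi, hk, ha⟩ := h
  simp only at hi hk ha
  subst hi
  obtain ⟨b, rfl⟩ := le_iff_exists_add'.1 ha
  simp only [add_tsub_cancel_right]
  have hco : ∀ (x : Fin n →₀ ℕ) (j : Fin m),
      coeff x ((monomial b (1 : D) • assemble _ f) j) =
        if b ≤ x then coeff (x - b) (assemble _ f j) else 0 := by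
    intro x j
    rw [Pi.smul_apply, smul_eq_mul, coeff_monomial_mul', one_mul]
  have hg := assemble_coeff (e := HTerm.deg (i, k', b + a))
    (monomial b (1 : D) • assemble _ f) (by
    intro j x hx
    rw [hco]
    split_ifs with hbx
    · apply coeff_assemble_eq_zero
      obtain ⟨c, rfl⟩ := le_iff_exists_add.1 hbx
      simp only [HTerm.deg, map_add, add_tsub_cancel_left] at hx ⊢
      omega
    · rfl)
  refine ⟨_, hg, ?_, ?_, ?_⟩
  · rw [mem_levelPart, hg]
    exact N.smul_mem _ hf
  · simp only [hco]
    rw [if_pos le_self_add, add_tsub_cancel_left]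
    have := coeff_assemble f ⟨(i, k, a), rfl⟩
    simp only at this
    rwa [this]
  · rintro ⟨⟨j, l, x⟩, ht'⟩ ht
    simp only [hco]
    split_ifs with hbx
    · obtain ⟨c, rfl⟩ := le_iff_exists_add.1 hbx
      rw [add_tsub_cancel_left]
      rcases lt_or_ge (HTerm.deg (i, k, a)) c.degree with hlt | hge
      · rw [coeff_assemble_eq_zero _ _ _ hlt]; exact p.zero_mem
      · have hdeg : HTerm.deg (j, HTerm.deg (i, k, a) - c.degree, c) = HTerm.deg (i, k, a) := by
          simp only [HTerm.deg] at hge ⊢; omega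
        have := coeff_assemble f ⟨_, hdeg⟩
        simp only at this
        rw [this]
        replace ht := HLevel.lt_iff.1 ht
        refine h2 _ (HLevel.lt_iff.2 ?_)
        simpa using ht
    · exact p.zero_mem

/-- Saturated submodules of finite free modules over a polynomial ring in finitely many variables
over a Prüfer domain are finitely generated. -/
theorem IsPruferDomain.fg_of_saturated_mvPolynomial [IsDomain D] (hD : IsPruferDomain D)
    (N : Submodule (MvPolynomial (Fin n) D) (Fin m → MvPolynomial (Fin n) D))
    (hN : ∀ c : MvPolynomial (Fin n) D, c ≠ 0 → ∀ v, c • v ∈ N → v ∈ N) : N.FG := by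
  classical
  let T (p : Ideal D) : Set (HTerm m n) :=
    {q | IsPivot (levelPart N q.deg) p (⟨q, rfl⟩ : HLevel m n q.deg)}
  have hT : ∀ p e, {q ∈ T p | q.deg = e} =
      Subtype.val '' {t : HLevel m n e | IsPivot (levelPart N e) p t} := by
    intro p e
    ext q
    constructor
    · rintro ⟨hq, rfl⟩
      exact ⟨⟨q, rfl⟩, hq, rfl⟩
    · rintro ⟨⟨q, rfl⟩, hq, rfl⟩
      exact ⟨hq, rfl⟩
  obtain ⟨d, hd⟩ := HTerm.wellQuasiOrdered_dvd.exists_uniform_degree_bound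
    (fun _ => ⟨rfl, le_rfl⟩) (fun _ _ _ h h' => ⟨h.1.trans h'.1, h.2.trans h'.2⟩)
    HTerm.deg HTerm.finite_deg_eq (T '' {p | p.IsMaximal})
    (by
      rintro _ ⟨p, hp, rfl⟩ q ⟨f, hf, h1, h2⟩ q' hqq'
      obtain ⟨g, -, hg⟩ := exists_shift q q' hqq' f hf h1 h2
      exact ⟨g, hg⟩)
    (by
      rintro _ ⟨p, hp, rfl⟩ _ ⟨p', hp', rfl⟩ e
      have : p.IsPrime := Ideal.IsMaximal.isPrime hp
      have : p'.IsPrime := Ideal.IsMaximal.isPrime hp'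
      rw [hT, hT, Set.ncard_image_of_injective _ Subtype.val_injective,
        Set.ncard_image_of_injective _ Subtype.val_injective]
      exact le_antisymm (ncard_pivots_le hD (saturated_levelPart hN e) _ _)
        (ncard_pivots_le hD (saturated_levelPart hN e) _ _))
  set N₀ : Submodule (MvPolynomial (Fin n) D) (Fin m → MvPolynomial (Fin n) D) :=
    Submodule.span _ (assemble d '' levelPart N d) with hN₀
  have hN₀fg : N₀.FG := by
    obtain ⟨s, hs⟩ := hD.fg_of_saturated (saturated_levelPart hN d)
    refine ⟨s.image (assemble d), le_antisymm (Submodule.span_mono ?_) (Submodule.span_le.2 ?_)⟩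
    · rw [Finset.coe_image]
      exact Set.image_mono (hs ▸ Submodule.subset_span)
    · rintro _ ⟨f, hf, rfl⟩
      rw [← hs] at hf
      have := Submodule.mem_map_of_mem (f := assemble d) hf
      rw [Submodule.map_span] at this
      rw [Finset.coe_image]
      exact Submodule.span_le_restrictScalars D (MvPolynomial (Fin n) D) _ this
  have hmem : ∀ e ≤ d, ∀ f ∈ levelPart N e, assemble e f ∈ N₀ := by
    intro e he f hf
    obtain ⟨g, hg⟩ := exists_assemble_eq_of_le he f
    rw [← hg]
    exact Submodule.subset_span ⟨g, by rw [SetLike.mem_coe, mem_levelPart, hg]; exact hf, rfl⟩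
  suffices N = N₀ by rwa [this]
  refine le_antisymm (fun w hw => ?_) (Submodule.span_le.2 ?_)
  swap
  · rintro _ ⟨f, hf, rfl⟩
    exact hf
  let I : Ideal D :=
    { carrier := {s | s • w ∈ N₀}
      zero_mem' := by simp
      add_mem' := fun {a b} ha hb => by
        simp only [Set.mem_ofPred_eq, add_smul] at ha hb ⊢
        exact N₀.add_mem ha hb
      smul_mem' := fun c a ha => by
        simp only [Set.mem_ofPred_eq, smul_eq_mul, mul_smul] at ha ⊢
        exact (N₀.restrictScalars D).smul_mem c ha }
  suffices I = ⊤ by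
    have h : (1 : D) ∈ I := this ▸ Submodule.mem_top
    simpa using (show (1 : D) • w ∈ N₀ from h)
  by_contra hI
  obtain ⟨p, hp, hIp⟩ := I.exists_le_maximal hI
  have := hp.isPrime
  obtain ⟨e, he⟩ := exists_assemble_eq w
  obtain ⟨f, hf⟩ := he e le_rfl
  have hz : ∀ t : {t // IsPivot (levelPart N e) p t}, ∃ g ∈ levelPart N e, assemble e g ∈ N₀ ∧
      g t ∉ p ∧ ∀ t', t.1 < t' → g t' ∈ p := by
    rintro ⟨⟨q, rfl⟩, hq⟩
    obtain ⟨q', ⟨f, hfN, h1, h2⟩, hqd, hqq'⟩ := hd _ ⟨p, hp, rfl⟩ q hq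
    obtain ⟨g, hg, hg1, hg2⟩ := exists_shift q' q hqq' f hfN h1 h2
    exact ⟨g, hg1, hg ▸ N₀.smul_mem _ (hmem _ hqd f hfN), hg2⟩
  choose z hzN hz₀ hz1 hz2 using hz
  obtain ⟨s, hs, h⟩ := exists_smul_mem_span_pivots hD (saturated_levelPart hN e) z hzN hz1 hz2
  refine hs (hIp ?_)
  change s • w ∈ N₀
  have h3 : Submodule.span D (Set.range z) ≤ (N₀.restrictScalars D).comap (assemble e) := by
    rw [Submodule.span_le]
    rintro _ ⟨t, rfl⟩
    exact hz₀ t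
  have h4 := h3 (h f (by rw [mem_levelPart, hf]; exact hw))
  rw [Submodule.mem_comap, map_smul, hf] at h4
  exact h4

end Coherence

section IntegralClosureFinite

open Polynomial in
/-- If a finite extension `K` of the fraction field of a Noetherian domain `A` becomes separable
after an extension `A'` of `A` adjoining enough `q ^ e`-th roots, then the integral closure of `A`
in `K` is finite. -/
lemma finite_integralClosure_of_exists_roots {A L K A' : Type*} [CommRing A] [IsDomain A]
    [IsNoetherianRing A] [Field L] [Algebra A L] [IsFractionRing A L] [Field K] [Algebra L K]
    [Algebra A K] [IsScalarTower A L K] [FiniteDimensional L K]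
    [CommRing A'] [IsDomain A'] [IsNoetherianRing A'] [IsIntegrallyClosed A'] [Algebra A A']
    [Module.Finite A A'] (hinj : Function.Injective (algebraMap A A')) (q e : ℕ) [ExpChar A' q]
    (S : Set K) (hS : S.Finite) (hspan : Submodule.span L S = ⊤) (f : K → A[X])
    (hsep : ∀ x ∈ S, ((f x).map (algebraMap A L)).Separable)
    (hroot : ∀ x ∈ S, aeval (x ^ q ^ e) (f x) = 0)
    (hf : ∀ x ∈ S, ∀ k, algebraMap A A' ((f x).coeff k) ∈ Set.range (iterateFrobenius A' q e)) :
    Module.Finite A (integralClosure A K) := by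
  let L' := FractionRing A'
  let Ω := AlgebraicClosure L'
  have hA'Ω : Function.Injective (algebraMap A' Ω) := by
    rw [IsScalarTower.algebraMap_eq A' L' Ω]
    exact (algebraMap L' Ω).injective.comp (IsFractionRing.injective A' L')
  have hAΩ : Function.Injective (algebraMap A Ω) := by
    rw [IsScalarTower.algebraMap_eq A A' Ω]
    exact hA'Ω.comp hinj
  have hAL' : Function.Injective (algebraMap A L') := by
    rw [IsScalarTower.algebraMap_eq A A' L']
    exact (IsFractionRing.injective A' L').comp hinj
  let ρ : L →+* L' := IsFractionRing.lift hAL'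
  let : Algebra L L' := ρ.toAlgebra
  have hρ : ∀ a, algebraMap L L' (algebraMap A L a) = algebraMap A L' a :=
    IsFractionRing.lift_algebraMap hAL'
  have : IsScalarTower A L Ω := IsScalarTower.of_algebraMap_eq fun a => by
    rw [IsScalarTower.algebraMap_apply L L' Ω, hρ, ← IsScalarTower.algebraMap_apply A L' Ω]
  let φ : K →ₐ[L] Ω := IsAlgClosed.lift
  have : ExpChar L' q := expChar_of_injective_algebraMap (IsFractionRing.injective A' L') q
  have : ExpChar Ω q := expChar_of_injective_algebraMap hA'Ω q
  have hsepφ : ∀ x ∈ S, IsSeparable L' (φ x) := by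
    intro x hx
    have h1 : (f x).map (algebraMap A A') ∈ lifts (iterateFrobenius A' q e) := by
      rw [lifts_iff_coeff_lifts]
      intro k
      rw [coeff_map]
      exact hf x hx k
    obtain ⟨g, hg⟩ := (mem_lifts _).1 h1
    have h2 : (g.map (algebraMap A' L')).map (iterateFrobenius L' q e) =
        ((f x).map (algebraMap A L)).map (algebraMap L L') := by
      have h3 : (iterateFrobenius L' q e).comp (algebraMap A' L') =
          (algebraMap A' L').comp (iterateFrobenius A' q e) := by
        ext a; simp [iterateFrobenius_def]
      have h4 : (algebraMap L L').comp (algebraMap A L) =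
          (algebraMap A' L').comp (algebraMap A A') := by
        rw [← IsScalarTower.algebraMap_eq A A' L']
        ext a; exact hρ a
      rw [map_map, map_map, h3, h4, ← map_map, ← map_map, hg]
    have h5 : (g.map (algebraMap A' L')).Separable := by
      rw [← separable_map (iterateFrobenius L' q e), h2]
      exact (hsep x hx).map
    have h6 : aeval (φ x) (g.map (algebraMap A' L')) = 0 := by
      have h7 : aeval (φ x ^ q ^ e) (f x) = 0 := by
        have := hroot x hx
        have h8 := congrArg (φ.restrictScalars A) this
        rw [map_zero, ← aeval_algHom_apply] at h8
        simpa using h8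
      apply iterateFrobenius_inj Ω q e
      rw [map_zero, aeval_map_algebraMap, aeval_def, hom_eval₂]
      have h3 : (iterateFrobenius Ω q e).comp (algebraMap A' Ω) =
          (algebraMap A' Ω).comp (iterateFrobenius A' q e) := by
        ext a; simp [iterateFrobenius_def]
      rw [h3, ← eval₂_map, hg, eval₂_map, ← IsScalarTower.algebraMap_eq, iterateFrobenius_def]
      exact h7
    exact h5.of_dvd (minpoly.dvd L' (φ x) h6)
  let M := IntermediateField.adjoin L' (φ '' S)
  have : Finite (φ '' S) := (hS.image φ).to_subtype
  have : FiniteDimensional L' M := IntermediateField.finiteDimensional_adjoin (by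
    rintro _ ⟨x, hx, rfl⟩
    exact (hsepφ x hx).isIntegral)
  have : Algebra.IsSeparable L' M := by
    rw [IntermediateField.isSeparable_adjoin_iff_isSeparable]
    rintro _ ⟨x, hx, rfl⟩
    exact hsepφ x hx
  have hM : ∀ x, φ x ∈ M := by
    intro x
    have hx : x ∈ Submodule.span L S := hspan ▸ Submodule.mem_top
    induction hx using Submodule.span_induction with
    | mem x hx => exact IntermediateField.subset_adjoin _ _ ⟨x, hx, rfl⟩
    | zero => rw [map_zero]; exact M.zero_mem
    | add x y _ _ hx hy => rw [map_add]; exact M.add_mem hx hy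
    | smul a x _ hx =>
      rw [map_smul, Algebra.smul_def, IsScalarTower.algebraMap_apply L L' Ω]
      exact M.mul_mem (M.algebraMap_mem _) hx
  have hfin : Module.Finite A' (integralClosure A' M) :=
    IsIntegralClosure.finite A' L' M (integralClosure A' M)
  let τ : integralClosure A' M →ₗ[A'] Ω :=
    ((M.val.restrictScalars A').toLinearMap).comp (integralClosure A' M).val.toLinearMap
  have : Module.Finite A (LinearMap.range τ) := Module.Finite.trans A' (LinearMap.range τ)
  have hnoeth : IsNoetherian A (LinearMap.range τ) := isNoetherian_of_isNoetherianRing_of_finite A _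
  have : IsNoetherian A ((LinearMap.range τ).restrictScalars A) := hnoeth
  let κ : integralClosure A K →ₗ[A] Ω :=
    ((φ.restrictScalars A).toLinearMap).comp (integralClosure A K).val.toLinearMap
  have hκ : ∀ x, κ x ∈ (LinearMap.range τ).restrictScalars A := by
    rintro ⟨x, hx⟩
    have h1 : IsIntegral A' (φ x) := (IsIntegral.map (φ.restrictScalars A) hx).tower_top
    have h2 : IsIntegral A' (⟨φ x, hM x⟩ : M) :=
      (isIntegral_algHom_iff (M.val.restrictScalars A') M.val.injective).1 h1
    exact ⟨⟨⟨φ x, hM x⟩, h2⟩, rfl⟩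
  exact Module.Finite.of_injective (κ.codRestrict ((LinearMap.range τ).restrictScalars A) hκ) (by
    intro x y hxy
    have h1 : φ x = φ y := congrArg Subtype.val hxy
    exact Subtype.ext (φ.injective h1))

open MvPolynomial in
/-- Taking `Q`-th powers of the variables and extending the coefficients is a finite map. -/
lemma MvPolynomial.finite_aeval_X_pow (F F' σ : Type*) [Field F] [Field F'] [Algebra F F']
    [FiniteDimensional F F'] [Finite σ] {Q : ℕ} (hQ : 0 < Q) :
    (aeval (R := F) (fun i : σ => (X i : MvPolynomial σ F') ^ Q)).toRingHom.Finite := by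
  apply RingHom.IsIntegral.to_finite
  · let := (aeval (R := F) (fun i : σ => (X i : MvPolynomial σ F') ^ Q)).toRingHom.toAlgebra
    have : IsScalarTower F (MvPolynomial σ F) (MvPolynomial σ F') :=
      IsScalarTower.of_algebraMap_eq fun a =>
        ((aeval (R := F) (fun i : σ => (X i : MvPolynomial σ F') ^ Q)).commutes a).symm
    intro p
    change IsIntegral (MvPolynomial σ F) p
    induction p using MvPolynomial.induction_on with
    | C a =>
      have h1 : IsIntegral F (algebraMap F' (MvPolynomial σ F') a) :=
        (Algebra.IsIntegral.isIntegral (R := F) a).map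
          (IsScalarTower.toAlgHom F F' (MvPolynomial σ F'))
      exact h1.tower_top
    | add p q hp hq => exact hp.add hq
    | mul_X p i hp =>
      refine hp.mul (IsIntegral.of_pow hQ ?_)
      have : algebraMap (MvPolynomial σ F) (MvPolynomial σ F') (X i) = X i ^ Q := aeval_X _ i
      rw [← this]
      exact isIntegral_algebraMap
  · have h1 : Algebra.FiniteType F (MvPolynomial σ F') :=
      Algebra.FiniteType.trans (S := F') inferInstance inferInstance
    let := (aeval (R := F) (fun i : σ => (X i : MvPolynomial σ F') ^ Q)).toRingHom.toAlgebra
    have : IsScalarTower F (MvPolynomial σ F) (MvPolynomial σ F') :=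
      IsScalarTower.of_algebraMap_eq fun a =>
        ((aeval (R := F) (fun i : σ => (X i : MvPolynomial σ F') ^ Q)).commutes a).symm
    exact Algebra.FiniteType.of_restrictScalars_finiteType F (MvPolynomial σ F) _

open MvPolynomial in
/-- The integral closure of a polynomial ring over a field in a finite extension of its fraction
field is finite. -/
theorem MvPolynomial.finite_integralClosure (F σ L K : Type*) [Field F] [Finite σ] [Field L]
    [Algebra (MvPolynomial σ F) L] [IsFractionRing (MvPolynomial σ F) L] [Field K] [Algebra L K]
    [Algebra (MvPolynomial σ F) K] [IsScalarTower (MvPolynomial σ F) L K]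
    [FiniteDimensional L K] :
    Module.Finite (MvPolynomial σ F) (integralClosure (MvPolynomial σ F) K) := by
  classical
  let A := MvPolynomial σ F
  obtain ⟨s, b, hb⟩ := FiniteDimensional.exists_is_basis_integral A L K
  let q := ringExpChar F
  have : ExpChar F q := ringExpChar.expChar F
  have : ExpChar L q := by
    have : ExpChar A q := inferInstance
    exact expChar_of_injective_algebraMap (IsFractionRing.injective A L) q
  have := separableClosure.isPurelyInseparable L K
  have : ExpChar (separableClosure L K) q :=
    expChar_of_injective_algebraMap (algebraMap L (separableClosure L K)).injective q
  have hn : ∀ x : K, ∃ n, IsSeparable L (x ^ q ^ n) := by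
    intro x
    obtain ⟨n, y, hy⟩ := IsPurelyInseparable.pow_mem (separableClosure L K) q x
    exact ⟨n, by rw [← mem_separableClosure_iff, ← hy]; exact y.2⟩
  choose N hN using hn
  let e := Finset.univ.sup fun x : s => N (b x)
  have he : ∀ x : s, IsSeparable L (b x ^ q ^ e) := by
    intro x
    have hle : N (b x) ≤ e := Finset.le_sup (f := fun x : s => N (b x)) (Finset.mem_univ x)
    obtain ⟨k, hk⟩ := Nat.exists_eq_add_of_le hle
    rw [hk, pow_add, pow_mul, ← mem_separableClosure_iff]
    exact pow_mem (mem_separableClosure_iff.2 (hN _)) _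
  let Q := q ^ e
  have hQ : 0 < Q := pow_pos (expChar_pos F q) e
  let f : K → Polynomial A := fun x => minpoly A (x ^ Q)
  choose r hr using fun a : F =>
    IsAlgClosed.exists_pow_nat_eq (algebraMap F (AlgebraicClosure F) a) hQ
  let R : Set (AlgebraicClosure F) := ⋃ x : s, ⋃ k ∈ (f (b x)).support,
    ⋃ v ∈ ((f (b x)).coeff k).support, {r (coeff v ((f (b x)).coeff k))}
  have hR : R.Finite := Set.finite_iUnion fun x => Set.Finite.biUnion (Finset.finite_toSet _)
    fun k _ => Set.Finite.biUnion (Finset.finite_toSet _) fun v _ => Set.finite_singleton _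
  let F' := IntermediateField.adjoin F R
  have : Finite R := hR.to_subtype
  have : FiniteDimensional F F' := IntermediateField.finiteDimensional_adjoin fun x _ =>
    Algebra.IsIntegral.isIntegral x
  let A' := MvPolynomial σ F'
  let ψ : A →ₐ[F] A' := aeval fun i => X i ^ Q
  have : ExpChar F' q := expChar_of_injective_algebraMap (algebraMap F F').injective q
  let : Algebra A A' := ψ.toRingHom.toAlgebra
  have : Module.Finite A A' := MvPolynomial.finite_aeval_X_pow F F' σ hQ
  have hcoef : ∀ x : s, ∀ k v, ∃ y : F', y ^ Q = algebraMap F F' (coeff v ((f (b x)).coeff k)) := by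
    intro x k v
    by_cases h0 : coeff v ((f (b x)).coeff k) = 0
    · exact ⟨0, by rw [h0, map_zero, zero_pow hQ.ne']⟩
    · refine ⟨⟨r (coeff v ((f (b x)).coeff k)), IntermediateField.subset_adjoin F R ?_⟩, ?_⟩
      · simp only [R, Set.mem_iUnion]
        refine ⟨x, k, ?_, v, ?_, rfl⟩
        · rw [Polynomial.mem_support_iff]
          intro h; rw [h] at h0; exact h0 (coeff_zero v)
        · exact mem_support_iff.2 h0
      · exact Subtype.ext (hr _)
  refine finite_integralClosure_of_exists_roots (A := A) (L := L) (A' := A') ?_ q e (Set.range b)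
    (Set.finite_range b) b.span_eq f ?_ ?_ ?_
  · have hcomp : ψ.toRingHom = (expand Q).toRingHom.comp (map (algebraMap F F')) := by
      apply ringHom_ext
      · intro a
        rw [RingHom.comp_apply, map_C]
        exact (aeval_C _ a).trans (expand_C Q _).symm
      · intro i
        rw [RingHom.comp_apply, map_X]
        exact (aeval_X _ i).trans (expand_X Q i).symm
    change Function.Injective ψ.toRingHom
    rw [hcomp]
    exact (expand_injective hQ).comp (map_injective _ (algebraMap F F').injective)
  · rintro _ ⟨x, rfl⟩
    have := minpoly.isIntegrallyClosed_eq_field_fractions L K (hb x |>.pow Q)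
    rw [← this]
    exact he x
  · rintro _ ⟨x, rfl⟩
    exact minpoly.aeval _ _
  · rintro _ ⟨x, rfl⟩ k
    change ψ _ ∈ (iterateFrobenius A' q e).range
    rw [((f (b x)).coeff k).as_sum, map_sum]
    refine sum_mem fun v _ => ?_
    rw [aeval_monomial, Finsupp.prod]
    refine mul_mem ?_ (prod_mem fun i _ => ?_)
    · obtain ⟨y, hy⟩ := hcoef x k v
      refine RingHom.mem_range.2 ⟨C y, ?_⟩
      rw [iterateFrobenius_def, ← C_pow]
      change C (y ^ Q) = _
      rw [hy]
      rfl
    · exact pow_mem (RingHom.mem_range.2 ⟨X i, iterateFrobenius_def _ _ _⟩) _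

end IntegralClosureFinite

section Duality

open MvPolynomial in
/-- An element of a polynomial ring over a Prüfer domain that is divisible by a constant locally
at the extension of each maximal ideal is divisible by that constant. -/
lemma IsPruferDomain.C_dvd_of_forall_isMaximal {D : Type u} [CommRing D] [IsDomain D]
    (hD : IsPruferDomain D) {σ : Type*} {c : D} {v : MvPolynomial σ D}
    (h : ∀ m : Ideal D, m.IsMaximal →
      ∃ s ∉ m.map (C : D →+* MvPolynomial σ D), C c ∣ s * v) : C c ∣ v := by
  by_cases hv : v = 0
  · exact hv ▸ dvd_zero _
  let I : Ideal D :=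
    { carrier := {d | C c ∣ C d * v}
      add_mem' := fun {a b} ha hb => by
        change C c ∣ C (a + b) * v
        rw [C_add, add_mul]
        exact dvd_add ha hb
      zero_mem' := by
        change C c ∣ C 0 * v
        rw [C_0, zero_mul]
        exact dvd_zero _
      smul_mem' := fun a b hb => by
        change C c ∣ C (a * b) * v
        rw [C_mul, mul_assoc]
        exact dvd_mul_of_dvd_right hb _ }
  suffices hI : I = ⊤ by
    have h1 : (1 : D) ∈ I := hI ▸ Submodule.mem_top
    have h2 : C c ∣ C 1 * v := h1
    rwa [C_1, one_mul] at h2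
  by_contra hI
  obtain ⟨m, hm, hIm⟩ := I.exists_le_maximal hI
  have hp : m.IsPrime := hm.isPrime
  obtain ⟨s, hs, p, hp'⟩ := h m hm
  obtain ⟨i, hi⟩ := ne_zero_iff.1 hv
  obtain ⟨c', hc', d, hd, e, ⟨j, -, hj⟩, -, hout, he⟩ :=
    hD.exists_primitive m v.support (fun i => coeff i v) ⟨i, mem_support_iff.2 hi, hi⟩
  let E : MvPolynomial σ D := ∑ i ∈ v.support, monomial i (e i)
  have hE : ∀ i, coeff i E = e i := by
    intro i
    classical
    simp only [E, coeff_sum, coeff_monomial]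
    rw [Finset.sum_ite_eq']
    split_ifs with hi
    · rfl
    · exact (hout i hi).symm
  have hdE : C d * v = C c' * E := by
    ext i
    rw [coeff_C_mul, coeff_C_mul, hE]
    by_cases hi : i ∈ v.support
    · exact he i hi
    · rw [hout i hi, notMem_support_iff.1 hi, mul_zero, mul_zero]
  have hEm : E ∉ m.map (C : D →+* MvPolynomial σ D) := fun h =>
    hj (hE j ▸ mem_map_C_iff.1 h j)
  have hsE : s * E ∉ m.map (C : D →+* MvPolynomial σ D) := fun h =>
    ((isPrime_map_C hp σ).mem_or_mem h).elim hs hEm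
  rw [mem_map_C_iff] at hsE
  push Not at hsE
  obtain ⟨k, hk⟩ := hsE
  have h1 : C c' * (s * E) = C c * (C d * p) := by
    linear_combination C d * hp' - s * hdE
  have h2 : c' * coeff k (s * E) = c * coeff k (C d * p) := by
    rw [← coeff_C_mul, h1, coeff_C_mul]
  have h3 : coeff k (s * E) * d ∈ I := by
    refine ⟨C (coeff k (C d * p)) * E, ?_⟩
    rw [← mul_assoc, ← C_mul, ← h2, C_mul, C_mul]
    linear_combination C (coeff k (s * E)) * hdE
  exact (hp.mem_or_mem (hIm h3)).elim hk hd

open MvPolynomial in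
/-- The elements of a finite-dimensional vector space over the fraction field whose coordinates
are polynomials over a Prüfer domain form a finitely generated module. -/
lemma IsPruferDomain.exists_fg_submodule {D : Type u} [CommRing D] [IsDomain D]
    (hD : IsPruferDomain D) {n m : ℕ} {L U : Type*} [Field L] [Algebra (MvPolynomial (Fin n) D) L]
    [IsFractionRing (MvPolynomial (Fin n) D) L] [AddCommGroup U] [Module L U]
    [Module (MvPolynomial (Fin n) D) U] [IsScalarTower (MvPolynomial (Fin n) D) L U]
    (Φ : Fin m → U →ₗ[L] L) (hΦ : ∀ u, (∀ i, Φ i u = 0) → u = 0) :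
    ∃ N : Submodule (MvPolynomial (Fin n) D) U, N.FG ∧
      ∀ u, u ∈ N ↔ ∀ i, Φ i u ∈ Set.range (algebraMap (MvPolynomial (Fin n) D) L) := by
  let P := MvPolynomial (Fin n) D
  let Ψ : U →ₗ[L] (Fin m → L) := LinearMap.pi Φ
  have hΨ : LinearMap.ker (Ψ.restrictScalars P) = ⊥ := by
    rw [LinearMap.ker_eq_bot']
    intro u hu
    exact hΦ u fun i => congrFun hu i
  let α : (Fin m → P) →ₗ[P] (Fin m → L) := (Algebra.linearMap P L).compLeft (Fin m)
  have hα : ∀ v i, α v i = algebraMap P L (v i) := fun v i => rfl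
  let N₀ : Submodule P (Fin m → P) := (LinearMap.range (Ψ.restrictScalars P)).comap α
  have hN₀ : N₀.FG := by
    refine hD.fg_of_saturated_mvPolynomial N₀ fun c hc v hv => ?_
    obtain ⟨u, hu⟩ := hv
    have hc' : algebraMap P L c ≠ 0 := by
      rwa [Ne, FaithfulSMul.algebraMap_eq_zero_iff]
    refine ⟨(algebraMap P L c)⁻¹ • u, ?_⟩
    have h1 : Ψ u = α (c • v) := hu
    change Ψ _ = α v
    rw [map_smul, h1]
    funext i
    rw [Pi.smul_apply, hα, hα, Pi.smul_apply, smul_eq_mul, smul_eq_mul, map_mul,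
      inv_mul_cancel_left₀ hc']
  refine ⟨(N₀.map α).comap (Ψ.restrictScalars P), ?_, ?_⟩
  · refine Submodule.fg_of_fg_map_injective _ (LinearMap.ker_eq_bot.1 hΨ) ?_
    rw [Submodule.map_comap_eq_of_le]
    · exact hN₀.map α
    · rintro _ ⟨v, hv, rfl⟩
      exact hv
  · intro u
    constructor
    · rintro ⟨v, -, hv⟩ i
      exact ⟨v i, congrFun hv i⟩
    · intro h
      choose v hv using h
      have h1 : α v = Ψ u := funext hv
      exact ⟨v, ⟨u, h1.symm⟩, h1⟩

end Duality

section Finiteness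

open MvPolynomial

/-- The integral closure of a polynomial ring over a domain `D` in a finite extension of its
fraction field is, up to denominators from `D`, generated by finitely many elements. -/
lemma MvPolynomial.exists_finite_forall_smul_mem_span (D σ L K : Type*) [CommRing D] [IsDomain D]
    [Finite σ] [Field L] [Algebra (MvPolynomial σ D) L] [IsFractionRing (MvPolynomial σ D) L]
    [Field K] [Algebra L K] [Algebra (MvPolynomial σ D) K] [IsScalarTower (MvPolynomial σ D) L K]
    [FiniteDimensional L K] :
    ∃ G : Set K, G.Finite ∧ (∀ g ∈ G, IsIntegral (MvPolynomial σ D) g) ∧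
      ∀ c : K, IsIntegral (MvPolynomial σ D) c →
        ∃ d : D, d ≠ 0 ∧ (C d : MvPolynomial σ D) • c ∈ Submodule.span (MvPolynomial σ D) G := by
  let P := MvPolynomial σ D
  let F := FractionRing D
  let A := MvPolynomial σ F
  let M : Submonoid P := (nonZeroDivisors D).map C
  have hM : M ≤ nonZeroDivisors P := by
    rintro _ ⟨d, hd, rfl⟩
    rw [mem_nonZeroDivisors_iff_ne_zero]
    exact (map_ne_zero_iff _ (C_injective _ _)).2 (nonZeroDivisors.ne_zero hd)
  let : Algebra P A := algebraMvPolynomial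
  have : IsLocalization M A := MvPolynomial.isLocalization (nonZeroDivisors D) F
  let : Algebra A L := IsLocalization.localizationAlgebraOfSubmonoidLe A L M _ hM
  have : IsScalarTower P A L :=
    IsLocalization.localization_isScalarTower_of_submonoid_le A L M _ hM
  have : IsFractionRing A L := IsFractionRing.isFractionRing_of_isDomain_of_isLocalization M A L
  let : Algebra A K := ((algebraMap L K).comp (algebraMap A L)).toAlgebra
  have : IsScalarTower A L K := IsScalarTower.of_algebraMap_eq fun _ => rfl
  have : IsScalarTower P A K := IsScalarTower.of_algebraMap_eq fun p => by
    rw [IsScalarTower.algebraMap_apply A L K, ← IsScalarTower.algebraMap_apply P A L,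
      ← IsScalarTower.algebraMap_apply P L K]
  obtain ⟨s, hs⟩ := (MvPolynomial.finite_integralClosure F σ L K).fg_top
  choose t ht using fun x : integralClosure A K =>
    IsIntegral.exists_multiple_integral_of_isLocalization M (x : K) x.2
  refine ⟨(fun x : integralClosure A K => t x • (x : K)) '' s, s.finite_toSet.image _, ?_, ?_⟩
  · rintro _ ⟨x, -, rfl⟩
    exact ht x
  · intro c hc
    have hcs : ∀ y : integralClosure A K, y ∈ Submodule.span A (s : Set (integralClosure A K)) →
        (y : K) ∈ Submodule.span A
          ((fun x : integralClosure A K => t x • (x : K)) '' s) := by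
      intro y hy
      induction hy using Submodule.span_induction with
      | mem x hx =>
        obtain ⟨u, hu⟩ := IsLocalization.map_units A (t x)
        have h1 : (x : K) = (↑u⁻¹ : A) • (t x • (x : K)) := by
          rw [Submonoid.smul_def, ← algebraMap_smul A (t x : P) (x : K), ← hu, smul_smul,
            Units.inv_mul, one_smul]
        rw [h1]
        exact Submodule.smul_mem _ _ (Submodule.subset_span ⟨x, hx, rfl⟩)
      | zero => exact zero_mem _
      | add x y _ _ hx hy => exact add_mem hx hy
      | smul a x _ hx => exact Submodule.smul_mem _ a hx
    obtain ⟨⟨_, d, hd, rfl⟩, hm⟩ := multiple_mem_span_of_mem_localization_span M A _ c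
      (hcs ⟨c, hc.tower_top⟩ (hs ▸ Submodule.mem_top))
    exact ⟨d, mem_nonZeroDivisors_iff_ne_zero.1 hd, hm⟩

/-- Let `P` be a polynomial ring over a Prüfer domain `D`. If the integral closure of `P` in a
finite extension of its fraction field agrees with a finite `P`-subalgebra locally at the extension
of each maximal ideal of `D`, then it is finite. -/
lemma IsPruferDomain.finite_integralClosure {D : Type u} [CommRing D] [IsDomain D]
    (hD : IsPruferDomain D) (n : ℕ) (L K : Type*) [Field L] [Algebra (MvPolynomial (Fin n) D) L]
    [IsFractionRing (MvPolynomial (Fin n) D) L] [Field K] [Algebra L K]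
    [Algebra (MvPolynomial (Fin n) D) K] [IsScalarTower (MvPolynomial (Fin n) D) L K]
    [FiniteDimensional L K] (B : Subalgebra (MvPolynomial (Fin n) D) K)
    (hB : B.toSubmodule.FG)
    (hloc : ∀ c : K, IsIntegral (MvPolynomial (Fin n) D) c → ∀ m : Ideal D, m.IsMaximal →
      ∃ s ∉ m.map (C : D →+* MvPolynomial (Fin n) D), s • c ∈ B) :
    (integralClosure (MvPolynomial (Fin n) D) K).toSubmodule.FG := by
  let P := MvPolynomial (Fin n) D
  obtain ⟨G, hGfin, hGint, hG⟩ := MvPolynomial.exists_finite_forall_smul_mem_span D (Fin n) L K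
  obtain ⟨M, hMfg, hBM, hGM⟩ : ∃ M : Subalgebra P K, M.toSubmodule.FG ∧ B ≤ M ∧ G ⊆ M := by
    obtain ⟨T, hT⟩ := hB
    refine ⟨Algebra.adjoin P (T ∪ G), fg_adjoin_of_finite (T.finite_toSet.union hGfin) ?_, ?_, ?_⟩
    · rintro x (hx | hx)
      · refine IsIntegral.of_mem_of_fg B ⟨T, hT⟩ x ?_
        rw [← Subalgebra.mem_toSubmodule, ← hT]
        exact Submodule.subset_span hx
      · exact hGint x hx
    · rw [← Subalgebra.toSubmodule.le_iff_le, ← hT, Submodule.span_le]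
      exact Set.subset_union_left.trans Algebra.subset_adjoin
    · exact Set.subset_union_right.trans Algebra.subset_adjoin
  have hdiv : ∀ c : K, IsIntegral P c → ∃ d : D, d ≠ 0 ∧ (C d : P) • c ∈ M := by
    intro c hc
    obtain ⟨d, hd, h⟩ := hG c hc
    have hle : Submodule.span P G ≤ M.toSubmodule := Submodule.span_le.2 hGM
    exact ⟨d, hd, hle h⟩
  obtain ⟨m, g, hg⟩ := Submodule.fg_iff_exists_fin_generating_family.1 hMfg
  have hvanish : ∀ φ : K →ₗ[L] L, (∀ i, Module.Dual.eval L K (g i) φ = 0) → φ = 0 := by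
    intro φ hφ
    have hle : M.toSubmodule ≤ LinearMap.ker (φ.restrictScalars P) := by
      rw [← hg, Submodule.span_le]
      rintro _ ⟨i, rfl⟩
      exact hφ i
    ext k
    obtain ⟨p, hp⟩ := IsIntegral.exists_multiple_integral_of_isLocalization (nonZeroDivisors P) k
      (Algebra.IsIntegral.isIntegral (R := L) k)
    obtain ⟨d, hd, h⟩ := hdiv _ hp
    have h1 : φ.restrictScalars P (((C d : P) * p) • k) = 0 := by
      rw [mul_smul]
      exact hle h
    rw [map_smul, ← algebraMap_smul L, smul_eq_zero] at h1
    refine h1.resolve_left ?_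
    rw [FaithfulSMul.algebraMap_eq_zero_iff]
    exact mul_ne_zero ((map_ne_zero_iff _ (C_injective _ _)).2 hd) (nonZeroDivisors.ne_zero p.2)
  obtain ⟨M', hM'fg, hM'⟩ := hD.exists_fg_submodule (n := n)
    (fun i => Module.Dual.eval L K (g i)) hvanish
  have hM'M : ∀ φ, φ ∈ M' ↔ ∀ k ∈ M, φ k ∈ LinearMap.range (Algebra.linearMap P L) := by
    intro φ
    rw [hM']
    constructor
    · intro h
      have hle : M.toSubmodule ≤
          (LinearMap.range (Algebra.linearMap P L)).comap (φ.restrictScalars P) := by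
        rw [← hg, Submodule.span_le]
        rintro _ ⟨i, rfl⟩
        exact h i
      exact fun k hk => hle hk
    · intro h i
      refine h _ ?_
      rw [← Subalgebra.mem_toSubmodule, ← hg]
      exact Submodule.subset_span ⟨i, rfl⟩
  obtain ⟨r, f, hf⟩ := Submodule.fg_iff_exists_fin_generating_family.1 hM'fg
  have hsep : ∀ k : K, (∀ i, f i k = 0) → k = 0 := by
    intro k hk
    have hle : M' ≤ LinearMap.ker ((Module.Dual.eval L K k).restrictScalars P) := by
      rw [← hf, Submodule.span_le]
      rintro _ ⟨i, rfl⟩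
      exact hk i
    rw [← Module.forall_dual_apply_eq_zero_iff L]
    intro ψ
    obtain ⟨b, hb⟩ := IsLocalization.exist_integer_multiples_of_finite (nonZeroDivisors P)
      fun i => ψ (g i)
    have h1 : (b : P) • ψ ∈ M' := (hM' _).2 hb
    have h2 : (b : P) • ψ k = 0 := hle h1
    rw [← algebraMap_smul L, smul_eq_zero] at h2
    refine h2.resolve_left ?_
    rw [FaithfulSMul.algebraMap_eq_zero_iff]
    exact nonZeroDivisors.ne_zero b.2
  obtain ⟨N, hNfg, hN⟩ := hD.exists_fg_submodule (n := n) f hsep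
  have hNM' : ∀ k, k ∈ N ↔ ∀ φ ∈ M', φ k ∈ LinearMap.range (Algebra.linearMap P L) := by
    intro k
    rw [hN]
    constructor
    · intro h
      have hle : M' ≤ (LinearMap.range (Algebra.linearMap P L)).comap
          ((Module.Dual.eval L K k).restrictScalars P) := by
        rw [← hf, Submodule.span_le]
        rintro _ ⟨i, rfl⟩
        exact h i
      exact fun φ hφ => hle hφ
    · intro h i
      refine h _ ?_
      rw [← hf]
      exact Submodule.subset_span ⟨i, rfl⟩
  have hmul : ∀ x ∈ N, ∀ y ∈ N, x * y ∈ N := by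
    intro x hx y hy
    have hy' : ∀ φ ∈ M', φ ∘ₗ LinearMap.mulRight L y ∈ M' := by
      intro φ hφ
      rw [hM'M]
      intro z hz
      refine (hNM' y).1 hy (φ ∘ₗ LinearMap.mulLeft L z) ?_
      rw [hM'M]
      exact fun w hw => (hM'M φ).1 hφ _ (M.mul_mem hz hw)
    rw [hNM']
    exact fun φ hφ => (hNM' x).1 hx _ (hy' φ hφ)
  have h1N : (1 : K) ∈ N := (hNM' 1).2 fun φ hφ => (hM'M φ).1 hφ 1 M.one_mem
  suffices h : (integralClosure P K).toSubmodule = N from h ▸ hNfg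
  apply le_antisymm
  · intro c hc
    rw [hNM']
    intro φ hφ
    obtain ⟨d, hd, hdc⟩ := hdiv c hc
    obtain ⟨v, hv⟩ := (hM'M φ).1 hφ _ hdc
    have hv' : algebraMap P L v = algebraMap P L (C d) * φ c := by
      rw [← Algebra.smul_def, ← LinearMap.map_smul_of_tower]
      exact hv
    obtain ⟨p, hp⟩ : C d ∣ v := by
      refine hD.C_dvd_of_forall_isMaximal fun 𝔪 h𝔪 => ?_
      obtain ⟨s, hs, hsc⟩ := hloc c hc 𝔪 h𝔪
      obtain ⟨p, hp⟩ := (hM'M φ).1 hφ _ (hBM hsc)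
      have hp' : algebraMap P L p = algebraMap P L s * φ c := by
        rw [← Algebra.smul_def, ← LinearMap.map_smul_of_tower]
        exact hp
      refine ⟨s, hs, p, IsFractionRing.injective P L ?_⟩
      rw [map_mul, map_mul, hv', hp']
      ring
    refine ⟨p, mul_left_cancel₀ (a := algebraMap P L (C d)) ?_ ?_⟩
    · rw [Ne, FaithfulSMul.algebraMap_eq_zero_iff]
      exact (map_ne_zero_iff _ (C_injective _ _)).2 hd
    · rw [← hv', hp, map_mul]
      rfl
  · intro x hx
    exact isIntegral_of_smul_mem_submodule N
      (fun h => one_ne_zero ((Submodule.eq_bot_iff N).1 h 1 h1N)) hNfg x fun y hy => hmul x hx y hy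

end Finiteness

/-- Let `D` be a Prüfer domain, `P = D[x₁,…,xₙ]`, and `B` a domain containing `P`
and finite as a `P`-module.  If for every maximal ideal `𝔪` of `D` the
localization of `B` at the multiplicative set `P ∖ 𝔪P` is integrally closed
(in the fraction field of `B`), then `B` is N-1. -/
theorem isN1_of_normal_at_maximal_extensions
    (D : Type u) [CommRing D] [IsDomain D] (hD : IsPruferDomain D) (n : ℕ)
    (B : Type u) [CommRing B] [IsDomain B]
    [Algebra (MvPolynomial (Fin n) D) B]
    (hinj : Function.Injective (algebraMap (MvPolynomial (Fin n) D) B))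
    [Module.Finite (MvPolynomial (Fin n) D) B]
    (hnormal : ∀ (𝔪 : Ideal D) (h𝔪 : 𝔪.IsMaximal),
      IsIntegrallyClosed
        (Localization
          (Submonoid.map (algebraMap (MvPolynomial (Fin n) D) B)
            (@Ideal.primeCompl _ _
              (Ideal.map (MvPolynomial.C : D →+* MvPolynomial (Fin n) D) 𝔪)
              (isPrime_map_C h𝔪.isPrime _))))) :
    IsN1 B := by
  let P := MvPolynomial (Fin n) D
  let L := FractionRing P
  let K := FractionRing B
  have : FaithfulSMul P B := (faithfulSMul_iff_algebraMap_injective P B).2 hinj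
  have : FaithfulSMul P K := FaithfulSMul.trans P B K
  let : Algebra L K := FractionRing.liftAlgebra P K
  have : IsScalarTower P L K := FractionRing.isScalarTower_liftAlgebra P K
  have : Algebra.IsIntegral P B := Algebra.IsIntegral.of_finite P B
  have : FiniteDimensional L K := .of_isLocalization P B (nonZeroDivisors P)
  have hfg : (integralClosure P K).toSubmodule.FG := by
    refine hD.finite_integralClosure n L K (IsScalarTower.toAlgHom P B K).range ?_ ?_
    · have h1 : (⊤ : Submodule P B).FG := Module.Finite.fg_top
      have h2 := h1.map (IsScalarTower.toAlgHom P B K).toLinearMap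
      rwa [Submodule.map_top] at h2
    · intro c hc 𝔪 h𝔪
      have h𝔭 := isPrime_map_C h𝔪.isPrime (Fin n)
      let S : Submonoid B := (𝔪.map (MvPolynomial.C : D →+* P)).primeCompl.map (algebraMap P B)
      have hS : S ≤ nonZeroDivisors B := by
        rintro _ ⟨p, hp, rfl⟩
        rw [mem_nonZeroDivisors_iff_ne_zero]
        refine (map_ne_zero_iff _ hinj).2 ?_
        rintro rfl
        exact hp (zero_mem _)
      let : Algebra (Localization S) K :=
        IsLocalization.localizationAlgebraOfSubmonoidLe _ K S _ hS
      have : IsScalarTower B (Localization S) K :=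
        IsLocalization.localization_isScalarTower_of_submonoid_le _ K S _ hS
      have : IsFractionRing (Localization S) K :=
        IsFractionRing.isFractionRing_of_isDomain_of_isLocalization S _ K
      have : IsIntegrallyClosed (Localization S) := hnormal 𝔪 h𝔪
      have hcB : IsIntegral B c := hc.tower_top
      have hcS : IsIntegral (Localization S) c := hcB.tower_top
      obtain ⟨y, rfl⟩ := IsIntegrallyClosed.isIntegral_iff.1 hcS
      obtain ⟨⟨b, _, s, hs, rfl⟩, hb⟩ := IsLocalization.surj S y
      refine ⟨s, hs, b, ?_⟩
      have h1 := congrArg (algebraMap (Localization S) K) hb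
      rw [map_mul, ← IsScalarTower.algebraMap_apply B (Localization S) K,
        ← IsScalarTower.algebraMap_apply B (Localization S) K,
        ← IsScalarTower.algebraMap_apply P B K] at h1
      rw [Algebra.smul_def, mul_comm]
      exact h1.symm
  have hfin : Module.Finite P (integralClosure P K) := Module.Finite.iff_fg.2 hfg
  let ι : integralClosure P K →ₗ[P] (integralClosure B K).restrictScalars P :=
    (Subalgebra.inclusion fun x hx => IsIntegral.tower_top (A := B) hx).toLinearMap
  have hι : Function.Surjective ι := fun x =>
    ⟨⟨x, isIntegral_trans (R := P) (A := B) (x : K) x.2⟩, rfl⟩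
  have : Module.Finite P (integralClosure B K) := Module.Finite.of_surjective ι hι
  exact Module.Finite.of_restrictScalars_finite P B (integralClosure B K)
end

section
/- Let D be a Prüfer domain, let P = D[x_1,…,x_n] be a polynomial D-algebra in finitely many variables, and let B ⊆ C be integral domains containing P, each finite as a P-module. If C is N-1, then B is N-1. -/
set_option synthInstance.maxHeartbeats 400000
set_option maxHeartbeats 800000

universe u

section Reduction

open Submodule

variable {D : Type*} [CommRing D] {M : Type*} [AddCommGroup M] [Module D M]
  {T : Type*} [LinearOrder T]

/-- The indices `t ∈ A` for which `v t` is, modulo `p`, a combination of earlier members of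
the family `v` on `A`. -/
def redundantSet (p : Ideal D) (v : T → M) (A : Set T) : Set T :=
  {t | t ∈ A ∧ v t ∈ span D (v '' {s | s ∈ A ∧ s < t}) ⊔ p • span D (v '' A)}

lemma span_image_le_of_redundant (p : Ideal D) {A : Set T} (hA : A.Finite) (U : Set T)
    (e : T → M) (W : Submodule D M)
    (h : ∀ t ∈ A, t ∈ U → e t ∈ span D (e '' {s | s ∈ A ∧ s < t}) ⊔ W ⊔ p • span D (e '' A)) :
    span D (e '' A) ≤ (span D (e '' (A \ U)) ⊔ W) ⊔ p • span D (e '' A) := by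
  rw [span_le]
  rintro _ ⟨t, ht, rfl⟩
  refine (hA.wellFoundedOn (r := (· < ·))).induction
    (P := fun t => e t ∈ (span D (e '' (A \ U)) ⊔ W) ⊔ p • span D (e '' A)) ht ?_
  intro t ht ih
  by_cases hU : t ∈ U
  · refine SetLike.le_def.1 (sup_le (sup_le ?_ ?_) le_sup_right) (h t ht hU)
    · rw [span_le]
      rintro _ ⟨s, ⟨hs, hst⟩, rfl⟩
      exact ih s hs hst
    · exact le_sup_of_le_left le_sup_right
  · exact mem_sup_left (mem_sup_left (subset_span ⟨t, ⟨ht, hU⟩, rfl⟩))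

lemma exists_notMem_smul_mem_of_redundant (p : Ideal D) (hp : p ≠ ⊤) {A : Set T} (hA : A.Finite)
    (U : Set T) (e : T → M) (W : Submodule D M)
    (h : ∀ t ∈ A, t ∈ U → e t ∈ span D (e '' {s | s ∈ A ∧ s < t}) ⊔ W ⊔ p • span D (e '' A)) :
    ∃ r ∉ p, ∀ f ∈ span D (e '' A), r • f ∈ span D (e '' (A \ U)) ⊔ W := by
  obtain ⟨r, hr, hle⟩ := exists_sub_one_mem_and_smul_le_of_fg_of_le_sup
    (fg_span (hA.image e)) le_rfl (span_image_le_of_redundant p hA U e W h)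
  refine ⟨r, fun hrp => hp ((Ideal.eq_top_iff_one p).2 ?_), fun f hf => hle ?_⟩
  · simpa using p.sub_mem hrp hr
  · exact smul_mem_pointwise_smul f r _ hf

lemma exists_forall_dvd_of_valuationRing {V ι : Type*} [CommRing V] [IsDomain V] [ValuationRing V]
    (f : ι → V) (s : Finset ι) (hs : s.Nonempty) : ∃ i ∈ s, ∀ j ∈ s, f i ∣ f j := by
  classical
  induction hs using Finset.Nonempty.cons_induction with
  | singleton a => exact ⟨a, by simp⟩
  | cons a s ha hs ih =>
    obtain ⟨i, hi, hdvd⟩ := ih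
    rcases ValuationRing.dvd_total (f a) (f i) with h | h
    · refine ⟨a, by simp, fun j hj => ?_⟩
      rcases Finset.mem_cons.1 hj with rfl | hj
      · exact dvd_rfl
      · exact h.trans (hdvd j hj)
    · refine ⟨i, by simp [hi], fun j hj => ?_⟩
      rcases Finset.mem_cons.1 hj with rfl | hj
      · exact h
      · exact hdvd j hj

lemma exists_common_divisor_at_prime [IsDomain D] (p : Ideal D) [p.IsPrime]
    [ValuationRing (Localization.AtPrime p)] {ι : Type*} (s : Finset ι) (c : ι → D)
    (hc : ∃ i ∈ s, c i ≠ 0) :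
    ∃ i₀ ∈ s, c i₀ ≠ 0 ∧ ∃ b : ι → D, b i₀ ∉ p ∧ ∀ i ∈ s, b i₀ * c i = b i * c i₀ := by
  classical
  obtain ⟨i₁, hi₁, hci₁⟩ := hc
  let φ := algebraMap D (Localization.AtPrime p)
  have hφ : Function.Injective φ :=
    IsLocalization.injective _ p.primeCompl_le_nonZeroDivisors
  obtain ⟨i₀, hi₀, hdvd⟩ := exists_forall_dvd_of_valuationRing (fun i => φ (c i)) s ⟨i₁, hi₁⟩
  have h0 : c i₀ ≠ 0 := by
    intro h0
    have := hdvd i₁ hi₁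
    simp only [h0, map_zero, zero_dvd_iff] at this
    exact hci₁ (hφ (by simpa using this))
  choose! z hz using hdvd
  obtain ⟨r, hr⟩ := IsLocalization.exist_integer_multiples p.primeCompl s z
  choose! b hb using hr
  have key : ∀ i ∈ s, (r : D) * c i = b i * c i₀ := by
    intro i hi
    apply hφ
    have := hb i hi
    rw [map_mul, map_mul, hz i hi]
    change φ (b i) = _ at this
    rw [this, Algebra.smul_def]
    change _ = φ (r : D) * _ * _
    ring
  have hbi : b i₀ = r := mul_right_cancel₀ h0 (key i₀ hi₀).symm
  refine ⟨i₀, hi₀, h0, b, hbi ▸ r.2, fun i hi => hbi ▸ key i hi⟩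

variable (htf : ∀ (a : D) (m : M), a ≠ 0 → a • m = 0 → m = 0)

include htf in
lemma linearIndepOn_diff_redundantSet [IsDomain D] (p : Ideal D) [hp : p.IsMaximal]
    [ValuationRing (Localization.AtPrime p)] (v : T → M) {A : Set T} (hA : A.Finite) :
    LinearIndepOn D v (A \ redundantSet p v A) := by
  classical
  set s : Finset T := (hA.subset (Set.sdiff_subset (t := redundantSet p v A))).toFinset with hs
  have hsmem : ∀ t, t ∈ s ↔ t ∈ A \ redundantSet p v A := fun t => by simp [hs]
  have hcoe : A \ redundantSet p v A = (s : Set T) := by ext t; simp [hsmem]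
  rw [hcoe, linearIndepOn_finset_iff]
  by_contra! hcon
  obtain ⟨c, hc, hne⟩ := hcon
  obtain ⟨i₀, hi₀, h0, b, hb, hbc⟩ := exists_common_divisor_at_prime p s c hne
  have hsum : ∑ i ∈ s, b i • v i = 0 := by
    apply htf (c i₀) _ h0
    rw [Finset.smul_sum]
    calc ∑ i ∈ s, c i₀ • b i • v i = ∑ i ∈ s, b i₀ • c i • v i :=
          Finset.sum_congr rfl fun i hi => by rw [smul_smul, smul_smul, hbc i hi, mul_comm]
      _ = 0 := by rw [← Finset.smul_sum, hc, smul_zero]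
  obtain ⟨t, ht, hmax⟩ := (s.filter (fun i => b i ∉ p)).exists_maximal
    ⟨i₀, by simp [hi₀, hb]⟩
  rw [Finset.mem_filter] at ht
  obtain ⟨y, z, hz, hyz⟩ := hp.exists_inv ht.2
  refine ((hsmem t).1 ht.1).2 ⟨((hsmem t).1 ht.1).1, ?_⟩
  have hvA : ∀ i ∈ s, v i ∈ span D (v '' A) := fun i hi =>
    subset_span ⟨i, ((hsmem i).1 hi).1, rfl⟩
  have hvt : v t = z • v t - ∑ i ∈ s.erase t, y • b i • v i := by
    have h1 : b t • v t + ∑ i ∈ s.erase t, b i • v i = 0 := by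
      rw [Finset.add_sum_erase s (fun i => b i • v i) ht.1, hsum]
    rw [← Finset.smul_sum, eq_neg_of_add_eq_zero_right h1, smul_neg, sub_neg_eq_add, smul_smul,
      ← add_smul, add_comm z, hyz, one_smul]
  rw [hvt]
  refine sub_mem (mem_sup_right (smul_mem_smul hz (hvA t ht.1))) (sum_mem fun i hi => ?_)
  rw [Finset.mem_erase] at hi
  by_cases hbi : b i ∈ p
  · refine smul_mem _ _ (mem_sup_right (smul_mem_smul hbi (hvA i hi.2)))
  · refine smul_mem _ _ (smul_mem _ _ (mem_sup_left
      (subset_span ⟨i, ⟨((hsmem i).1 hi.2).1, ?_⟩, rfl⟩)))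
    refine lt_of_le_of_ne (not_lt.1 fun hlt => ?_) hi.1
    exact (hlt.trans_le (hmax (Finset.mem_filter.2 ⟨hi.2, hbi⟩) hlt.le)).false

include htf in
lemma ncard_diff_redundantSet [IsDomain D] (p : Ideal D) [hp : p.IsMaximal]
    [ValuationRing (Localization.AtPrime p)] (v : T → M) {A : Set T} (hA : A.Finite) :
    (A \ redundantSet p v A).ncard = Module.finrank D (span D (v '' A)) := by
  have hli := linearIndepOn_diff_redundantSet htf p v hA
  have hfin : (A \ redundantSet p v A).Finite := hA.subset Set.sdiff_subset
  have : Fintype ↥(A \ redundantSet p v A) := hfin.fintype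
  have hB : Module.finrank D (span D (v '' (A \ redundantSet p v A)))
      = (A \ redundantSet p v A).ncard := by
    rw [Set.image_eq_range, finrank_span_eq_card hli, ← Nat.card_eq_fintype_card,
      Nat.card_coe_set_eq]
  rw [← hB]
  have : Module.Finite D (span D (v '' A)) := Module.Finite.iff_fg.2 (fg_span (hA.image v))
  have : Module.Finite D (span D (v '' (A \ redundantSet p v A))) :=
    Module.Finite.iff_fg.2 (fg_span (hfin.image v))
  apply le_antisymm
  · exact LinearMap.finrank_le_finrank_of_injective
      (Submodule.inclusion_injective (span_mono (Set.image_mono Set.sdiff_subset)))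
  · obtain ⟨r, hr, hmem⟩ := exists_notMem_smul_mem_of_redundant p hp.ne_top hA
      (redundantSet p v A) v ⊥ (fun t _ ht => by simpa using ht.2)
    let φ : span D (v '' A) →ₗ[D] span D (v '' (A \ redundantSet p v A)) :=
      ((r • LinearMap.id : M →ₗ[D] M)).restrict (fun f hf => by simpa using hmem f hf)
    refine LinearMap.finrank_le_finrank_of_injective (f := φ) ?_
    rw [injective_iff_map_eq_zero]
    intro x hx
    have : r • (x : M) = 0 := congrArg Subtype.val hx
    exact Subtype.ext (htf r _ (fun h => hr (h ▸ p.zero_mem)) this)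

/-- The linear relations satisfied by the family `v` on `A`. -/
noncomputable def relationsOn (D : Type*) [CommRing D] [Module D M] (v : T → M) (A : Set T) :
    Submodule D (T →₀ D) :=
  Finsupp.supported D D A ⊓ LinearMap.ker (Finsupp.linearCombination D v)

include htf in
lemma exists_notMem_smul_relationsOn_mem [IsDomain D] (p : Ideal D) [hp : p.IsMaximal]
    [ValuationRing (Localization.AtPrime p)] (v : T → M) {A : Set T} (hA : A.Finite)
    (W : Submodule D (T →₀ D)) (hW : W ≤ relationsOn D v A)
    (h : ∀ t ∈ redundantSet p v A, ∃ w ∈ W, ∃ g ∈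
      Finsupp.supported D D {s | s ∈ A ∧ s < t} ⊔ p • Finsupp.supported D D A,
        Finsupp.single t 1 = g + w) :
    ∃ r ∉ p, ∀ f ∈ relationsOn D v A, r • f ∈ W := by
  obtain ⟨r, hr, hmem⟩ := exists_notMem_smul_mem_of_redundant p hp.ne_top hA
    (redundantSet p v A) (fun s => Finsupp.single s (1 : D)) W (fun t _ ht => by
      obtain ⟨w, hw, g, hg, heq⟩ := h t ht
      rw [sup_right_comm, ← Finsupp.supported_eq_span_single, ← Finsupp.supported_eq_span_single]
      rw [heq]
      exact add_mem (mem_sup_left hg) (mem_sup_right hw))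
  refine ⟨r, hr, fun f hf => ?_⟩
  rw [← Finsupp.supported_eq_span_single, ← Finsupp.supported_eq_span_single] at hmem
  obtain ⟨a, ha, w, hw, haw⟩ := mem_sup.1 (hmem f hf.1)
  have hker : Finsupp.linearCombination D v a = 0 := by
    have h1 : a = r • f - w := by rw [← haw]; simp
    have h2 : Finsupp.linearCombination D v f = 0 := hf.2
    have h3 : Finsupp.linearCombination D v w = 0 := (hW hw).2
    rw [h1, map_sub, map_smul, h2, h3]; simp
  have : a = 0 := linearIndepOn_iff.1 (linearIndepOn_diff_redundantSet htf p v hA) a ha hker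
  rw [← haw, this, zero_add]
  exact hw

lemma exists_relation_of_mem_redundantSet (p : Ideal D) (v : T → M) {A : Set T} {t : T}
    (ht : t ∈ redundantSet p v A) :
    ∃ w ∈ relationsOn D v A, ∃ g ∈
      Finsupp.supported D D {s | s ∈ A ∧ s < t} ⊔ p • Finsupp.supported D D A,
        Finsupp.single t 1 = g + w := by
  have himg : ∀ B : Set T, span D (v '' B) =
      (Finsupp.supported D D B).map (Finsupp.linearCombination D v) :=
    fun B => (Finsupp.span_image_eq_map_linearCombination D B)
  have hmem := ht.2
  rw [himg, himg, ← map_smul'', ← Submodule.map_sup] at hmem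
  obtain ⟨g, hg, hgv⟩ := hmem
  refine ⟨Finsupp.single t 1 - g, ⟨sub_mem ?_ ?_, ?_⟩, g, hg, by simp⟩
  · exact Finsupp.single_mem_supported D 1 ht.1
  · exact SetLike.le_def.1 (sup_le (Finsupp.supported_mono fun s hs => hs.1) smul_le_right) hg
  · rw [SetLike.mem_coe, LinearMap.mem_ker, map_sub, hgv]; simp

lemma le_of_forall_isMaximal_exists_smul_mem {N W : Submodule D M}
    (h : ∀ p : Ideal D, p.IsMaximal → ∃ r ∉ p, ∀ f ∈ N, r • f ∈ W) : N ≤ W := by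
  let J : Ideal D :=
    { carrier := {r | ∀ f ∈ N, r • f ∈ W}
      add_mem' := fun ha hb f hf => by rw [add_smul]; exact add_mem (ha f hf) (hb f hf)
      zero_mem' := fun f _ => by simp
      smul_mem' := fun c a ha f hf => by
        rw [smul_eq_mul, mul_smul]; exact W.smul_mem c (ha f hf) }
  have hJ : J = ⊤ := by
    by_contra hne
    obtain ⟨p, hp, hle⟩ := Ideal.exists_le_maximal J hne
    obtain ⟨r, hr, hrf⟩ := h p hp
    exact hr (hle hrf)
  intro f hf
  have : (1 : D) ∈ J := hJ ▸ mem_top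
  simpa using this f hf

lemma fg_of_forall_isMaximal_exists_smul_mem {N : Submodule D M}
    (h : ∀ p : Ideal D, p.IsMaximal → ∃ r ∉ p, ∃ W ≤ N, W.FG ∧ ∀ f ∈ N, r • f ∈ W) : N.FG := by
  let J : Ideal D :=
    { carrier := {r | ∃ W ≤ N, W.FG ∧ ∀ f ∈ N, r • f ∈ W}
      add_mem' := by
        rintro a b ⟨W, hW, hWf, ha⟩ ⟨W', hW', hWf', hb⟩
        refine ⟨W ⊔ W', sup_le hW hW', hWf.sup hWf', fun f hf => ?_⟩
        rw [add_smul]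
        exact add_mem (mem_sup_left (ha f hf)) (mem_sup_right (hb f hf))
      zero_mem' := ⟨⊥, bot_le, fg_bot, fun f _ => by simp⟩
      smul_mem' := by
        rintro c a ⟨W, hW, hWf, ha⟩
        refine ⟨W, hW, hWf, fun f hf => ?_⟩
        rw [smul_eq_mul, mul_smul]; exact W.smul_mem c (ha f hf) }
  have hJ : J = ⊤ := by
    by_contra hne
    obtain ⟨p, hp, hle⟩ := Ideal.exists_le_maximal J hne
    obtain ⟨r, hr, hrf⟩ := h p hp
    exact hr (hle hrf)
  obtain ⟨W, hW, hWf, h1⟩ : (1 : D) ∈ J := hJ ▸ mem_top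
  have : N = W := le_antisymm (fun f hf => by simpa using h1 f hf) hW
  rwa [this]

include htf in
lemma relationsOn_fg [IsDomain D]
    (hD : ∀ (p : Ideal D) [p.IsPrime], ValuationRing (Localization.AtPrime p))
    (v : T → M) {A : Set T} (hA : A.Finite) : (relationsOn D v A).FG := by
  refine fg_of_forall_isMaximal_exists_smul_mem fun p hp => ?_
  have := hD p
  have hex := fun t (ht : t ∈ redundantSet p v A) => exists_relation_of_mem_redundantSet p v ht
  choose! w hw hg using hex
  have hle : span D (w '' redundantSet p v A) ≤ relationsOn D v A := by
    rw [span_le]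
    rintro _ ⟨t, ht, rfl⟩
    exact hw t ht
  obtain ⟨r, hr, hmem⟩ := exists_notMem_smul_relationsOn_mem htf p v hA _ hle
    (fun t ht => ⟨w t, subset_span ⟨t, ht, rfl⟩, hg t ht⟩)
  exact ⟨r, hr, _, hle, fg_span ((hA.subset fun t ht => ht.1).image w), hmem⟩

end Reduction

section Shifts

variable {T σ : Type*}

/-- `t` is obtained from `s` by applying finitely many of the operators `shift i`. -/
def ShiftReachable (shift : σ → T → T) : T → T → Prop :=
  Relation.ReflTransGen fun s t => ∃ i, t = shift i s

lemma mem_of_shiftReachable {shift : σ → T → T} {U : Set T} (hU : ∀ i, ∀ t ∈ U, shift i t ∈ U)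
    {s t : T} (hst : ShiftReachable shift s t) (hs : s ∈ U) : t ∈ U := by
  induction hst with
  | refl => exact hs
  | tail _ h ih =>
    obtain ⟨i, rfl⟩ := h
    exact hU i _ ih

lemma exists_degree_bound (shift : σ → T → T) (hwqo : WellQuasiOrdered (ShiftReachable shift))
    (deg : T → ℕ) (U : Set T) :
    ∃ d₀, ∀ t ∈ U, ∃ s ∈ U, ShiftReachable shift s t ∧ deg s ≤ d₀ := by
  by_contra! hcon
  choose t htU ht using hcon
  let n : ℕ → ℕ := fun k => Nat.rec 0 (fun _ m => max m (deg (t m))) k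
  have hn : Monotone n := monotone_nat_of_le_succ fun k => le_max_left _ _
  obtain ⟨i, j, hij, hr⟩ := hwqo fun k => t (n k)
  have h1 : deg (t (n i)) ≤ n (i + 1) := le_max_right _ _
  exact absurd (h1.trans (hn hij)) (not_le.2 (ht _ _ (htU _) hr))

/-- If a family of shift-stable sets has complements with the same number of elements in each
degree, then the members of the family are generated in uniformly bounded degrees. -/
lemma exists_uniform_degree_bound (shift : σ → T → T)
    (hwqo : WellQuasiOrdered (ShiftReachable shift)) (deg : T → ℕ)
    (hfin : ∀ d, {t | deg t = d}.Finite) {I : Type*} (U : I → Set T)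
    (hU : ∀ p i, ∀ t ∈ U p, shift i t ∈ U p) (h : ℕ → ℕ)
    (hcard : ∀ p d, ({t | deg t = d} \ U p).ncard = h d) :
    ∃ d₀, ∀ p, ∀ t ∈ U p, ∃ s ∈ U p, ShiftReachable shift s t ∧ deg s ≤ d₀ := by
  by_contra! hcon
  choose p t htU ht using hcon
  let F : Ultrafilter ℕ := Filter.hyperfilter ℕ
  let V : Set T := {t | ∀ᶠ k in (F : Filter ℕ), t ∈ U (p k)}
  obtain ⟨d₀, hd₀⟩ := exists_degree_bound shift hwqo deg V
  have hfin' : {t | deg t ≤ d₀}.Finite := by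
    have : {t | deg t ≤ d₀} = ⋃ d ∈ Set.Iic d₀, {t | deg t = d} := by ext; simp
    rw [this]
    exact (Set.finite_Iic d₀).biUnion fun d _ => hfin d
  have hgen : ∀ᶠ k in (F : Filter ℕ), ∀ t ∈ {t | deg t ≤ d₀}, t ∈ V → t ∈ U (p k) := by
    rw [Filter.eventually_all_finite hfin']
    intro t _
    by_cases htV : t ∈ V
    · filter_upwards [htV] with k hk _ using hk
    · exact Filter.Eventually.of_forall fun k hk => absurd hk htV
  have hVcard : ∀ d, ({t | deg t = d} \ V).ncard = h d := by
    intro d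
    have hev : ∀ᶠ k in (F : Filter ℕ), ∀ t ∈ {t | deg t = d}, (t ∈ V ↔ t ∈ U (p k)) := by
      rw [Filter.eventually_all_finite (hfin d)]
      intro t _
      by_cases htV : t ∈ V
      · filter_upwards [htV] with k hk using iff_of_true htV hk
      · filter_upwards [Ultrafilter.eventually_not.2 htV] with k hk using iff_of_false htV hk
    obtain ⟨k, hk⟩ := hev.exists
    rw [← hcard (p k) d]
    congr 1
    ext t
    simp only [Set.mem_sdiff, Set.mem_ofPred_eq]
    exact and_congr_right fun htd => not_congr (hk t htd)
  have hlarge : ∀ᶠ k in (F : Filter ℕ), d₀ ≤ k := by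
    have h1 : ∀ᶠ k in Filter.cofinite, d₀ ≤ k := by
      rw [Nat.cofinite_eq_atTop]; exact Filter.eventually_ge_atTop d₀
    exact Filter.hyperfilter_le_cofinite h1
  obtain ⟨k, hk, hdk⟩ := (hgen.and hlarge).exists
  have hVU : V ⊆ U (p k) := fun t htV => by
    obtain ⟨s, hs, hst, hsd⟩ := hd₀ t htV
    exact mem_of_shiftReachable (hU (p k)) hst (hk s hsd hs)
  have hUV : U (p k) ⊆ V := by
    intro u hu
    have heq : {t | deg t = deg u} \ U (p k) = {t | deg t = deg u} \ V :=
      Set.eq_of_subset_of_ncard_le (Set.sdiff_subset_sdiff_right hVU)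
        (by rw [hVcard, hcard]) ((hfin _).subset Set.sdiff_subset)
    by_contra huV
    have : u ∈ {t | deg t = deg u} \ U (p k) := heq ▸ ⟨rfl, huV⟩
    exact this.2 hu
  obtain ⟨s, hs, hst, hsd⟩ := hd₀ _ (hUV (htU k))
  exact absurd (hsd.trans hdk) (not_le.2 (ht k s (hVU hs) hst))

end Shifts

section Graded

open Submodule

variable {D : Type*} [CommRing D] {M : Type*} [AddCommGroup M] [Module D M]
  {T : Type*} [LinearOrder T] {σ : Type*}

lemma lmapDomain_shift_mem_supported (shift : T → T) (deg : T → ℕ)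
    (hdeg : ∀ t, deg (shift t) = deg t + 1) (hmono : StrictMono shift)
    (p : Ideal D) {d : ℕ} {t : T} {g : T →₀ D}
    (hg : g ∈ Finsupp.supported D D {s | s ∈ {s | deg s = d} ∧ s < t} ⊔
      p • Finsupp.supported D D {s | deg s = d}) :
    Finsupp.lmapDomain D D shift g ∈
      Finsupp.supported D D {s | s ∈ {s | deg s = d + 1} ∧ s < shift t} ⊔
        p • Finsupp.supported D D {s | deg s = d + 1} := by
  have h1 := mem_map_of_mem (f := Finsupp.lmapDomain D D shift) hg
  rw [Submodule.map_sup, map_smul'', Finsupp.lmapDomain_supported, Finsupp.lmapDomain_supported]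
    at h1
  refine SetLike.le_def.1 (sup_le_sup (Finsupp.supported_mono ?_)
    (Submodule.smul_mono le_rfl (Finsupp.supported_mono ?_))) h1
  · rintro _ ⟨s, ⟨hs, hst⟩, rfl⟩
    exact ⟨by simpa [hdeg] using hs, hmono hst⟩
  · rintro _ ⟨s, hs, rfl⟩
    simpa [hdeg] using hs

omit [LinearOrder T] in
lemma lmapDomain_shift_mem_relationsOn (v : T → M) (shift : T → T) (deg : T → ℕ)
    (hdeg : ∀ t, deg (shift t) = deg t + 1) (x : M →ₗ[D] M) (hv : ∀ t, v (shift t) = x (v t))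
    {d : ℕ} {g : T →₀ D} (hg : g ∈ relationsOn D v {t | deg t = d}) :
    Finsupp.lmapDomain D D shift g ∈ relationsOn D v {t | deg t = d + 1} := by
  refine ⟨?_, ?_⟩
  · have h1 := mem_map_of_mem (f := Finsupp.lmapDomain D D shift) hg.1
    rw [Finsupp.lmapDomain_supported] at h1
    refine Finsupp.supported_mono ?_ h1
    rintro _ ⟨s, hs, rfl⟩
    simpa [hdeg] using hs
  · have h2 : Finsupp.linearCombination D v g = 0 := hg.2
    rw [SetLike.mem_coe, LinearMap.mem_ker, Finsupp.lmapDomain_apply,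
      Finsupp.linearCombination_mapDomain]
    have : v ∘ shift = x ∘ v := funext hv
    rw [this, ← Finsupp.apply_linearCombination, h2, map_zero]

/-- Over a Prüfer domain, the relations satisfied by a torsion-free family indexed by a graded
set with shifts are generated, under the shifts, in bounded degrees. -/
theorem exists_relationsOn_le_iSup_shift [IsDomain D]
    (hD : ∀ (p : Ideal D) [p.IsPrime], ValuationRing (Localization.AtPrime p))
    (htf : ∀ (a : D) (m : M), a ≠ 0 → a • m = 0 → m = 0)
    (v : T → M) (shift : σ → T → T) (deg : T → ℕ)
    (hdeg : ∀ i t, deg (shift i t) = deg t + 1) (hmono : ∀ i, StrictMono (shift i))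
    (hfin : ∀ d, {t | deg t = d}.Finite) (hwqo : WellQuasiOrdered (ShiftReachable shift))
    (x : σ → M →ₗ[D] M) (hv : ∀ i t, v (shift i t) = x i (v t)) :
    ∃ d₀, ∀ d, d₀ ≤ d → relationsOn D v {t | deg t = d + 1} ≤
      ⨆ i, (relationsOn D v {t | deg t = d}).map (Finsupp.lmapDomain D D (shift i)) := by
  let U : {p : Ideal D // p.IsMaximal} → Set T :=
    fun p => {t | t ∈ redundantSet p.1 v {s | deg s = deg t}}
  have hUA : ∀ p d, {t | deg t = d} \ U p =
      {t | deg t = d} \ redundantSet p.1 v {s | deg s = d} := by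
    intro p d
    ext t
    simp only [Set.mem_sdiff, Set.mem_ofPred_eq, U]
    exact and_congr_right fun h => by rw [h]
  have hshift : ∀ (p : Ideal D) i t, t ∈ redundantSet p v {s | deg s = deg t} →
      ∃ w ∈ (relationsOn D v {s | deg s = deg t}).map (Finsupp.lmapDomain D D (shift i)), ∃ g ∈
      Finsupp.supported D D {s | s ∈ {s | deg s = deg t + 1} ∧ s < shift i t} ⊔
        p • Finsupp.supported D D {s | deg s = deg t + 1},
        Finsupp.single (shift i t) 1 = g + w := by
    intro p i t ht
    obtain ⟨w, hw, g, hg, heq⟩ := exists_relation_of_mem_redundantSet p v ht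
    refine ⟨_, mem_map_of_mem hw, _,
      lmapDomain_shift_mem_supported (shift i) deg (hdeg i) (hmono i) p hg, ?_⟩
    rw [← map_add, ← heq]
    simp
  have hU : ∀ p i, ∀ t ∈ U p, shift i t ∈ U p := by
    intro p i t ht
    obtain ⟨_, ⟨w, hw, rfl⟩, g, hg, heq⟩ := hshift p.1 i t ht
    have hw' := lmapDomain_shift_mem_relationsOn v (shift i) deg (hdeg i) (x i) (hv i) hw
    refine ⟨rfl, ?_⟩
    have hvg : v (shift i t) = Finsupp.linearCombination D v g := by
      have h1 := congrArg (Finsupp.linearCombination D v) heq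
      have h2 : Finsupp.linearCombination D v (Finsupp.lmapDomain D D (shift i) w) = 0 := hw'.2
      rw [map_add, h2] at h1
      simpa using h1
    have h3 := mem_map_of_mem (f := Finsupp.linearCombination D v) hg
    rw [Submodule.map_sup, map_smul'', ← Finsupp.span_image_eq_map_linearCombination,
      ← Finsupp.span_image_eq_map_linearCombination] at h3
    rw [hvg, hdeg]
    exact h3
  obtain ⟨d₀, hd₀⟩ := exists_uniform_degree_bound shift hwqo deg hfin U hU
    (fun d => Module.finrank D (span D (v '' {t | deg t = d}))) (fun p d => by
      have := p.2
      have := hD p.1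
      rw [hUA, ncard_diff_redundantSet htf p.1 v (hfin d)])
  refine ⟨d₀, fun d hd => le_of_forall_isMaximal_exists_smul_mem fun p hp => ?_⟩
  have := hD p
  refine exists_notMem_smul_relationsOn_mem htf p v (hfin _) _ (iSup_le fun i => ?_) ?_
  · rintro _ ⟨w, hw, rfl⟩
    exact lmapDomain_shift_mem_relationsOn v (shift i) deg (hdeg i) (x i) (hv i) hw
  · intro t ht
    have htd : deg t = d + 1 := ht.1
    have htU : t ∈ U ⟨p, hp⟩ := by
      change t ∈ redundantSet p v {s | deg s = deg t}
      rwa [htd]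
    obtain ⟨s, hs, hst, hsd⟩ := hd₀ _ t htU
    rcases Relation.ReflTransGen.cases_tail hst with rfl | ⟨u, hsu, i, rfl⟩
    · omega
    · have hu : u ∈ U ⟨p, hp⟩ := mem_of_shiftReachable (hU _) hsu hs
      have hud : deg u = d := by have := hdeg i u; omega
      subst hud
      obtain ⟨w, hw, g, hg, heq⟩ := hshift p i u hu
      exact ⟨w, mem_iSup_of_mem i hw, g, hg, heq⟩

end Graded

section Saturated

open Submodule

lemma mem_iff_exists_mem_of_algHom_surjective {D R F : Type*} [CommRing D] [CommRing R]
    [Algebra D R] [AddCommGroup F] [Module R F] [Module D F] [IsScalarTower D R F]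
    {k : ℕ} (φ : MvPolynomial (Fin k) D →ₐ[D] R) (hφ : Function.Surjective φ)
    {ι : Type*} (b : ι → F) (hb : span R (Set.range b) = ⊤) (L : ℕ → Submodule D F)
    (hL : Monotone L) (hbL : ∀ j, b j ∈ L 0)
    (hX : ∀ i d, ∀ f ∈ L d, φ (MvPolynomial.X i) • f ∈ L (d + 1)) (f : F) : ∃ d, f ∈ L d := by
  have hsmul : ∀ q : MvPolynomial (Fin k) D, ∀ f : F, (∃ d, f ∈ L d) → ∃ d, φ q • f ∈ L d := by
    intro q
    induction q using MvPolynomial.induction_on with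
    | C a =>
      rintro f ⟨d, hd⟩
      refine ⟨d, ?_⟩
      rw [← MvPolynomial.algebraMap_eq, AlgHom.commutes, algebraMap_smul]
      exact (L d).smul_mem a hd
    | add p q hp hq =>
      intro f hf
      obtain ⟨d, hd⟩ := hp f hf
      obtain ⟨e, he⟩ := hq f hf
      refine ⟨max d e, ?_⟩
      rw [map_add, add_smul]
      exact add_mem (hL (le_max_left d e) hd) (hL (le_max_right d e) he)
    | mul_X p i hp =>
      rintro f ⟨d, hd⟩
      rw [map_mul, mul_smul]
      exact hp _ ⟨_, hX i d f hd⟩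
  have hf : f ∈ span R (Set.range b) := hb ▸ mem_top
  induction hf using span_induction with
  | mem _ h =>
    obtain ⟨j, rfl⟩ := h
    exact ⟨0, hbL j⟩
  | zero => exact ⟨0, zero_mem _⟩
  | add f g _ _ hf hg =>
    obtain ⟨d, hd⟩ := hf
    obtain ⟨e, he⟩ := hg
    exact ⟨max d e, add_mem (hL (le_max_left d e) hd) (hL (le_max_right d e) he)⟩
  | smul r f _ hf =>
    obtain ⟨q, rfl⟩ := hφ r
    exact hsmul q f hf

/-- Generators of a free module over a polynomial ring, as a `D`-module, in lexicographic
order. -/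
abbrev ModuleMonomial (r k : ℕ) : Type := Fin r ×ₗ Lex (Fin k →₀ ℕ)

namespace ModuleMonomial

variable {r k : ℕ}

/-- The total degree of the monomial. -/
noncomputable def degree (t : ModuleMonomial r k) : ℕ := (ofLex (ofLex t).2).degree

/-- Multiplication of a monomial by the `i`-th variable. -/
noncomputable def shift (i : Fin k) (t : ModuleMonomial r k) : ModuleMonomial r k :=
  toLex ((ofLex t).1, toLex (Finsupp.single i 1) + (ofLex t).2)

lemma degree_shift (i : Fin k) (t : ModuleMonomial r k) : degree (shift i t) = degree t + 1 := by
  simp [degree, shift, add_comm]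

lemma shift_strictMono (i : Fin k) : StrictMono (shift (r := r) i) := by
  intro s t hst
  rw [Prod.Lex.lt_iff] at hst ⊢
  rcases hst with h | ⟨h, h'⟩
  · exact Or.inl h
  · exact Or.inr ⟨h, add_lt_add_right h' _⟩

lemma finite_degree_eq (d : ℕ) : {t : ModuleMonomial r k | degree t = d}.Finite := by
  have h1 : {α : Fin k →₀ ℕ | α.degree ≤ d}.Finite := Finsupp.finite_of_degree_le d
  refine Set.Finite.of_injOn (f := fun t => ((ofLex t).1, ofLex (ofLex t).2))
    (t := Set.univ ×ˢ {α : Fin k →₀ ℕ | α.degree ≤ d}) (fun t ht => ⟨trivial, le_of_eq ht⟩)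
    (fun s _ t _ hst => ?_) (Set.finite_univ.prod h1)
  exact ofLex.injective (Prod.ext (Prod.ext_iff.1 hst).1 (ofLex.injective (Prod.ext_iff.1 hst).2))

lemma shiftReachable_add (j : Fin r) (α γ : Fin k →₀ ℕ) :
    ShiftReachable shift (toLex (j, toLex α) : ModuleMonomial r k)
      (toLex (j, toLex (γ + α))) := by
  induction γ using Finsupp.induction_linear generalizing α with
  | zero => rw [zero_add]; exact Relation.ReflTransGen.refl
  | add f g hf hg => rw [add_assoc]; exact (hg α).trans (hf _)
  | single i n =>
    induction n with
    | zero => rw [Finsupp.single_zero, zero_add]; exact Relation.ReflTransGen.refl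
    | succ n ih =>
      refine ih.tail ⟨i, ?_⟩
      rw [add_comm n 1, Finsupp.single_add, add_assoc]
      rfl

lemma wellQuasiOrdered_shiftReachable :
    WellQuasiOrdered (ShiftReachable (shift (r := r) (k := k))) := by
  intro f
  obtain ⟨m, n, hmn, h1, h2⟩ := (Finite.wellQuasiOrdered (α := Fin r) (· = ·)).prod
    (wellQuasiOrdered_le (α := Fin k →₀ ℕ)) fun i => ((ofLex (f i)).1, ofLex (ofLex (f i)).2)
  refine ⟨m, n, hmn, ?_⟩
  obtain ⟨γ, hγ⟩ := exists_add_of_le h2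
  have := shiftReachable_add (ofLex (f m)).1 (ofLex (ofLex (f m)).2) γ
  rw [add_comm γ, ← hγ] at this
  change (ofLex (f m)).1 = (ofLex (f n)).1 at h1
  convert! this using 1
  rw [h1]
  rfl

end ModuleMonomial

/-- Over a finite type algebra `R` over a Prüfer domain `D`, every `D`-saturated submodule of a
finite `R`-module is finitely generated. -/
theorem fg_of_saturated {D R F : Type*} [CommRing D] [IsDomain D]
    (hD : ∀ (p : Ideal D) [p.IsPrime], ValuationRing (Localization.AtPrime p))
    [CommRing R] [Algebra D R] [Algebra.FiniteType D R] [AddCommGroup F] [Module R F]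
    [Module D F] [IsScalarTower D R F] [Module.Finite R F] (N : Submodule R F)
    (hN : ∀ (a : D) (y : F), a ≠ 0 → a • y ∈ N → y ∈ N) : N.FG := by
  obtain ⟨k, φ, hφ⟩ := Algebra.FiniteType.iff_quotient_mvPolynomial''.1
    (inferInstance : Algebra.FiniteType D R)
  obtain ⟨r, b, hb⟩ := Module.Finite.exists_fin (R := R) (M := F)
  let x : Fin (k + 1) → R := Fin.cons 1 fun i => φ (MvPolynomial.X i)
  let w : ModuleMonomial r (k + 1) → F :=
    fun t => (∏ i, x i ^ ofLex (ofLex t).2 i) • b (ofLex t).1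
  let v : ModuleMonomial r (k + 1) → F ⧸ N := fun t => N.mkQ (w t)
  have hw : ∀ i t, w (ModuleMonomial.shift i t) = x i • w t := by
    intro i t
    change (∏ l, x l ^ (Finsupp.single i 1 + ofLex (ofLex t).2 : Fin (k + 1) →₀ ℕ) l) •
      b (ofLex t).1 = _
    simp only [Finsupp.add_apply, pow_add, Finset.prod_mul_distrib, w, smul_smul]
    congr 2
    rw [Finset.prod_eq_single i (fun l _ hl => by simp [hl.symm])
      (by simp)]
    simp
  let Λ : (ModuleMonomial r (k + 1) →₀ D) →ₗ[D] F := Finsupp.linearCombination D w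
  let A : ℕ → Set (ModuleMonomial r (k + 1)) := fun d => {t | t.degree = d}
  have hΛshift : ∀ i c, Λ (Finsupp.lmapDomain D D (ModuleMonomial.shift i) c) = x i • Λ c := by
    intro i c
    simp only [Λ, Finsupp.lmapDomain_apply, Finsupp.linearCombination_mapDomain]
    have : w ∘ ModuleMonomial.shift i = (Algebra.lsmul D D F (x i)) ∘ w := funext (hw i)
    rw [this, ← Finsupp.apply_linearCombination]
    rfl
  have hvΛ : ∀ c, Finsupp.linearCombination D v c = N.mkQ (Λ c) := by
    intro c
    have : v = (N.mkQ.restrictScalars D) ∘ w := rfl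
    rw [this, ← Finsupp.apply_linearCombination]
    rfl
  have htf : ∀ (a : D) (m : F ⧸ N), a ≠ 0 → a • m = 0 → m = 0 := by
    intro a m ha hm
    obtain ⟨y, rfl⟩ := N.mkQ_surjective m
    have h1 : N.mkQ (a • y) = 0 := hm
    rw [mkQ_apply, Quotient.mk_eq_zero] at h1 ⊢
    exact hN a y ha h1
  obtain ⟨d₀, hd₀⟩ := exists_relationsOn_le_iSup_shift hD htf v ModuleMonomial.shift
    ModuleMonomial.degree ModuleMonomial.degree_shift ModuleMonomial.shift_strictMono
    ModuleMonomial.finite_degree_eq ModuleMonomial.wellQuasiOrdered_shiftReachable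
    (fun i => Algebra.lsmul D D (F ⧸ N) (x i)) (fun i t => by
      simp only [v, hw, map_smul]; rfl)
  have hfg := relationsOn_fg htf hD v (ModuleMonomial.finite_degree_eq d₀)
  obtain ⟨G, hG⟩ := (hfg.map Λ)
  refine ⟨G, le_antisymm ?_ ?_⟩
  · rw [span_le]
    intro g hg
    have : g ∈ (relationsOn D v (A d₀)).map Λ := hG ▸ subset_span hg
    obtain ⟨c, hc, rfl⟩ := this
    have h1 : Finsupp.linearCombination D v c = 0 := hc.2
    rw [hvΛ, mkQ_apply, Quotient.mk_eq_zero] at h1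
    exact h1
  · have hgen : ∀ d, d₀ ≤ d → ∀ c ∈ relationsOn D v (A d), Λ c ∈ span R (G : Set F) := by
      intro d hd
      induction d, hd using Nat.le_induction with
      | base =>
        intro c hc
        have : Λ c ∈ span D (G : Set F) := hG ▸ mem_map_of_mem hc
        exact span_le_restrictScalars D R (G : Set F) this
      | succ d hd ih =>
        intro c hc
        have hle : (⨆ i, (relationsOn D v (A d)).map
            (Finsupp.lmapDomain D D (ModuleMonomial.shift i))) ≤
            ((span R (G : Set F)).restrictScalars D).comap Λ := by
          refine iSup_le fun i => ?_
          rintro _ ⟨c, hc, rfl⟩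
          change Λ _ ∈ span R (G : Set F)
          rw [hΛshift]
          exact smul_mem _ _ (ih c hc)
        exact hle (hd₀ d hd hc)
    intro f hf
    let L : ℕ → Submodule D F := fun d => (Finsupp.supported D D (A d)).map Λ
    have hLx : ∀ i d, ∀ f ∈ L d, x i • f ∈ L (d + 1) := by
      rintro i d _ ⟨c, hc, rfl⟩
      rw [← hΛshift]
      refine mem_map_of_mem ?_
      have h1 := mem_map_of_mem (f := Finsupp.lmapDomain D D (ModuleMonomial.shift i)) hc
      rw [Finsupp.lmapDomain_supported] at h1
      refine Finsupp.supported_mono ?_ h1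
      rintro _ ⟨t, ht, rfl⟩
      change _ = _ at ht
      change _ = _
      rw [ModuleMonomial.degree_shift, ht]
    have hL : Monotone L := monotone_nat_of_le_succ fun d f hf => by
      simpa [x] using hLx 0 d f hf
    obtain ⟨d, hd⟩ := mem_iff_exists_mem_of_algHom_surjective φ hφ b hb L hL
      (fun j => ⟨Finsupp.single (toLex (j, toLex 0)) 1,
        Finsupp.single_mem_supported D 1 (by simp [A, ModuleMonomial.degree]), by
          simp [Λ, w]⟩)
      (fun i d f hf => by simpa [x] using hLx i.succ d f hf) f
    obtain ⟨c, hc, rfl⟩ := hL (le_max_right d₀ d) hd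
    refine hgen _ (le_max_left d₀ d) c ⟨hc, ?_⟩
    rw [SetLike.mem_coe, LinearMap.mem_ker, hvΛ, mkQ_apply, Quotient.mk_eq_zero]
    exact hf

end Saturated

/-- Let `D` be a Prüfer domain, `P = D[x₁,…,xₙ]`, and `B ⊆ C` integral domains
containing `P`, each finite as a `P`-module.  If `C` is N-1, then so is `B`. -/
theorem isN1_of_isN1_of_finite_extension
    (D : Type u) [CommRing D] [IsDomain D] (hD : IsPruferDomain D) (n : ℕ)
    (B C : Type u) [CommRing B] [IsDomain B] [CommRing C] [IsDomain C]
    [Algebra (MvPolynomial (Fin n) D) B] [Algebra (MvPolynomial (Fin n) D) C]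
    [Algebra B C] [IsScalarTower (MvPolynomial (Fin n) D) B C]
    (hPB : Function.Injective (algebraMap (MvPolynomial (Fin n) D) B))
    (hBC : Function.Injective (algebraMap B C))
    [Module.Finite (MvPolynomial (Fin n) D) B]
    [Module.Finite (MvPolynomial (Fin n) D) C]
    (hC : IsN1 C) :
    IsN1 B := by
  let P := MvPolynomial (Fin n) D
  let K := FractionRing B
  let L := FractionRing C
  have hBL : Function.Injective (algebraMap B L) := by
    rw [IsScalarTower.algebraMap_eq B C L]
    exact (IsFractionRing.injective C L).comp hBC
  let ψ : K →ₐ[B] L := IsFractionRing.liftAlgHom (g := Algebra.ofId B L) hBL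
  have hψ : Function.Injective ψ := ψ.toRingHom.injective
  have : Algebra.IsIntegral P C := Algebra.IsIntegral.of_finite P C
  have : Algebra.IsIntegral B C := Algebra.IsIntegral.tower_top P
  have : IsScalarTower P B L := IsScalarTower.of_algebraMap_eq' (by
    rw [IsScalarTower.algebraMap_eq P C L, IsScalarTower.algebraMap_eq B C L,
      IsScalarTower.algebraMap_eq P B C, RingHom.comp_assoc])
  let g : integralClosure B K →ₗ[P] integralClosure C L :=
    { toFun := fun z => ⟨ψ z, (z.2.map ψ).tower_top⟩
      map_add' := fun y z => Subtype.ext (map_add ψ y.1 z.1)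
      map_smul' := fun a z => Subtype.ext (map_smul (ψ.restrictScalars P) a z.1) }
  have hg : Function.Injective g := fun y z hyz => Subtype.ext (hψ (congrArg Subtype.val hyz))
  have : Module.Finite C (integralClosure C L) := hC
  have : Module.Finite P (integralClosure C L) := Module.Finite.trans C _
  let _ : Module D (integralClosure C L) := Module.compHom _ (algebraMap D P)
  have : IsScalarTower D P (integralClosure C L) :=
    IsScalarTower.of_algebraMap_smul fun _ _ => rfl
  have hfg : (LinearMap.range g).FG := by
    refine fg_of_saturated (D := D) hD (LinearMap.range g) ?_
    rintro a y ha ⟨z, hz⟩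
    have haB : algebraMap P B (algebraMap D P a) ≠ 0 := by
      rw [Ne, map_eq_zero_iff _ hPB, MvPolynomial.algebraMap_eq,
        map_eq_zero_iff _ (MvPolynomial.C_injective _ _)]
      exact ha
    set β := algebraMap P B (algebraMap D P a) with hβ
    have hβK : algebraMap B K β ≠ 0 := by
      rwa [Ne, map_eq_zero_iff _ (IsFractionRing.injective B K)]
    have hβL : algebraMap B L β ≠ 0 := by rwa [Ne, map_eq_zero_iff _ hBL]
    have hzy : ψ z = algebraMap B L β * y := by
      have h1 : ψ z = (algebraMap D P a) • (y : L) := congrArg Subtype.val hz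
      rw [h1, hβ, ← IsScalarTower.algebraMap_apply P B L, Algebra.smul_def]
    have hy : ψ ((algebraMap B K β)⁻¹ * z) = y := by
      rw [map_mul, map_inv₀, AlgHom.commutes, hzy, inv_mul_cancel_left₀ hβL]
    have hint : IsIntegral B (ψ ((algebraMap B K β)⁻¹ * z)) := by
      rw [hy]
      exact isIntegral_trans (R := B) (A := C) _ y.2
    exact ⟨⟨_, (isIntegral_algHom_iff ψ hψ).1 hint⟩, Subtype.ext hy⟩
  have : Module.Finite P (LinearMap.range g) := Module.Finite.iff_fg.2 hfg
  have : Module.Finite P (integralClosure B K) :=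
    Module.Finite.equiv (LinearEquiv.ofInjective g hg).symm
  exact Module.Finite.of_restrictScalars_finite P B _
end

section
/- Let R be a commutative ring and let P be a polynomial R-algebra (in an arbitrary set of variables). Consider the subsets Σ = { 𝔭P : 𝔭 a prime ideal of R } and M = { 𝔪P : 𝔪 a maximal ideal of R } of Spec(P), where 𝔭P denotes the extension of 𝔭 to P. Then the canonical continuous bijection Σ → Spec(R) sending 𝔭P to 𝔭 is a homeomorphism (Σ carrying the subspace topology), and both Σ and M are quasi-compact subspaces of Spec(P). -/
set_option synthInstance.maxHeartbeats 400000
set_option maxHeartbeats 800000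

universe u v

open PrimeSpectrum in
/-- The subspace of maximal ideals is quasi-compact, since any union of open sets containing it
is the whole spectrum. -/
theorem PrimeSpectrum.isCompact_setOf_isMaximal (R : Type*) [CommRing R] :
    IsCompact {x : PrimeSpectrum R | x.asIdeal.IsMaximal} := by
  refine isCompact_of_finite_subcover fun U hU hcover ↦ ?_
  have huniv : (Set.univ : Set (PrimeSpectrum R)) ⊆ ⋃ i, U i := by
    intro x _
    obtain ⟨m, hm, hxm⟩ := x.asIdeal.exists_le_maximal x.isPrime.ne_top
    obtain ⟨i, hi⟩ := Set.mem_iUnion.mp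
      (hcover (show (⟨m, hm.isPrime⟩ : PrimeSpectrum R) ∈ _ from hm))
    have hspec : x ⤳ ⟨m, hm.isPrime⟩ := (le_iff_specializes x ⟨m, hm.isPrime⟩).mp hxm
    exact Set.mem_iUnion.mpr ⟨i, hspec.mem_open (hU i) hi⟩
  obtain ⟨t, ht⟩ := isCompact_univ.elim_finite_subcover U hU huniv
  exact ⟨t, (Set.subset_univ _).trans ht⟩

namespace MvPolynomial

theorem isPrime_map_C {R σ : Type*} [CommRing R] (p : Ideal R) [p.IsPrime] :
    (p.map (C : R →+* MvPolynomial σ R)).IsPrime := by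
  have h : p.map (C : R →+* MvPolynomial σ R) =
      RingHom.ker (map (σ := σ) (Ideal.Quotient.mk p)) := by
    ext f
    simp [mem_map_C_iff, RingHom.mem_ker, MvPolynomial.ext_iff, coeff_map,
      Ideal.Quotient.eq_zero_iff_mem]
  rw [h]
  exact RingHom.ker_isPrime _

theorem comap_map_C {R σ : Type*} [CommRing R] (I : Ideal R) :
    (I.map (C : R →+* MvPolynomial σ R)).comap C = I := by
  refine le_antisymm (fun r hr ↦ ?_) Ideal.le_comap_map
  simpa using mem_map_C_iff.mp (Ideal.mem_comap.mp hr) 0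

/-- The section `𝔭 ↦ 𝔭P` of the projection `Spec P → Spec R`, for `P` a polynomial
`R`-algebra. -/
noncomputable def extendPrime {R : Type*} (σ : Type*) [CommRing R] (x : PrimeSpectrum R) :
    PrimeSpectrum (MvPolynomial σ R) :=
  ⟨x.asIdeal.map C, isPrime_map_C x.asIdeal⟩

theorem continuous_extendPrime (R σ : Type*) [CommRing R] :
    Continuous (extendPrime (R := R) σ) := by
  refine PrimeSpectrum.isTopologicalBasis_basic_opens.continuous_iff.mpr ?_
  rintro _ ⟨f, rfl⟩
  have h : extendPrime σ ⁻¹' (PrimeSpectrum.basicOpen f : Set _) =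
      ⋃ m, (PrimeSpectrum.basicOpen (f.coeff m) : Set (PrimeSpectrum R)) := by
    ext x
    simp [extendPrime, mem_map_C_iff]
  rw [h]
  exact isOpen_iUnion fun m ↦ (PrimeSpectrum.basicOpen _).isOpen

theorem comap_extendPrime {R σ : Type*} [CommRing R] (x : PrimeSpectrum R) :
    PrimeSpectrum.comap C (extendPrime σ x) = x :=
  PrimeSpectrum.ext (comap_map_C x.asIdeal)

theorem image_extendPrime {R σ : Type*} [CommRing R] {S : Ideal R → Prop}
    (hS : ∀ I, S I → I.IsPrime) :
    extendPrime σ '' {x : PrimeSpectrum R | S x.asIdeal} =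
      {q | ∃ I, S I ∧ q.asIdeal = I.map (C : R →+* MvPolynomial σ R)} := by
  ext q
  constructor
  · rintro ⟨x, hx, rfl⟩
    exact ⟨x.asIdeal, hx, rfl⟩
  · rintro ⟨I, hI, hq⟩
    exact ⟨⟨I, hS I hI⟩, hI, PrimeSpectrum.ext hq.symm⟩

end MvPolynomial

/-- Let `R` be a commutative ring and `P = R[xᵢ : i ∈ σ]` a polynomial algebra.
The set `Σ = {𝔭P : 𝔭 ∈ Spec R}` of extensions of primes of `R`, with its subspace
topology in `Spec P`, is mapped homeomorphically onto `Spec R` by the canonical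
map `𝔭P ↦ 𝔭` (the restriction of the map induced by `C : R → P`), and both `Σ`
and `M = {𝔪P : 𝔪 ∈ Max R}` are quasi-compact. -/
theorem extensions_of_primes_homeomorph_and_quasiCompact
    (R : Type u) [CommRing R] (σ : Type v) :
    IsHomeomorph
      (fun q : {q : PrimeSpectrum (MvPolynomial σ R) |
          ∃ 𝔭 : Ideal R, 𝔭.IsPrime ∧
            q.asIdeal = Ideal.map (MvPolynomial.C : R →+* MvPolynomial σ R) 𝔭} =>
        PrimeSpectrum.comap (MvPolynomial.C : R →+* MvPolynomial σ R) q.1) ∧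
    IsCompact {q : PrimeSpectrum (MvPolynomial σ R) |
        ∃ 𝔭 : Ideal R, 𝔭.IsPrime ∧
          q.asIdeal = Ideal.map (MvPolynomial.C : R →+* MvPolynomial σ R) 𝔭} ∧
    IsCompact {q : PrimeSpectrum (MvPolynomial σ R) |
        ∃ 𝔪 : Ideal R, 𝔪.IsMaximal ∧
          q.asIdeal = Ideal.map (MvPolynomial.C : R →+* MvPolynomial σ R) 𝔪} := by
  refine ⟨?_, ?_, ?_⟩
  · refine isHomeomorph_iff_exists_inverse.mpr ⟨by fun_prop,
      fun x ↦ ⟨MvPolynomial.extendPrime σ x, x.asIdeal, x.isPrime, rfl⟩, ?_, ?_,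
      (MvPolynomial.continuous_extendPrime R σ).subtype_mk _⟩
    · rintro ⟨q, p, hp, hq⟩
      obtain rfl : q = MvPolynomial.extendPrime σ ⟨p, hp⟩ := PrimeSpectrum.ext hq
      simp only [MvPolynomial.comap_extendPrime]
    · exact MvPolynomial.comap_extendPrime
  · rw [← MvPolynomial.image_extendPrime fun _ h ↦ h]
    refine IsCompact.image ?_ (MvPolynomial.continuous_extendPrime R σ)
    simpa only [PrimeSpectrum.isPrime, Set.ofPred_true] using isCompact_univ
  · rw [← MvPolynomial.image_extendPrime fun _ h ↦ h.isPrime]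
    exact (PrimeSpectrum.isCompact_setOf_isMaximal R).image
      (MvPolynomial.continuous_extendPrime R σ)
end

section
/- Let K be a field, let (D_i)_{i ∈ ι} be a directed family of subrings of K (directed under inclusion) such that each D_i is a Prüfer domain and for all i ≤ j, D_j is finite as a D_i-module. Let D = ⋃_i D_i, and fix n ≥ 0. If the polynomial ring D[x_1,…,x_n] is N-2, then D_i[x_1,…,x_n] is N-2 for every i. -/
set_option synthInstance.maxHeartbeats 400000
set_option maxHeartbeats 800000

universe u

/-- An integral domain `S` is N-2 (Japanese) if for every finite field extension `L`
of its fraction field, the integral closure of `S` in `L` is a finitely generated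
`S`-module. -/
def IsN2 (S : Type u) [CommRing S] [IsDomain S] : Prop :=
  ∀ (L : Type u) [Field L] [Algebra S L] [Algebra (FractionRing S) L]
    [IsScalarTower S (FractionRing S) L],
    FiniteDimensional (FractionRing S) L → Module.Finite S (integralClosure S L)

/-- A commutative ring `R` is universally Japanese if every finite type `R`-algebra
that is an integral domain is N-1. -/
def UniversallyJapanese (R : Type u) [CommRing R] : Prop :=
  ∀ (A : Type u) [CommRing A] [IsDomain A] [Algebra R A],
    Algebra.FiniteType R A → IsN1 A

open MvPolynomial
open scoped TensorProduct

theorem finite_setOf_degree_eq (σ : Type*) [Finite σ] (d : ℕ) :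
    {t : σ →₀ ℕ | t.degree = d}.Finite := by
  have := Fintype.ofFinite σ
  classical
  refine ((Finset.univ : Finset σ).finsuppAntidiag d).finite_toSet.subset fun t ht ↦ ?_
  simp only [Finset.mem_coe, Finset.mem_finsuppAntidiag]
  exact ⟨by simpa [Finsupp.degree_eq_sum] using ht, by simp⟩

theorem exists_degree_bound_of_ncard_degree_eq {σ : Type*} [Finite σ] (h : ℕ → ℕ) :
    ∃ e : ℕ, ∀ E : Set (σ →₀ ℕ), IsUpperSet E →
      (∀ d, (E ∩ {t | t.degree = d}).ncard = h d) →
      ∀ t ∈ E, ∃ b ∈ E, b ≤ t ∧ b.degree ≤ e := by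
  by_contra! H
  choose E hup hcard t ht hbad using H
  let U : Ultrafilter ℕ := Filter.hyperfilter ℕ
  let F : Set (σ →₀ ℕ) := {t | ∀ᶠ k in U, t ∈ E k}
  have hFup : IsUpperSet F := fun a b hab ha ↦ ha.mono fun k hk ↦ hup k hab hk
  have hagree (d : ℕ) : ∀ᶠ k in U, E k ∩ {t | t.degree = d} = F ∩ {t | t.degree = d} := by
    have : ∀ᶠ k in U, ∀ t ∈ {t : σ →₀ ℕ | t.degree = d}, (t ∈ E k ↔ t ∈ F) := by
      refine (Filter.eventually_all_finite (finite_setOf_degree_eq σ d)).2 fun t _ ↦ ?_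
      by_cases htF : t ∈ F
      · exact Filter.Eventually.mono (show ∀ᶠ k in U, t ∈ E k from htF) fun k hk ↦ by simp [hk, htF]
      · have : ∀ᶠ k in U, t ∉ E k := Ultrafilter.eventually_not.2 htF
        exact this.mono fun k hk ↦ by simp [hk, htF]
    refine this.mono fun k hk ↦ ?_
    ext t
    simp only [Set.mem_inter_iff]
    constructor
    · rintro ⟨h1, h2⟩; exact ⟨(hk t h2).1 h1, h2⟩
    · rintro ⟨h1, h2⟩; exact ⟨(hk t h2).2 h1, h2⟩
  have hFcard (d : ℕ) : (F ∩ {t | t.degree = d}).ncard = h d := by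
    obtain ⟨k, hk⟩ := (hagree d).exists
    rw [← hk, hcard]
  have hBfin : {b | Minimal (· ∈ F) b}.Finite :=
    WellQuasiOrderedLE.finite_of_isAntichain (setOfPred_minimal_antichain _)
  have hmin (t) (ht : t ∈ F) : ∃ b ≤ t, Minimal (· ∈ F) b :=
    exists_minimal_le_of_wellFoundedLT (· ∈ F) t ht
  obtain ⟨e, he⟩ := (hBfin.image Finsupp.degree).bddAbove
  have hsub : ∀ᶠ k in U, F ⊆ E k := by
    have : ∀ᶠ k in U, ∀ b ∈ {b | Minimal (· ∈ F) b}, b ∈ E k :=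
      (Filter.eventually_all_finite hBfin).2 fun b hb ↦ hb.prop
    refine this.mono fun k hk t ht ↦ ?_
    obtain ⟨b, hbt, hb⟩ := hmin t ht
    exact hup k hbt (hk b hb)
  have hlarge : ∀ᶠ k in U, e ≤ k :=
    Filter.Eventually.filter_mono (Nat.hyperfilter_le_atTop) (Filter.eventually_ge_atTop e)
  obtain ⟨k, hk, hek⟩ := (hsub.and hlarge).exists
  have heq : t k ∈ F := by
    have := Set.eq_of_subset_of_ncard_le
      (Set.inter_subset_inter_left {s : σ →₀ ℕ | s.degree = (t k).degree} hk)
      (by rw [hFcard, hcard]) ((finite_setOf_degree_eq σ _).inter_of_right _)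
    exact (this.symm.subset ⟨ht k, rfl⟩).1
  obtain ⟨b, hbt, hb⟩ := hmin _ heq
  exact (hbad k b (hk hb.prop) hbt).not_ge ((he ⟨b, hb, rfl⟩).trans hek)

/-- The number of leading exponents of a finite-dimensional space of polynomials over a field is
its dimension. -/
theorem finrank_eq_ncard_degree {σ k : Type*} [Field k] (m : MonomialOrder σ)
    (U : Submodule k (MvPolynomial σ k)) [FiniteDimensional k U]
    (hfin : {t | ∃ f ∈ U, f ≠ 0 ∧ m.degree f = t}.Finite) :
    Module.finrank k U = {t | ∃ f ∈ U, f ≠ 0 ∧ m.degree f = t}.ncard := by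
  set E : Set (σ →₀ ℕ) := {t | ∃ f ∈ U, f ≠ 0 ∧ m.degree f = t} with hE
  classical
  have := hfin.fintype
  have hcard : E.ncard = Module.finrank k (E → k) := by
    rw [Module.finrank_fintype_fun_eq_card, ← Nat.card_coe_set_eq, Nat.card_eq_fintype_card]
  rw [hcard]
  apply le_antisymm
  · let ev : U →ₗ[k] (E → k) := LinearMap.pi fun t ↦ (lcoeff k (t : σ →₀ ℕ)).comp U.subtype
    refine LinearMap.finrank_le_finrank_of_injective (f := ev) ?_
    refine (injective_iff_map_eq_zero ev).2 fun f hf ↦ ?_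
    by_contra hne
    have hne' : (f : MvPolynomial σ k) ≠ 0 := by simpa using hne
    have := congrFun hf ⟨m.degree (f : MvPolynomial σ k), f, f.2, hne', rfl⟩
    exact m.coeff_degree_ne_zero_iff.2 hne' (by simpa [ev] using this)
  · choose g hgU hg0 hgdeg using fun t : E ↦ t.2
    let Φ : (E → k) →ₗ[k] U :=
      Fintype.linearCombination k (fun t ↦ (⟨g t, hgU t⟩ : U))
    refine LinearMap.finrank_le_finrank_of_injective (f := Φ) ?_
    refine (injective_iff_map_eq_zero Φ).2 fun c hc ↦ ?_
    by_contra hne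
    have hs : (Finset.univ.filter fun t : E ↦ c t ≠ 0).Nonempty := by
      obtain ⟨t, ht⟩ := Function.ne_iff.1 hne
      exact ⟨t, by simpa using ht⟩
    obtain ⟨t, ht, hmax⟩ := Finset.exists_max_image _ (fun t : E ↦ m.toSyn t) hs
    have h0 : ∑ s : E, c s * coeff t (g s) = 0 := by
      have := congrArg (fun u : U ↦ coeff (t : σ →₀ ℕ) (u : MvPolynomial σ k)) hc
      simpa [Φ, Fintype.linearCombination_apply, coeff_sum] using this
    rw [Finset.sum_eq_single t] at h0
    · have h1 := m.coeff_degree_ne_zero_iff.2 (hg0 t)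
      rw [hgdeg] at h1
      simp only [Finset.mem_filter, Finset.mem_univ, true_and] at ht
      exact mul_ne_zero ht h1 h0
    · intro s _ hst
      by_cases hcs : c s = 0
      · simp [hcs]
      · have hle := hmax s (by simpa using hcs)
        have hlt : m.toSyn (m.degree (g s)) < m.toSyn t := by
          rw [hgdeg]
          exact lt_of_le_of_ne hle fun h ↦ hst (Subtype.ext (m.toSyn.injective h))
        rw [m.coeff_eq_zero_of_lt hlt, mul_zero]
    · simp

/-- The exponents of leading monomials of homogeneous elements of an ideal. -/
def leadingExponents {σ k : Type*} [Field k] (m : MonomialOrder σ)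
    (V : Ideal (MvPolynomial σ k)) : Set (σ →₀ ℕ) :=
  {t | ∃ f ∈ V, f.IsHomogeneous t.degree ∧ f ≠ 0 ∧ m.degree f = t}

theorem isUpperSet_leadingExponents {σ k : Type*} [Field k] (m : MonomialOrder σ)
    (V : Ideal (MvPolynomial σ k)) : IsUpperSet (leadingExponents m V) := by
  classical
  rintro s t hst ⟨f, hf, hhom, h0, hdeg⟩
  obtain ⟨u, rfl⟩ := exists_add_of_le hst
  refine ⟨monomial u 1 * f, V.mul_mem_left _ hf, ?_, by simpa using h0, ?_⟩
  · rw [map_add, add_comm]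
    exact (isHomogeneous_monomial 1 rfl).mul hhom
  · rw [m.degree_mul (by simp) h0, m.degree_monomial, if_neg one_ne_zero, hdeg, add_comm]

theorem MvPolynomial.IsHomogeneous.degree_degree {σ k : Type*} [Field k] (m : MonomialOrder σ)
    {f : MvPolynomial σ k} {d : ℕ} (hf : f.IsHomogeneous d) (h0 : f ≠ 0) :
    (m.degree f).degree = d := by
  by_contra h
  exact m.coeff_degree_ne_zero_iff.2 h0 (hf.coeff_eq_zero h)

theorem ncard_leadingExponents {σ k : Type*} [Finite σ] [Field k] (m : MonomialOrder σ)
    (V : Ideal (MvPolynomial σ k)) (d : ℕ) :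
    (leadingExponents m V ∩ {t | t.degree = d}).ncard =
      Module.finrank k (V.restrictScalars k ⊓ homogeneousSubmodule σ k d : Submodule k _) := by
  have : FiniteDimensional k (homogeneousSubmodule σ k d) :=
    Module.Finite.iff_fg.2 (homogeneousSubmodule_fg σ k d)
  have : FiniteDimensional k (V.restrictScalars k ⊓ homogeneousSubmodule σ k d : Submodule k _) :=
    Submodule.finiteDimensional_of_le inf_le_right
  have heq : leadingExponents m V ∩ {t | t.degree = d} =
      {t | ∃ f ∈ (V.restrictScalars k ⊓ homogeneousSubmodule σ k d : Submodule k _),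
        f ≠ 0 ∧ m.degree f = t} := by
    ext t
    constructor
    · rintro ⟨⟨f, hf, hhom, h0, hdeg⟩, rfl⟩
      exact ⟨f, ⟨hf, hhom⟩, h0, hdeg⟩
    · rintro ⟨f, ⟨hf, hhom⟩, h0, rfl⟩
      have := MvPolynomial.IsHomogeneous.degree_degree m hhom h0
      exact ⟨⟨f, hf, by rwa [this], h0, rfl⟩, this⟩
  rw [finrank_eq_ncard_degree m, heq]
  rw [← heq]
  exact (finite_setOf_degree_eq σ d).inter_of_right _

theorem finrank_homogeneousSubmodule {σ k : Type*} [Finite σ] [Field k] (m : MonomialOrder σ)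
    (d : ℕ) :
    Module.finrank k (homogeneousSubmodule σ k d) = {t : σ →₀ ℕ | t.degree = d}.ncard := by
  classical
  have h := ncard_leadingExponents m (⊤ : Ideal (MvPolynomial σ k)) d
  rw [Submodule.restrictScalars_top, top_inf_eq] at h
  rw [← h]
  congr 1
  refine Set.inter_eq_right.2 fun t ht ↦ ⟨monomial t 1, trivial, isHomogeneous_monomial 1 rfl,
    by simp, by rw [m.degree_monomial, if_neg one_ne_zero]⟩

/-- Homogeneous elements of an ideal lie in the span of those of degree at most `e`, provided the
leading exponents are generated in degrees at most `e`. -/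
theorem mem_span_of_leadingExponents {σ k : Type*} [Field k] (m : MonomialOrder σ)
    (V : Ideal (MvPolynomial σ k)) (e : ℕ)
    (he : ∀ t ∈ leadingExponents m V, ∃ b ∈ leadingExponents m V, b ≤ t ∧ b.degree ≤ e)
    {f : MvPolynomial σ k} {d : ℕ} (hf : f ∈ V) (hhom : f.IsHomogeneous d) :
    f ∈ Ideal.span {g | g ∈ V ∧ ∃ d' ≤ e, g.IsHomogeneous d'} := by
  induction hs : m.toSyn (m.degree f) using WellFoundedLT.induction generalizing f with
  | ind s ih =>
    subst hs
    by_cases h0 : f = 0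
    · simp [h0]
    by_cases hdeg : m.degree f = 0
    · refine Ideal.subset_span ⟨hf, 0, zero_le, ?_⟩
      rw [m.eq_C_of_degree_eq_zero hdeg]
      exact isHomogeneous_C _ _
    have hfd := MvPolynomial.IsHomogeneous.degree_degree m hhom h0
    obtain ⟨b, ⟨g, hgV, hghom, hg0, rfl⟩, hbt, hbe⟩ :=
      he (m.degree f) ⟨f, hf, by rwa [hfd], h0, rfl⟩
    have hu : IsUnit (m.leadingCoeff g) := (m.leadingCoeff_ne_zero_iff.2 hg0).isUnit
    have hgspan : g ∈ Ideal.span {g | g ∈ V ∧ ∃ d' ≤ e, g.IsHomogeneous d'} :=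
      Ideal.subset_span ⟨hgV, _, hbe, hghom⟩
    have hred := m.degree_reduce_lt hu hbt hdeg
    have hmem := ih _ hred (f := m.reduce hu f) ?_ ?_ rfl
    · have := Ideal.add_mem _ hmem (Ideal.mul_mem_left _ (monomial (m.degree f - m.degree g)
        (hu.unit⁻¹ * m.leadingCoeff f)) hgspan)
      simpa [MonomialOrder.reduce] using this
    · exact V.sub_mem hf (V.mul_mem_left _ hgV)
    · refine hhom.sub ?_
      have : d = (m.degree f - m.degree g).degree + (m.degree g).degree := by
        rw [← map_add, tsub_add_cancel_of_le hbt, hfd]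
      rw [this]
      exact (isHomogeneous_monomial _ rfl).mul hghom

theorem IsPruferDomain.flat {D : Type u} [CommRing D] [IsDomain D] (hD : IsPruferDomain D)
    (M : Type*) [AddCommGroup M] [Module D M] [Module.IsTorsionFree D M] : Module.Flat D M := by
  rw [Module.Flat.flat_iff_torsion_eq_bot_of_valuationRing_localization_isMaximal
    (fun P _ ↦ hD P), ← Submodule.isTorsionFree_iff_torsion_eq_bot]
  infer_instance

theorem Module.Projective.of_finite_of_flat_of_isDomain {D : Type*} [CommRing D] [IsDomain D]
    (M : Type*) [AddCommGroup M] [Module D M] [Module.Finite D M] [Module.Flat D M] :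
    Module.Projective D M := by
  have key (P : Ideal D) [P.IsPrime] :
      ∃ a ∉ P, Module.Free (Localization.Away a) (LocalizedModule.Away a M) := by
    refine Module.Free.away_of_finite_of_flat_of_rankAtStalk_constant M P fun m _ ↦ ?_
    rw [← Ideal.finrank_fiber_eq_rankAtStalk, ← Ideal.finrank_fiber_eq_rankAtStalk,
      Ideal.finrank_fiber_eq_finrank, Ideal.finrank_fiber_eq_finrank]
  let s : Set D := {a | Module.Free (Localization.Away a) (LocalizedModule.Away a M)}
  have hs : Ideal.span s = ⊤ := by
    by_contra h
    obtain ⟨P, hP, hle⟩ := Ideal.exists_le_maximal _ h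
    obtain ⟨a, haP, ha⟩ := key P
    exact haP (hle (Ideal.subset_span ha))
  have : Module.FinitePresentation D M := by
    refine Module.FinitePresentation.of_localizationSpan s hs fun g ↦ ?_
    have : Module.Free (Localization.Away g.1) (LocalizedModule.Away g.1 M) := g.2
    exact Module.finitePresentation_of_projective _ _
  exact Module.Flat.projective_of_finitePresentation

theorem IsPruferDomain.projective {D : Type u} [CommRing D] [IsDomain D] (hD : IsPruferDomain D)
    (M : Type*) [AddCommGroup M] [Module D M] [Module.Finite D M] [Module.IsTorsionFree D M] :
    Module.Projective D M :=
  have := hD.flat M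
  .of_finite_of_flat_of_isDomain M

/-- Nakayama's lemma at all maximal ideals simultaneously. -/
theorem Submodule.le_of_forall_isMaximal_le_sup_smul {R M : Type*} [CommRing R] [AddCommGroup M]
    [Module R M] {N N' : Submodule R M} (hN : N.FG)
    (h : ∀ P : Ideal R, P.IsMaximal → N ≤ N' ⊔ P • N) : N ≤ N' := by
  by_contra hle
  have hne : (N'.colon (N : Set M)) ≠ ⊤ := by
    intro htop
    refine hle fun x hx ↦ ?_
    have := Submodule.mem_colon.1 (htop ▸ Submodule.mem_top : (1 : R) ∈ _) x hx
    simpa using this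
  obtain ⟨P, hP, hPle⟩ := Ideal.exists_le_maximal _ hne
  obtain ⟨r, hr, hrN⟩ := Submodule.exists_sub_one_mem_and_smul_le_of_fg_of_le_sup hN (h P hP) le_rfl
  have : r ∈ P := hPle (Submodule.mem_colon.2 fun x hx ↦
    hrN (Submodule.smul_mem_pointwise_smul _ _ _ (h P hP hx)))
  exact hP.ne_top ((Ideal.eq_top_iff_one _).2 (by simpa using P.sub_mem this hr))

theorem MvPolynomial.homogeneousComponent_map {σ R S : Type*} [CommSemiring R] [CommSemiring S]
    (φ : R →+* S) (d : ℕ) (f : MvPolynomial σ R) :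
    homogeneousComponent d (map φ f) = map φ (homogeneousComponent d f) := by
  ext t
  simp only [coeff_homogeneousComponent, coeff_map]
  split_ifs <;> simp

theorem MvPolynomial.IsHomogeneous.homogeneousComponent_self {σ R : Type*} [CommSemiring R]
    {d : ℕ} {f : MvPolynomial σ R} (hf : f.IsHomogeneous d) : homogeneousComponent d f = f := by
  rw [homogeneousComponent_of_mem hf, if_pos rfl]

theorem finrank_map_inf_homogeneousSubmodule {D k σ : Type*} [CommRing D] [Field k] [Algebra D k]
    [Finite σ] (hsurj : Function.Surjective (algebraMap D k)) (J : Ideal (MvPolynomial σ D))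
    (hJ : ∀ f ∈ J, ∀ d, homogeneousComponent d f ∈ J) (d : ℕ) :
    Module.finrank k (k ⊗[D] (MvPolynomial σ D ⧸
        (J.restrictScalars D).comap (homogeneousComponent d))) +
      Module.finrank k ((J.map (map (algebraMap D k))).restrictScalars k ⊓
        homogeneousSubmodule σ k d : Submodule k _) =
      Module.finrank k (homogeneousSubmodule σ k d) := by
  have hsurj' : Function.Surjective (MvPolynomial.map (σ := σ) (algebraMap D k)) :=
    MvPolynomial.map_surjective _ hsurj
  set K : Submodule D (MvPolynomial σ D) :=
    (J.restrictScalars D).comap (homogeneousComponent d) with hK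
  set V := J.map (map (algebraMap D k))
  set H := homogeneousSubmodule σ k d
  have : FiniteDimensional k H := Module.Finite.iff_fg.2 (homogeneousSubmodule_fg σ k d)
  let e := (algebraTensorAlgEquiv D (σ := σ) k).toLinearEquiv
  have he (c : k) (f : MvPolynomial σ D) : e (c ⊗ₜ f) = c • map (algebraMap D k) f :=
    algebraTensorAlgEquiv_tmul D k c f
  have hes (f : MvPolynomial σ D) : e.symm (map (algebraMap D k) f) = 1 ⊗ₜ f := by
    rw [e.symm_apply_eq, he, one_smul]
  let Ψ : k ⊗[D] MvPolynomial σ D →ₗ[k] k ⊗[D] (MvPolynomial σ D ⧸ K) := K.mkQ.baseChange k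
  have hΨ0 (f : MvPolynomial σ D) (hf : f ∈ K) : Ψ (1 ⊗ₜ f) = 0 := by
    simp [Ψ, (Submodule.Quotient.mk_eq_zero K).2 hf]
  let θ : H →ₗ[k] k ⊗[D] (MvPolynomial σ D ⧸ K) := Ψ ∘ₗ e.symm.toLinearMap ∘ₗ H.subtype
  have hθsurj : LinearMap.range θ = ⊤ := by
    rw [eq_top_iff]
    rintro x -
    induction x with
    | zero => exact zero_mem _
    | add x y hx hy => exact add_mem hx hy
    | tmul c q =>
      obtain ⟨f, rfl⟩ := K.mkQ_surjective q
      refine ⟨⟨c • map (algebraMap D k) (homogeneousComponent d f), H.smul_mem _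
        ((homogeneousComponent_isHomogeneous d f).map _)⟩, ?_⟩
      have hsub : f - homogeneousComponent d f ∈ K := by
        simp only [hK, Submodule.mem_comap, map_sub]
        rw [(homogeneousComponent_isHomogeneous d f).homogeneousComponent_self, sub_self]
        exact zero_mem _
      have h1 := hΨ0 _ hsub
      rw [TensorProduct.tmul_sub, map_sub, sub_eq_zero] at h1
      simp only [θ, LinearMap.comp_apply, Submodule.subtype_apply, LinearEquiv.coe_coe, map_smul,
        hes, ← h1]
      simp [Ψ, TensorProduct.smul_tmul']
  have hθker : (LinearMap.ker θ).map H.subtype = V.restrictScalars k ⊓ H := by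
    ext h
    constructor
    · rintro ⟨⟨h, hh⟩, hker, rfl⟩
      refine ⟨?_, hh⟩
      have hex : Function.Exact (K.subtype.lTensor k) (K.mkQ.lTensor k) :=
        lTensor_exact k (LinearMap.exact_subtype_mkQ K) K.mkQ_surjective
      obtain ⟨y, hy⟩ := (hex (e.symm h)).1 hker
      have key : ∀ y : k ⊗[D] K, homogeneousComponent d (e (K.subtype.lTensor k y)) ∈ V := by
        intro y
        induction y with
        | zero => simp
        | add x y hx hy => simpa using add_mem hx hy
        | tmul c g =>
          rw [LinearMap.lTensor_tmul, he, map_smul, homogeneousComponent_map]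
          exact (V.restrictScalars k).smul_mem _ (Ideal.mem_map_of_mem _ g.2)
      have := key y
      rwa [hy, e.apply_symm_apply, (show h.IsHomogeneous d from hh).homogeneousComponent_self]
        at this
    · rintro ⟨hV, hh⟩
      refine ⟨⟨h, hh⟩, ?_, rfl⟩
      obtain ⟨j, hj, rfl⟩ := (Ideal.mem_map_iff_of_surjective _ hsurj').1 hV
      have hcomp :=
        (show (map (algebraMap D k) j).IsHomogeneous d from hh).homogeneousComponent_self
      rw [homogeneousComponent_map] at hcomp
      simp only [SetLike.mem_coe, LinearMap.mem_ker, θ, LinearMap.comp_apply,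
        Submodule.subtype_apply, LinearEquiv.coe_coe]
      rw [← hcomp, hes]
      exact hΨ0 _ (hJ _ (hJ _ hj d) d)
  rw [← hθker, ← LinearMap.finrank_range_add_finrank_ker θ, hθsurj, finrank_top,
    LinearEquiv.finrank_eq (Submodule.equivMapOfInjective H.subtype H.injective_subtype _)]

theorem MvPolynomial.homogeneousComponent_mem_span {σ R : Type*} [CommRing R]
    {s : Set (MvPolynomial σ R)} (hs : ∀ g ∈ s, ∃ d, g.IsHomogeneous d) {f : MvPolynomial σ R}
    (hf : f ∈ Ideal.span s) (d : ℕ) : homogeneousComponent d f ∈ Ideal.span s := by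
  let _ : GradedAlgebra (homogeneousSubmodule σ R) := gradedAlgebra
  have := Ideal.homogeneous_span (homogeneousSubmodule σ R) s hs d hf
  rwa [← decomposition.decompose'_apply]

theorem finite_quotient_comap_homogeneousComponent {σ R : Type*} [Finite σ] [CommRing R]
    (N : Submodule R (MvPolynomial σ R)) (d : ℕ) :
    Module.Finite R (MvPolynomial σ R ⧸ N.comap (homogeneousComponent d)) := by
  set K := N.comap (homogeneousComponent d) with hK
  have : Module.Finite R (homogeneousSubmodule σ R d) :=
    Module.Finite.iff_fg.2 (homogeneousSubmodule_fg σ R d)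
  refine Module.Finite.of_surjective (K.mkQ ∘ₗ (homogeneousSubmodule σ R d).subtype) fun q ↦ ?_
  obtain ⟨f, rfl⟩ := K.mkQ_surjective q
  refine ⟨⟨homogeneousComponent d f, homogeneousComponent_isHomogeneous d f⟩, ?_⟩
  refine (Submodule.Quotient.eq K).2 ?_
  simp [hK, (homogeneousComponent_isHomogeneous d f).homogeneousComponent_self]

theorem isTorsionFree_quotient_comap_homogeneousComponent {σ R : Type*} [CommRing R] [IsDomain R]
    (J : Ideal (MvPolynomial σ R)) [Module.IsTorsionFree R (MvPolynomial σ R ⧸ J)] (d : ℕ) :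
    Module.IsTorsionFree R (MvPolynomial σ R ⧸
      (J.restrictScalars R).comap (homogeneousComponent d)) := by
  refine .of_smul_eq_zero fun c q hq ↦ ?_
  obtain ⟨f, rfl⟩ := Submodule.Quotient.mk_surjective _ q
  rw [← Submodule.Quotient.mk_smul, Submodule.Quotient.mk_eq_zero, Submodule.mem_comap, map_smul,
    Submodule.restrictScalars_mem, ← Ideal.Quotient.eq_zero_iff_mem] at hq
  have hq' : c • Ideal.Quotient.mk J (homogeneousComponent d f) = 0 := hq
  refine (smul_eq_zero.1 hq').imp_right fun h ↦ ?_
  rwa [Submodule.Quotient.mk_eq_zero, Submodule.mem_comap, Submodule.restrictScalars_mem,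
    ← Ideal.Quotient.eq_zero_iff_mem]

section
variable {D : Type u} [CommRing D] [IsDomain D] {σ : Type*} [Finite σ]

theorem IsPruferDomain.exists_retraction_homogeneous (hD : IsPruferDomain D)
    (J : Ideal (MvPolynomial σ D)) [Module.IsTorsionFree D (MvPolynomial σ D ⧸ J)]
    (hJ : ∀ f ∈ J, ∀ d, homogeneousComponent d f ∈ J) (d : ℕ) :
    ∃ ρ : MvPolynomial σ D →ₗ[D] MvPolynomial σ D,
      LinearMap.range ρ = J.restrictScalars D ⊓ homogeneousSubmodule σ D d ∧
      ∀ f ∈ J, f.IsHomogeneous d → ρ f = f := by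
  set K := (J.restrictScalars D).comap (homogeneousComponent d) with hK
  have := finite_quotient_comap_homogeneousComponent (J.restrictScalars D) d
  have := isTorsionFree_quotient_comap_homogeneousComponent J d
  have := hD.projective (MvPolynomial σ D ⧸ K)
  obtain ⟨s, hs⟩ := K.mkQ.exists_rightInverse_of_surjective K.range_mkQ
  have hs' (q) : K.mkQ (s q) = q := LinearMap.congr_fun hs q
  have hid : ∀ f ∈ J, f.IsHomogeneous d →
      (homogeneousComponent d ∘ₗ (LinearMap.id - s ∘ₗ K.mkQ)) f = f := by
    intro f hf hhom
    have : K.mkQ f = 0 := (Submodule.Quotient.mk_eq_zero K).2 (hJ f hf d)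
    simp [this, hhom.homogeneousComponent_self]
  refine ⟨homogeneousComponent d ∘ₗ (LinearMap.id - s ∘ₗ K.mkQ), le_antisymm ?_ ?_, hid⟩
  · rintro _ ⟨f, rfl⟩
    refine ⟨?_, homogeneousComponent_isHomogeneous _ _⟩
    have : f - s (K.mkQ f) ∈ K := by
      rw [← Submodule.Quotient.mk_eq_zero, ← K.mkQ_apply, map_sub, hs', sub_self]
    exact this
  · rintro f ⟨hf, hhom⟩
    exact ⟨f, hid f hf hhom⟩

theorem MvPolynomial.mem_smul_top_of_map_eq_zero {R k σ : Type*} [CommRing R] [CommRing k]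
    (φ : R →+* k) {f : MvPolynomial σ R} (hf : map φ f = 0) :
    f ∈ RingHom.ker φ • (⊤ : Submodule R (MvPolynomial σ R)) := by
  rw [f.as_sum]
  refine sum_mem fun t _ ↦ ?_
  rw [← mul_one (coeff t f), ← smul_eq_mul, ← smul_monomial]
  refine Submodule.smul_mem_smul ?_ trivial
  rw [RingHom.mem_ker, ← coeff_map, hf, coeff_zero]

theorem IsPruferDomain.exists_degree_bound (hD : IsPruferDomain D) {n : ℕ}
    (J : Ideal (MvPolynomial (Fin n) D)) [Module.IsTorsionFree D (MvPolynomial (Fin n) D ⧸ J)]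
    (hJ : ∀ f ∈ J, ∀ d, homogeneousComponent d f ∈ J) :
    ∃ e, ∀ P : Ideal D, ∀ [P.IsMaximal],
      ∀ t ∈ leadingExponents MonomialOrder.lex (J.map (map (algebraMap D P.ResidueField))),
      ∃ b ∈ leadingExponents MonomialOrder.lex (J.map (map (algebraMap D P.ResidueField))),
        b ≤ t ∧ b.degree ≤ e := by
  obtain ⟨e, he⟩ := exists_degree_bound_of_ncard_degree_eq (σ := Fin n) fun d ↦
    {t : Fin n →₀ ℕ | t.degree = d}.ncard - Module.finrank D (MvPolynomial (Fin n) D ⧸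
      (J.restrictScalars D).comap (homogeneousComponent d))
  refine ⟨e, fun P _ ↦ he _ (isUpperSet_leadingExponents _ _) fun d ↦ ?_⟩
  have := finite_quotient_comap_homogeneousComponent (J.restrictScalars D) d
  have := isTorsionFree_quotient_comap_homogeneousComponent J d
  have := hD.flat (MvPolynomial (Fin n) D ⧸
    (J.restrictScalars D).comap (homogeneousComponent d))
  rw [ncard_leadingExponents, ← finrank_homogeneousSubmodule (k := P.ResidueField)
    MonomialOrder.lex, ← finrank_map_inf_homogeneousSubmodule
    P.algebraMap_residueField_surjective J hJ d, ← Ideal.finrank_fiber_eq_finrank P,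
    Nat.add_sub_cancel_left]

theorem MvPolynomial.fg_of_homogeneous_le {R σ : Type*} [CommRing R] [Finite σ]
    {J : Ideal (MvPolynomial σ R)}
    (hJ : ∀ f ∈ J, ∀ d, homogeneousComponent d f ∈ J)
    (hfg : ∀ d, (J.restrictScalars R ⊓ homogeneousSubmodule σ R d).FG) (e : ℕ)
    (h : ∀ d, ∀ f ∈ J, f.IsHomogeneous d →
      f ∈ Ideal.span {g | g ∈ J ∧ ∃ d ≤ e, g.IsHomogeneous d}) : J.FG := by
  have hle : J = ⨆ d ∈ Finset.range (e + 1),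
      Ideal.span (J.restrictScalars R ⊓ homogeneousSubmodule σ R d : Submodule R _) := by
    apply le_antisymm
    · intro f hf
      rw [← sum_homogeneousComponent f]
      refine sum_mem fun d _ ↦ ?_
      refine Ideal.span_le.2 ?_ (h d _ (hJ f hf d) (homogeneousComponent_isHomogeneous d f))
      rintro g ⟨hg, d, hd, hhom⟩
      refine Ideal.mem_iSup_of_mem d (Ideal.mem_iSup_of_mem (by simpa using hd)
        (Ideal.subset_span ⟨hg, hhom⟩))
    · exact iSup₂_le fun d _ ↦ Ideal.span_le.2 fun f hf ↦ hf.1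
  rw [hle]
  refine Submodule.fg_biSup _ _ fun d _ ↦ ?_
  obtain ⟨s, hs⟩ := hfg d
  refine ⟨s, ?_⟩
  rw [← hs]
  exact (Submodule.span_span_of_tower _ _ _).symm

theorem IsPruferDomain.fg_of_homogeneous (hD : IsPruferDomain D) {n : ℕ}
    (J : Ideal (MvPolynomial (Fin n) D)) [Module.IsTorsionFree D (MvPolynomial (Fin n) D ⧸ J)]
    (hJ : ∀ f ∈ J, ∀ d, homogeneousComponent d f ∈ J) : J.FG := by
  obtain ⟨e, he⟩ := hD.exists_degree_bound J hJ
  choose ρ hρ hρid using hD.exists_retraction_homogeneous J hJ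
  have hfg (d : ℕ) : (J.restrictScalars D ⊓ homogeneousSubmodule (Fin n) D d).FG := by
    have : J.restrictScalars D ⊓ homogeneousSubmodule (Fin n) D d =
        (homogeneousSubmodule (Fin n) D d).map (ρ d) := by
      apply le_antisymm
      · rintro f ⟨hf, hhom⟩
        exact ⟨f, hhom, hρid d f hf hhom⟩
      · exact (LinearMap.map_le_range).trans (hρ d).le
    rw [this]
    exact (homogeneousSubmodule_fg _ D d).map _
  refine fg_of_homogeneous_le hJ hfg e fun d ↦ ?_
  set J' : Ideal (MvPolynomial (Fin n) D) := Ideal.span {g | g ∈ J ∧ ∃ d ≤ e, g.IsHomogeneous d}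
  have hJ' : ∀ f ∈ J', ∀ d, homogeneousComponent d f ∈ J' := by
    refine fun f hf d ↦ homogeneousComponent_mem_span ?_ hf d
    rintro g ⟨_, d, _, hg⟩
    exact ⟨d, hg⟩
  have hJ'J : J' ≤ J := Ideal.span_le.2 fun g hg ↦ hg.1
  suffices J.restrictScalars D ⊓ homogeneousSubmodule (Fin n) D d ≤ J'.restrictScalars D from
    fun f hf hhom ↦ this ⟨hf, hhom⟩
  refine Submodule.le_of_forall_isMaximal_le_sup_smul (hfg d) fun P _ ↦ ?_
  rintro f ⟨hf, hhom : f.IsHomogeneous d⟩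
  set φ := algebraMap D P.ResidueField
  have hsurj : Function.Surjective (map (σ := Fin n) φ) :=
    MvPolynomial.map_surjective _ P.algebraMap_residueField_surjective
  have hmem := mem_span_of_leadingExponents _ _ e (he P) (Ideal.mem_map_of_mem (map φ) hf)
    (hhom.map φ)
  have hle : Ideal.span {g | g ∈ J.map (map φ) ∧ ∃ d' ≤ e, g.IsHomogeneous d'} ≤
      J'.map (map φ) := by
    refine Ideal.span_le.2 ?_
    rintro g ⟨hg, d', hd', hghom⟩
    obtain ⟨j, hj, rfl⟩ := (Ideal.mem_map_iff_of_surjective _ hsurj).1 hg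
    rw [← hghom.homogeneousComponent_self, homogeneousComponent_map]
    exact Ideal.mem_map_of_mem _ (Ideal.subset_span
      ⟨hJ j hj d', d', hd', homogeneousComponent_isHomogeneous _ _⟩)
  obtain ⟨j, hj, hjf⟩ := (Ideal.mem_map_iff_of_surjective _ hsurj).1 (hle hmem)
  have hp : map φ (f - homogeneousComponent d j) = 0 := by
    rw [map_sub, ← homogeneousComponent_map, hjf, (hhom.map φ).homogeneousComponent_self, sub_self]
  have hpJ : ρ d (f - homogeneousComponent d j) = f - homogeneousComponent d j :=
    hρid d _ (J.sub_mem hf (hJ _ (hJ'J hj) d)) (hhom.sub (homogeneousComponent_isHomogeneous d j))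
  refine Submodule.mem_sup.2 ⟨_, hJ' j hj d, f - homogeneousComponent d j, ?_, by abel⟩
  have := Submodule.mem_map_of_mem (f := ρ d) (mem_smul_top_of_map_eq_zero φ hp)
  rwa [Submodule.map_smul'', Submodule.map_top, hρ, hpJ, Ideal.ker_algebraMap_residueField] at this

end

/-- Setting the first variable to `1`. -/
noncomputable def MvPolynomial.dehomogenize (R : Type*) [CommSemiring R] (n : ℕ) :
    MvPolynomial (Fin (n + 1)) R →ₐ[R] MvPolynomial (Fin n) R :=
  aeval (Fin.cons 1 X)

theorem MvPolynomial.exists_isHomogeneous_dehomogenize_eq {R : Type*} [CommSemiring R] {n : ℕ}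
    (f : MvPolynomial (Fin n) R) :
    ∃ F d, F.IsHomogeneous d ∧ dehomogenize R n F = f := by
  refine ⟨∑ t ∈ f.support, X 0 ^ (f.totalDegree - t.degree) *
    rename Fin.succ (monomial t (coeff t f)), f.totalDegree, ?_, ?_⟩
  · refine IsHomogeneous.sum _ _ _ fun t ht ↦ ?_
    have h := ((isHomogeneous_X_pow (R := R) (0 : Fin (n + 1)) (f.totalDegree - t.degree))).mul
      ((isHomogeneous_monomial (d := t) (coeff t f) rfl).rename_isHomogeneous (f := Fin.succ))
    rwa [tsub_add_cancel_of_le (show t.degree ≤ f.totalDegree from le_totalDegree ht)] at h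
  · conv_rhs => rw [f.as_sum]
    rw [map_sum]
    refine Finset.sum_congr rfl fun t _ ↦ ?_
    have : (Fin.cons 1 X : Fin (n + 1) → MvPolynomial (Fin n) R) ∘ Fin.succ = X := by
      ext1 i; simp
    rw [map_mul, map_pow, dehomogenize, aeval_X, Fin.cons_zero, one_pow, one_mul, aeval_rename,
      this, aeval_X_left_apply]

/-- An ideal of a polynomial ring over a Prüfer domain is finitely generated if its quotient is
torsion-free over the base. -/
theorem IsPruferDomain.fg_of_isTorsionFree_quotient {D : Type u} [CommRing D] [IsDomain D]
    (hD : IsPruferDomain D) {n : ℕ} (I : Ideal (MvPolynomial (Fin n) D))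
    [Module.IsTorsionFree D (MvPolynomial (Fin n) D ⧸ I)] : I.FG := by
  set φ := dehomogenize D n
  set J : Ideal (MvPolynomial (Fin (n + 1)) D) := Ideal.span {F | φ F ∈ I ∧ ∃ d, F.IsHomogeneous d}
  have hJI : J ≤ I.comap φ := Ideal.span_le.2 fun F hF ↦ hF.1
  have hJ : ∀ F ∈ J, ∀ d, homogeneousComponent d F ∈ J := fun F hF d ↦
    homogeneousComponent_mem_span (fun g hg ↦ hg.2) hF d
  have : Module.IsTorsionFree D (MvPolynomial (Fin (n + 1)) D ⧸ J) := by
    refine .of_smul_eq_zero fun c q hq ↦ ?_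
    obtain ⟨F, rfl⟩ := Ideal.Quotient.mk_surjective q
    refine or_iff_not_imp_left.2 fun hc ↦ Ideal.Quotient.eq_zero_iff_mem.2 ?_
    have hcF : c • F ∈ J := Ideal.Quotient.eq_zero_iff_mem.1 hq
    rw [← sum_homogeneousComponent F]
    refine sum_mem fun d _ ↦ Ideal.subset_span
      ⟨?_, d, homogeneousComponent_isHomogeneous d F⟩
    have h := hJI (hJ _ hcF d)
    rw [Ideal.mem_comap, map_smul, map_smul, ← Ideal.Quotient.eq_zero_iff_mem] at h
    have h' : c • Ideal.Quotient.mk I (φ (homogeneousComponent d F)) = 0 := h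
    exact Ideal.Quotient.eq_zero_iff_mem.1 ((smul_eq_zero.1 h').resolve_left hc)
  have hIJ : I = J.map φ := by
    refine le_antisymm (fun f hf ↦ ?_) (Ideal.map_le_iff_le_comap.2 hJI)
    obtain ⟨F, d, hF, rfl⟩ := exists_isHomogeneous_dehomogenize_eq f
    exact Ideal.mem_map_of_mem _ (Ideal.subset_span ⟨hf, d, hF⟩)
  rw [hIJ]
  exact (hD.fg_of_homogeneous J hJ).map _

/-- Torsion-free algebras of finite type over a Prüfer domain are finitely presented. -/
theorem IsPruferDomain.algebra_finitePresentation {D : Type u} [CommRing D] [IsDomain D]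
    (hD : IsPruferDomain D) (A : Type*) [CommRing A] [Algebra D A] [Algebra.FiniteType D A]
    [Module.IsTorsionFree D A] : Algebra.FinitePresentation D A := by
  obtain ⟨n, f, hf⟩ := Algebra.FiniteType.iff_quotient_mvPolynomial''.1
    ‹Algebra.FiniteType D A›
  refine ⟨n, f, hf, ?_⟩
  have : Module.IsTorsionFree D (MvPolynomial (Fin n) D ⧸ RingHom.ker f) :=
    (Ideal.quotientKerAlgEquivOfSurjective hf).injective.moduleIsTorsionFree _
      (map_smul (Ideal.quotientKerAlgEquivOfSurjective hf))
  exact hD.fg_of_isTorsionFree_quotient (RingHom.ker f)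

/-- A finite module over a torsion-free algebra of finite type over a Prüfer domain is finitely
presented if it is torsion-free over the base. -/
theorem IsPruferDomain.module_finitePresentation {D : Type u} [CommRing D] [IsDomain D]
    (hD : IsPruferDomain D) (S N : Type*) [CommRing S] [Algebra D S] [Algebra.FiniteType D S]
    [Module.IsTorsionFree D S] [AddCommGroup N] [Module S N] [Module D N] [IsScalarTower D S N]
    [Module.Finite S N] [Module.IsTorsionFree D N] : Module.FinitePresentation S N := by
  let : Module Sᵐᵒᵖ N := Module.compHom N ((RingHom.id S).fromOpposite mul_comm)
  have : IsCentralScalar S N := ⟨fun _ _ ↦ rfl⟩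
  have : Module.Finite S (TrivSqZeroExt S N) := inferInstanceAs (Module.Finite S (S × N))
  have : Module.IsTorsionFree D (TrivSqZeroExt S N) :=
    inferInstanceAs (Module.IsTorsionFree D (S × N))
  have : Algebra.FiniteType D (TrivSqZeroExt S N) :=
    .trans (S := S) inferInstance inferInstance
  have := hD.algebra_finitePresentation (TrivSqZeroExt S N)
  have : Algebra.FinitePresentation S (TrivSqZeroExt S N) :=
    .of_restrict_scalars_finitePresentation D S _
  have := Module.FinitePresentation.of_finite_of_finitePresentation S (TrivSqZeroExt S N)
  refine Module.finitePresentation_of_surjective (TrivSqZeroExt.sndHom S N)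
    TrivSqZeroExt.snd_surjective ?_
  have : LinearMap.ker (TrivSqZeroExt.sndHom S N) =
      LinearMap.range (Algebra.linearMap S (TrivSqZeroExt S N)) := by
    ext x
    constructor
    · intro hx
      exact ⟨x.fst, TrivSqZeroExt.ext rfl (Eq.symm hx)⟩
    · rintro ⟨s, rfl⟩
      exact TrivSqZeroExt.snd_inl N s
  rw [this, LinearMap.range_eq_map]
  exact Module.Finite.fg_top.map _

theorem IsPruferDomain.isIntegrallyClosed {D : Type u} [CommRing D] [IsDomain D]
    (hD : IsPruferDomain D) : IsIntegrallyClosed D :=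
  .of_localization_maximal fun P _ _ ↦
    have := hD P
    inferInstance

theorem IsIntegrallyClosed.mem_range_of_smul_mem_range {A B : Type*} [CommRing A] [IsDomain A]
    [IsIntegrallyClosed A] [CommRing B] [IsDomain B] [Algebra A B] [FaithfulSMul A B]
    [Algebra.IsIntegral A B] {c : A} (hc : c ≠ 0) {b : B}
    (h : c • b ∈ LinearMap.range (Algebra.linearMap A B)) :
    b ∈ LinearMap.range (Algebra.linearMap A B) := by
  obtain ⟨a, ha⟩ := h
  rw [Algebra.linearMap_apply] at ha
  let L := FractionRing B
  have : FaithfulSMul A L := (faithfulSMul_iff_algebraMap_injective A L).2 <| by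
    rw [IsScalarTower.algebraMap_eq A B L]
    exact (IsFractionRing.injective B L).comp (FaithfulSMul.algebraMap_injective A B)
  let : Algebra (FractionRing A) L := FractionRing.liftAlgebra A L
  have hmap (x : A) : algebraMap (FractionRing A) L (algebraMap A _ x) =
      algebraMap B L (algebraMap A B x) := by
    rw [← IsScalarTower.algebraMap_apply, ← IsScalarTower.algebraMap_apply]
  have hcB : algebraMap B L (algebraMap A B c) ≠ 0 := by
    rw [← IsScalarTower.algebraMap_apply]
    exact (map_ne_zero_iff _ (FaithfulSMul.algebraMap_injective A L)).2 hc
  have hq : algebraMap (FractionRing A) L (algebraMap A _ a / algebraMap A _ c) =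
      algebraMap B L b := by
    rw [map_div₀, hmap, hmap, div_eq_iff hcB, ha, Algebra.smul_def,
      map_mul, mul_comm]
  have h_int : IsIntegral A (algebraMap A (FractionRing A) a / algebraMap A _ c) := by
    rw [← isIntegral_algebraMap_iff (algebraMap (FractionRing A) L).injective, hq]
    exact (Algebra.IsIntegral.isIntegral b).algebraMap
  obtain ⟨y, hy⟩ := IsIntegrallyClosed.algebraMap_eq_of_integral h_int
  refine ⟨y, IsFractionRing.injective B L ?_⟩
  rw [Algebra.linearMap_apply, ← hmap, hy, hq]

theorem IsPruferDomain.exists_retraction {A : Type u} [CommRing A] [IsDomain A]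
    (hA : IsPruferDomain A) (B : Type*) [CommRing B] [IsDomain B] [Algebra A B] [FaithfulSMul A B]
    [Module.Finite A B] : ∃ r : B →ₗ[A] A, ∀ a, r (algebraMap A B a) = a := by
  have := hA.isIntegrallyClosed
  set N := LinearMap.range (Algebra.linearMap A B)
  have : Module.IsTorsionFree A (B ⧸ N) := by
    refine .of_smul_eq_zero fun c q hq ↦ or_iff_not_imp_left.2 fun hc ↦ ?_
    obtain ⟨b, rfl⟩ := Submodule.Quotient.mk_surjective _ q
    rw [← Submodule.Quotient.mk_smul, Submodule.Quotient.mk_eq_zero] at hq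
    rw [Submodule.Quotient.mk_eq_zero]
    exact IsIntegrallyClosed.mem_range_of_smul_mem_range hc hq
  have := hA.projective (B ⧸ N)
  obtain ⟨s, hs⟩ := N.mkQ.exists_rightInverse_of_surjective N.range_mkQ
  have hs' (q) : N.mkQ (s q) = q := LinearMap.congr_fun hs q
  let e : A ≃ₗ[A] N := LinearEquiv.ofInjective (Algebra.linearMap A B)
    (FaithfulSMul.algebraMap_injective A B)
  have hmem (b : B) : (LinearMap.id - s ∘ₗ N.mkQ : B →ₗ[A] B) b ∈ N := by
    rw [← Submodule.Quotient.mk_eq_zero, ← N.mkQ_apply]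
    simp only [LinearMap.sub_apply, LinearMap.id_apply, LinearMap.comp_apply, map_sub, hs',
      sub_self]
  refine ⟨e.symm.toLinearMap ∘ₗ LinearMap.codRestrict N _ hmem, fun a ↦ e.injective ?_⟩
  have h0 : N.mkQ (algebraMap A B a) = 0 :=
    (Submodule.Quotient.mk_eq_zero N).2 ⟨a, rfl⟩
  ext
  simp only [LinearMap.comp_apply, LinearEquiv.coe_coe, e.apply_symm_apply,
    LinearMap.codRestrict_apply, LinearMap.sub_apply, h0, map_zero, sub_zero, LinearMap.id_apply]
  rfl

theorem MvPolynomial.exists_retraction_map {σ A B : Type*} [CommSemiring A] [CommSemiring B]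
    [Algebra A B] (r : B →ₗ[A] A) (hr : ∀ a, r (algebraMap A B a) = a) :
    ∃ ρ : MvPolynomial σ B →+ MvPolynomial σ A, (∀ p, ρ (map (algebraMap A B) p) = p) ∧
      ∀ p f, ρ (map (algebraMap A B) p * f) = p * ρ f := by
  let ρ : MvPolynomial σ B →+ MvPolynomial σ A :=
    { toFun f := AddMonoidAlgebra.ofCoeff ((AddMonoidAlgebra.coeff f).mapRange r (map_zero r))
      map_zero' := by ext t; exact map_zero r
      map_add' f g := by ext t; exact map_add r _ _ }
  have hρ (f : MvPolynomial σ B) (t : σ →₀ ℕ) : coeff t (ρ f) = r (coeff t f) := rfl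
  classical
  refine ⟨ρ, fun p ↦ ?_, fun p f ↦ ?_⟩
  · ext t
    rw [hρ, coeff_map, hr]
  · ext t
    simp only [hρ, coeff_mul, map_sum, coeff_map, ← Algebra.smul_def, map_smul, smul_eq_mul]

theorem exists_linearIndependent_forall_mem_span (T F : Type*) [CommRing T] [IsDomain T] [Field F]
    [Algebra T F] [IsFractionRing T F] {Ω : Type u} [AddCommGroup Ω] [Module F Ω] [Module T Ω]
    [IsScalarTower T F Ω] {τ : Type*} [Finite τ] (v : τ → Ω) :
    ∃ (ν : Type u) (_ : Fintype ν) (β : ν → Ω), LinearIndependent T β ∧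
      ∀ t, v t ∈ Submodule.span T (Set.range β) := by
  classical
  have := Fintype.ofFinite τ
  let V := Submodule.span F (Set.range v)
  have : Module.Finite F V := .span_of_finite F (Set.finite_range v)
  let B := Module.finBasis F V
  let e : ULift.{u} (Fin (Module.finrank F V)) ≃ Fin (Module.finrank F V) := Equiv.ulift
  have hv (t) : v t ∈ V := Submodule.subset_span ⟨t, rfl⟩
  obtain ⟨d, hd⟩ := IsLocalization.exist_integer_multiples_of_finite (nonZeroDivisors T)
    (fun x : τ × Fin (Module.finrank F V) ↦ B.repr ⟨v x.1, hv x.1⟩ x.2)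
  choose c hc using hd
  have hd0 : algebraMap T F d ≠ 0 := IsFractionRing.to_map_ne_zero_of_mem_nonZeroDivisors d.2
  refine ⟨ULift.{u} (Fin (Module.finrank F V)), inferInstance,
    fun j ↦ (algebraMap T F d)⁻¹ • (B (e j) : Ω), ?_, fun t ↦ ?_⟩
  · have h : LinearIndependent F fun j ↦ (algebraMap T F d)⁻¹ • (B (e j) : Ω) := by
      have := (B.linearIndependent.map' V.subtype V.ker_subtype).comp e e.injective
      exact this.units_smul fun _ ↦ (Units.mk0 _ hd0)⁻¹
    refine h.restrict_scalars ?_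
    intro x y hxy
    simpa [Algebra.smul_def] using hxy
  · have h := congrArg V.subtype (B.sum_repr ⟨v t, hv t⟩)
    rw [map_sum] at h
    have h' : v t = ∑ j, c (t, e j) • (algebraMap T F d)⁻¹ • (B (e j) : Ω) := by
      rw [← Equiv.sum_comp e] at h
      refine h.symm.trans (Finset.sum_congr rfl fun j _ ↦ ?_)
      rw [← algebraMap_smul F (c (t, e j)), hc, smul_smul, Algebra.smul_def, mul_right_comm,
        mul_inv_cancel₀ hd0, one_mul]
      rfl
    rw [h']
    exact Submodule.sum_mem _ fun j _ ↦ Submodule.smul_mem _ _ (Submodule.subset_span ⟨j, rfl⟩)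

/-- Over a ring `R` which is pure in `T`, an element of `∑ T bₖ` which has a multiple in `∑ R lₜ`
lies in `∑ R bₖ`, provided that `b` and `l` have coordinates in `R` with respect to some family
which is linearly independent over `T`. -/
theorem exists_eq_sum_smul_of_pure {R T Ω : Type*} [CommRing R] [CommRing T] [Algebra R T]
    [AddCommGroup Ω] [Module T Ω] [Module R Ω] [IsScalarTower R T Ω]
    [FaithfulSMul R T] {κ τ ν : Type*} [Fintype κ] [Fintype τ] [Fintype ν]
    (hpure : ∀ (M : ν → κ → R) (c : ν → R) (s : κ → T),
      (∀ v, ∑ k, algebraMap R T (M v k) * s k = algebraMap R T (c v)) →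
        ∃ s' : κ → R, ∀ v, ∑ k, M v k * s' k = c v)
    {β : ν → Ω} (hβ : LinearIndependent T β) {b : κ → Ω} {μ : κ → ν → R}
    (hb : ∀ k, b k = ∑ v, μ k v • β v) {l : τ → Ω} {lam : τ → ν → R}
    (hl : ∀ t, l t = ∑ v, lam t v • β v) {a : Ω} {s : κ → T} (ha : a = ∑ k, s k • b k)
    {d : R} (hd : ∀ x : Ω, d • x = 0 → x = 0) {c : τ → R} (hda : d • a = ∑ t, c t • l t) :
    ∃ s' : κ → R, a = ∑ k, s' k • b k := by
  have hcoord : ∑ t, c t • l t = ∑ v, (∑ t, c t * lam t v) • β v := by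
    simp only [hl, Finset.smul_sum, smul_smul, Finset.sum_smul]
    exact Finset.sum_comm
  have hcomb (x : κ → T) : d • ∑ k, x k • b k =
      ∑ v, (∑ k, algebraMap R T (d * μ k v) * x k) • β v := by
    simp only [hb, Finset.smul_sum, Finset.sum_smul]
    rw [Finset.sum_comm]
    refine Finset.sum_congr rfl fun v _ ↦ Finset.sum_congr rfl fun k _ ↦ ?_
    rw [← algebraMap_smul T d, ← algebraMap_smul T (μ k v), smul_smul, smul_smul, map_mul]
    congr 1
    ring
  have hsol (v) : ∑ k, algebraMap R T (d * μ k v) * s k = algebraMap R T (∑ t, c t * lam t v) := by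
    refine sub_eq_zero.1 (Fintype.linearIndependent_iff.1 hβ
      (fun v ↦ ∑ k, algebraMap R T (d * μ k v) * s k - algebraMap R T (∑ t, c t * lam t v)) ?_ v)
    simp only [sub_smul, Finset.sum_sub_distrib, algebraMap_smul]
    rw [← hcomb, ← hcoord, ← ha, hda, sub_self]
  obtain ⟨s', hs'⟩ := hpure (fun v k ↦ d * μ k v) _ s hsol
  refine ⟨s', sub_eq_zero.1 (hd _ ?_)⟩
  have h := hcomb fun k ↦ algebraMap R T (s' k)
  simp only [algebraMap_smul, ← map_mul, ← map_sum, hs'] at h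
  rw [smul_sub, h, hda, hcoord, sub_self]

theorem exists_le_forall_mem_range_map {σ K : Type*} [Field K] {ι : Type*}
    {Dfam : ι → Subring K} (hdir : ∀ i j, ∃ k, Dfam i ≤ Dfam k ∧ Dfam j ≤ Dfam k)
    {κ : Type*} [Finite κ] (s : κ → MvPolynomial σ (⨆ i, Dfam i : Subring K)) (j : ι) :
    ∃ l, Dfam j ≤ Dfam l ∧
      ∀ k, s k ∈ (map (σ := σ) (Subring.inclusion (le_iSup Dfam l))).range := by
  have := Fintype.ofFinite κ
  have : Nonempty ι := ⟨j⟩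
  have hmem (x : (⨆ i, Dfam i : Subring K)) : ∃ l, (x : K) ∈ Dfam l :=
    (Subring.mem_iSup_of_directed hdir).1 x.2
  have key (t : Finset (⨆ i, Dfam i : Subring K)) :
      ∃ l, Dfam j ≤ Dfam l ∧ ∀ x ∈ t, (x : K) ∈ Dfam l := by
    classical
    induction t using Finset.induction_on with
    | empty => exact ⟨j, le_rfl, by simp⟩
    | insert x t _ ih =>
      obtain ⟨l, hjl, hl⟩ := ih
      obtain ⟨m, hm⟩ := hmem x
      obtain ⟨p, hlp, hmp⟩ := hdir l m
      refine ⟨p, hjl.trans hlp, fun y hy ↦ ?_⟩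
      obtain rfl | hy := Finset.mem_insert.1 hy
      exacts [hmp hm, hlp (hl y hy)]
  classical
  obtain ⟨l, hjl, hl⟩ := key (Finset.univ.biUnion fun k ↦ (s k).support.image fun t ↦ coeff t (s k))
  refine ⟨l, hjl, fun k ↦ (mem_range_map_iff_coeffs_subset).2 fun x hx ↦ ?_⟩
  obtain ⟨t, ht, rfl⟩ := mem_coeffs_iff.1 hx
  exact ⟨⟨_, hl _ (Finset.mem_biUnion.2 ⟨k, Finset.mem_univ k, Finset.mem_image.2 ⟨t, ht, rfl⟩⟩)⟩,
    rfl⟩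

theorem pure_map_inclusion_iSup {σ : Type*} {K : Type u} [Field K] {ι : Type*}
    {Dfam : ι → Subring K} (hdir : ∀ i j, ∃ k, Dfam i ≤ Dfam k ∧ Dfam j ≤ Dfam k)
    (hpruefer : ∀ i, IsPruferDomain (Dfam i))
    (hfin : ∀ i j (hij : Dfam i ≤ Dfam j),
      letI : Algebra (Dfam i) (Dfam j) := (Subring.inclusion hij).toAlgebra
      Module.Finite (Dfam i) (Dfam j)) (j : ι) {κ ν : Type*} [Fintype κ]
    (M : ν → κ → MvPolynomial σ (Dfam j)) (c : ν → MvPolynomial σ (Dfam j))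
    (s : κ → MvPolynomial σ (⨆ i, Dfam i : Subring K))
    (hs : ∀ v, ∑ k, map (Subring.inclusion (le_iSup Dfam j)) (M v k) * s k =
      map (Subring.inclusion (le_iSup Dfam j)) (c v)) :
    ∃ s' : κ → MvPolynomial σ (Dfam j), ∀ v, ∑ k, M v k * s' k = c v := by
  obtain ⟨l, hjl, hl⟩ := exists_le_forall_mem_range_map hdir s j
  choose s₁ hs₁ using hl
  let : Algebra (Dfam j) (Dfam l) := (Subring.inclusion hjl).toAlgebra
  have : Module.Finite (Dfam j) (Dfam l) := hfin j l hjl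
  have : FaithfulSMul (Dfam j) (Dfam l) :=
    (faithfulSMul_iff_algebraMap_injective _ _).2 (Subring.inclusion_injective hjl)
  obtain ⟨r, hr⟩ := (hpruefer j).exists_retraction (Dfam l)
  obtain ⟨ρ, hρ, hρ'⟩ := MvPolynomial.exists_retraction_map (σ := σ) r hr
  have hcomp (p : MvPolynomial σ (Dfam j)) : map (Subring.inclusion (le_iSup Dfam j)) p =
      map (Subring.inclusion (le_iSup Dfam l)) (map (algebraMap (Dfam j) (Dfam l)) p) := by
    rw [map_map]
    rfl
  refine ⟨fun k ↦ ρ (s₁ k), fun v ↦ ?_⟩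
  have h : ∑ k, map (algebraMap (Dfam j) (Dfam l)) (M v k) * s₁ k =
      map (algebraMap (Dfam j) (Dfam l)) (c v) := by
    refine map_injective _ (Subring.inclusion_injective (le_iSup Dfam l)) ?_
    rw [← hcomp, ← hs v, map_sum]
    exact Finset.sum_congr rfl fun k _ ↦ by rw [map_mul, ← hcomp]; congr 1; exact hs₁ k
  have h' := congrArg ρ h
  rw [hρ, map_sum] at h'
  simpa only [hρ'] using h'

theorem MvPolynomial.finite_of_finite_coeff (σ A B : Type*) [CommRing A] [CommRing B]
    [Algebra A B] [Module.Finite A B] :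
    letI : Algebra (MvPolynomial σ A) (MvPolynomial σ B) := algebraMvPolynomial
    Module.Finite (MvPolynomial σ A) (MvPolynomial σ B) :=
  letI : Algebra (MvPolynomial σ A) (MvPolynomial σ B) := algebraMvPolynomial
  .equiv (Algebra.IsPushout.equiv A (MvPolynomial σ A) B (MvPolynomial σ B)).toLinearEquiv

/-- To prove that the integral closure of `S` in a field `L` is finite, it suffices to find a
finite `S`-module of integral elements containing it in some larger field. -/
theorem IsPruferDomain.finite_integralClosure_s15 {D : Type u} [CommRing D] [IsDomain D]
    (hD : IsPruferDomain D) {S L Ω : Type*} [CommRing S] [IsDomain S] [Algebra D S]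
    [FaithfulSMul D S] [Algebra.FiniteType D S] [Field L] [Algebra S L] [FaithfulSMul S L] [Field Ω]
    [Algebra S Ω] (φ : L →ₐ[S] Ω) (W : Submodule S Ω) (hW : W.FG)
    (h_int : ∀ x ∈ W, IsIntegral S x) (hφ : ∀ a : L, IsIntegral S a → φ a ∈ W) :
    Module.Finite S (integralClosure S L) := by
  have : Module.IsTorsionFree D S := by
    refine .of_smul_eq_zero fun d q hq ↦ ?_
    rw [Algebra.smul_def, mul_eq_zero] at hq
    exact hq.imp_left fun h ↦ FaithfulSMul.algebraMap_injective D S (h.trans (map_zero _).symm)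
  let P := LinearMap.range φ.toLinearMap
  have : Module.IsTorsionFree S (Ω ⧸ P) := by
    refine .of_smul_eq_zero fun d q hq ↦ or_iff_not_imp_left.2 fun hd ↦ ?_
    obtain ⟨x, rfl⟩ := Submodule.Quotient.mk_surjective _ q
    rw [← Submodule.Quotient.mk_smul, Submodule.Quotient.mk_eq_zero] at hq
    obtain ⟨y, hy⟩ := hq
    have hd0 : algebraMap S L d ≠ 0 :=
      (map_ne_zero_iff _ (FaithfulSMul.algebraMap_injective S L)).2 hd
    rw [Submodule.Quotient.mk_eq_zero]
    refine ⟨(algebraMap S L d)⁻¹ * y, ?_⟩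
    change φ _ = _
    change φ y = _ at hy
    rw [map_mul, hy, map_inv₀, Algebra.smul_def, φ.commutes, inv_mul_cancel_left₀]
    rw [← φ.commutes]
    exact (map_ne_zero φ).2 hd0
  have : Module.Finite S W := .of_fg hW
  let g : W →ₗ[S] Ω ⧸ P := P.mkQ ∘ₗ W.subtype
  let : Module D (LinearMap.range g) := .compHom _ (algebraMap D S)
  have : IsScalarTower D S (LinearMap.range g) := .of_algebraMap_smul fun _ _ ↦ rfl
  have : Module.IsTorsionFree D (LinearMap.range g) := by
    refine .of_smul_eq_zero fun d q hq ↦ ?_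
    rw [← algebraMap_smul S d q, smul_eq_zero] at hq
    exact hq.imp_left fun h ↦ FaithfulSMul.algebraMap_injective D S (h.trans (map_zero _).symm)
  have := hD.module_finitePresentation S (LinearMap.range g)
  have hker := Module.FinitePresentation.fg_ker g.rangeRestrict g.surjective_rangeRestrict
  rw [LinearMap.ker_rangeRestrict] at hker
  have hker' := hker.map W.subtype
  have heq : (LinearMap.ker g).map W.subtype =
      (integralClosure S L).toSubmodule.map φ.toLinearMap := by
    ext x
    constructor
    · rintro ⟨w, hw, rfl⟩
      obtain ⟨a, ha⟩ : (w : Ω) ∈ P := (Submodule.Quotient.mk_eq_zero P).1 hw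
      refine ⟨a, ?_, ha⟩
      refine (isIntegral_algHom_iff φ φ.injective).1 ?_
      have := h_int _ w.2
      rwa [← ha] at this
    · rintro ⟨a, ha, rfl⟩
      exact ⟨⟨φ a, hφ a ha⟩, (Submodule.Quotient.mk_eq_zero P).2 ⟨a, rfl⟩, rfl⟩
  rw [heq] at hker'
  exact .of_fg (Submodule.fg_of_fg_map_injective φ.toLinearMap φ.injective hker')

theorem exists_le_forall_eq_sum_smul {σ : Type*} {K : Type u} [Field K] {ι : Type*}
    {Dfam : ι → Subring K} (hdir : ∀ i j, ∃ k, Dfam i ≤ Dfam k ∧ Dfam j ≤ Dfam k)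
    (hpruefer : ∀ i, IsPruferDomain (Dfam i))
    (hfin : ∀ i j (hij : Dfam i ≤ Dfam j),
      letI : Algebra (Dfam i) (Dfam j) := (Subring.inclusion hij).toAlgebra
      Module.Finite (Dfam i) (Dfam j)) (i : ι) {Ω : Type*} [Field Ω]
    [Algebra (MvPolynomial σ (⨆ i, Dfam i : Subring K)) Ω]
    [FaithfulSMul (MvPolynomial σ (⨆ i, Dfam i : Subring K)) Ω]
    {κ τ : Type*} [Fintype κ] [Fintype τ] (b : κ → Ω) (l : τ → Ω) (A : Set Ω)
    (hb : ∀ a ∈ A, ∃ s : κ → MvPolynomial σ (⨆ i, Dfam i : Subring K), a = ∑ k, s k • b k)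
    (hl : ∀ a ∈ A, ∃ d : MvPolynomial σ (Dfam i), d ≠ 0 ∧ ∃ c : τ → MvPolynomial σ (Dfam i),
      map (Subring.inclusion (le_iSup Dfam i)) d • a =
        ∑ t, map (Subring.inclusion (le_iSup Dfam i)) (c t) • l t) :
    ∃ j, Dfam i ≤ Dfam j ∧ ∀ a ∈ A, ∃ s : κ → MvPolynomial σ (Dfam j),
      a = ∑ k, map (Subring.inclusion (le_iSup Dfam j)) (s k) • b k := by
  set T := MvPolynomial σ (⨆ i, Dfam i : Subring K)
  let : Algebra (FractionRing T) Ω := FractionRing.liftAlgebra T Ω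
  obtain ⟨ν, _, β, hβ, hspan⟩ := exists_linearIndependent_forall_mem_span T (FractionRing T)
    (Sum.elim l b)
  simp only [Submodule.mem_span_range_iff_exists_fun] at hspan
  choose q hq using hspan
  obtain ⟨j, hij, hj⟩ := exists_le_forall_mem_range_map hdir
    (fun x : (τ ⊕ κ) × ν ↦ q x.1 x.2) i
  choose q' hq' using hj
  refine ⟨j, hij, fun a ha ↦ ?_⟩
  obtain ⟨s, hs⟩ := hb a ha
  obtain ⟨d, hd, c, hc⟩ := hl a ha
  let f : MvPolynomial σ (Dfam j) →+* T := map (Subring.inclusion (le_iSup Dfam j))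
  have hf : Function.Injective f := map_injective _ (Subring.inclusion_injective _)
  let : Algebra (MvPolynomial σ (Dfam j)) T := f.toAlgebra
  let : Module (MvPolynomial σ (Dfam j)) Ω := .compHom _ f
  have : IsScalarTower (MvPolynomial σ (Dfam j)) T Ω := .of_algebraMap_smul fun _ _ ↦ rfl
  have : FaithfulSMul (MvPolynomial σ (Dfam j)) T :=
    (faithfulSMul_iff_algebraMap_injective _ _).2 hf
  let h : MvPolynomial σ (Dfam i) →+* MvPolynomial σ (Dfam j) := map (Subring.inclusion hij)
  have hh : Function.Injective h := map_injective _ (Subring.inclusion_injective _)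
  have hfh (p) : f (h p) = map (Subring.inclusion (le_iSup Dfam i)) p := map_map _ _ _
  refine exists_eq_sum_smul_of_pure (T := T) (ν := ν)
    (fun M c s ↦ pure_map_inclusion_iSup hdir hpruefer hfin j M c s) hβ
    (μ := fun k v ↦ q' (Sum.inr k, v)) (fun k ↦ ?_) (l := l)
    (lam := fun t v ↦ q' (Sum.inl t, v)) (fun t ↦ ?_) hs (d := h d) (fun x hx ↦ ?_)
    (c := fun t ↦ h (c t)) ?_
  · refine (hq (Sum.inr k)).symm.trans (Finset.sum_congr rfl fun v _ ↦ ?_)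
    exact congrArg (· • β v) (hq' (Sum.inr k, v)).symm
  · refine (hq (Sum.inl t)).symm.trans (Finset.sum_congr rfl fun v _ ↦ ?_)
    exact congrArg (· • β v) (hq' (Sum.inl t, v)).symm
  · change f (h d) • x = 0 at hx
    rw [Algebra.smul_def, mul_eq_zero] at hx
    refine hx.resolve_left ?_
    rw [map_eq_zero_iff _ (FaithfulSMul.algebraMap_injective T Ω), map_eq_zero_iff _ hf,
      map_eq_zero_iff _ hh]
    exact hd
  · change f (h d) • a = ∑ t, f (h (c t)) • l t
    simpa only [hfh] using hc

/-- Over an N-2 ring `T` which is integral over `S`, the integral elements of a finite extension `L`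
of the fraction field of `S` embed in a finite `T`-module of integral elements of some field. -/
theorem IsN2.exists_ringHom {S T : Type u} [CommRing S] [IsDomain S] [CommRing T] [IsDomain T]
    (hN2 : IsN2 T) [Algebra S T] [FaithfulSMul S T] (L : Type u) [Field L]
    [Algebra S L] [Algebra (FractionRing S) L] [IsScalarTower S (FractionRing S) L]
    [FiniteDimensional (FractionRing S) L] :
    ∃ (Ω : Type u) (_ : Field Ω) (_ : Algebra T Ω) (_ : FaithfulSMul T Ω) (φ : L →+* Ω) (m r : ℕ)
      (b : Fin m → Ω) (l : Fin r → Ω),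
      (∀ x, φ (algebraMap S L x) = algebraMap T Ω (algebraMap S T x)) ∧
      (∀ k, IsIntegral T (b k)) ∧
      (∀ a, IsIntegral S a → ∃ s : Fin m → T, φ a = ∑ k, s k • b k) ∧
      ∀ a, ∃ d : S, d ≠ 0 ∧ ∃ c : Fin r → S,
        algebraMap S T d • φ a = ∑ t, algebraMap S T (c t) • l t := by
  let E := FractionRing T
  let Ω := AlgebraicClosure E
  have : FaithfulSMul T Ω := by
    rw [faithfulSMul_iff_algebraMap_injective, IsScalarTower.algebraMap_eq T E Ω]
    exact (algebraMap E Ω).injective.comp (IsFractionRing.injective T E)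
  have : FaithfulSMul S Ω := .trans S T Ω
  let : Algebra (FractionRing S) Ω := FractionRing.liftAlgebra S Ω
  let φ' : L →ₐ[FractionRing S] Ω := IsAlgClosed.lift
  let φ : L →ₐ[S] Ω := φ'.restrictScalars S
  let B := Module.finBasis (FractionRing S) L
  let L' := IntermediateField.adjoin E (Set.range fun t ↦ φ (B t))
  have hclear (a : L) : ∃ d : S, d ≠ 0 ∧ ∃ c : Fin (Module.finrank (FractionRing S) L) → S,
      algebraMap S T d • φ a = ∑ t, algebraMap S T (c t) • φ (B t) := by
    obtain ⟨d, hd⟩ := IsLocalization.exist_integer_multiples_of_finite (nonZeroDivisors S)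
      (fun t ↦ B.repr a t)
    choose c hc using hd
    refine ⟨d, nonZeroDivisors.coe_ne_zero d, c, ?_⟩
    simp only [algebraMap_smul, ← map_smul, ← map_sum]
    congr 1
    conv_lhs => rw [← B.sum_repr a, Finset.smul_sum]
    refine Finset.sum_congr rfl fun t _ ↦ ?_
    rw [← algebraMap_smul (FractionRing S) (c t), hc, smul_assoc]
  have hL' (a : L) : φ a ∈ L' := by
    obtain ⟨d, hd, c, hc⟩ := hclear a
    have hd' : algebraMap T Ω (algebraMap S T d) ≠ 0 := by
      rw [map_ne_zero_iff _ (FaithfulSMul.algebraMap_injective T Ω),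
        map_ne_zero_iff _ (FaithfulSMul.algebraMap_injective S T)]
      exact hd
    have hT (x : T) : algebraMap T Ω x ∈ L' := by
      rw [IsScalarTower.algebraMap_apply T E Ω]
      exact L'.algebraMap_mem _
    rw [Algebra.smul_def, mul_comm, ← eq_mul_inv_iff_mul_eq₀ hd'] at hc
    rw [hc]
    refine mul_mem (sum_mem fun t _ ↦ ?_) (inv_mem (hT _))
    rw [Algebra.smul_def]
    exact mul_mem (hT _) (IntermediateField.subset_adjoin _ _ ⟨t, rfl⟩)
  have : FiniteDimensional E L' := by
    have := Set.finite_range fun t ↦ φ (B t)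
    exact IntermediateField.finiteDimensional_adjoin fun x _ ↦ Algebra.IsIntegral.isIntegral x
  have : Module.Finite T (integralClosure T L') := hN2 L' inferInstance
  obtain ⟨m, b', hb'⟩ := Module.Finite.exists_fin (R := T) (M := integralClosure T L')
  let b (k : Fin m) : Ω := ((b' k : L') : Ω)
  have hb (k) : IsIntegral T (b k) :=
    (b' k).2.map (L'.val.restrictScalars T)
  have hspan (a : L) (ha : IsIntegral S a) : ∃ s : Fin m → T, φ a = ∑ k, s k • b k := by
    have h : IsIntegral T (⟨φ a, hL' a⟩ : L') := by
      refine (isIntegral_algHom_iff (L'.val.restrictScalars T) L'.val.injective).1 ?_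
      exact (ha.map φ).tower_top
    obtain ⟨s, hs⟩ := (Submodule.mem_span_range_iff_exists_fun T).1
      (hb'.ge (Submodule.mem_top (x := (⟨⟨φ a, hL' a⟩, h⟩ : integralClosure T L'))))
    refine ⟨s, ?_⟩
    have := congrArg ((L'.val.restrictScalars T).comp (integralClosure T L').val) hs
    rw [map_sum] at this
    simp only [map_smul] at this
    exact this.symm
  refine ⟨Ω, inferInstance, inferInstance, ‹_›, φ, m, _, b, fun t ↦ φ (B t), fun x ↦ ?_, hb, hspan,
    hclear⟩
  exact (φ.commutes x).trans (IsScalarTower.algebraMap_apply S T Ω x)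

/-- Let `(Dᵢ)` be a directed family of subrings of a field `K`, each a Prüfer
domain, with `Dⱼ` finite as a `Dᵢ`-module whenever `Dᵢ ⊆ Dⱼ`.  Let
`D = ⋃ᵢ Dᵢ` and fix `n ≥ 0`.  If `D[x₁,…,xₙ]` is N-2 then so is each
`Dᵢ[x₁,…,xₙ]`. -/
theorem isN2_polynomial_of_directed_union
    (K : Type u) [Field K] (ι : Type u) (Dfam : ι → Subring K)
    (hdir : ∀ i j, ∃ k, Dfam i ≤ Dfam k ∧ Dfam j ≤ Dfam k)
    (hpruefer : ∀ i, IsPruferDomain (Dfam i))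
    (hfin : ∀ i j (hij : Dfam i ≤ Dfam j),
      letI : Algebra (Dfam i) (Dfam j) := (Subring.inclusion hij).toAlgebra
      Module.Finite (Dfam i) (Dfam j))
    (n : ℕ)
    (hN2 : IsN2 (MvPolynomial (Fin n) (⨆ i, Dfam i : Subring K)))
    (i : ι) :
    IsN2 (MvPolynomial (Fin n) (Dfam i)) := by
  intro L _ _ _ _ hfd
  let D : Subring K := ⨆ i, Dfam i
  have hle (j) : Dfam j ≤ D := le_iSup Dfam j
  let S := MvPolynomial (Fin n) (Dfam i)
  let T := MvPolynomial (Fin n) D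
  let : Algebra (Dfam i) D := (Subring.inclusion (hle i)).toAlgebra
  have : FaithfulSMul (Dfam i) D :=
    (faithfulSMul_iff_algebraMap_injective _ _).2 (Subring.inclusion_injective _)
  have : Algebra.IsIntegral (Dfam i) D := by
    refine ⟨fun x ↦ ?_⟩
    have : Nonempty ι := ⟨i⟩
    obtain ⟨l, hl⟩ := (Subring.mem_iSup_of_directed hdir).1 x.2
    obtain ⟨j, hij, hlj⟩ := hdir i l
    let : Algebra (Dfam i) (Dfam j) := (Subring.inclusion hij).toAlgebra
    have : Module.Finite (Dfam i) (Dfam j) := hfin i j hij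
    let f : Dfam j →ₐ[Dfam i] D := { Subring.inclusion (hle j) with commutes' _ := rfl }
    exact (Algebra.IsIntegral.isIntegral (R := Dfam i) (⟨x, hlj hl⟩ : Dfam j)).map f
  let : Algebra S T := MvPolynomial.algebraMvPolynomial
  have : Algebra.IsIntegral S T := instIsIntegralMvPolynomial _ _
  have : FaithfulSMul S T :=
    (faithfulSMul_iff_algebraMap_injective _ _).2 (map_injective _ (Subring.inclusion_injective _))
  obtain ⟨Ω, _, _, _, ψ, m, r, b, l, hψ, hb, hspan, hclear⟩ := hN2.exists_ringHom (S := S) L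
  obtain ⟨j, hij, hj⟩ := exists_le_forall_eq_sum_smul hdir hpruefer hfin i b l
    (Set.image ψ {a | IsIntegral S a}) (by rintro _ ⟨a, ha, rfl⟩; exact hspan a ha)
    (by rintro _ ⟨a, -, rfl⟩; exact hclear a)
  let S' := MvPolynomial (Fin n) (Dfam j)
  let : Algebra (Dfam i) (Dfam j) := (Subring.inclusion hij).toAlgebra
  have : Module.Finite (Dfam i) (Dfam j) := hfin i j hij
  let : Algebra S S' := MvPolynomial.algebraMvPolynomial
  have : Module.Finite S S' := MvPolynomial.finite_of_finite_coeff ..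
  let : Algebra S' T := (map (Subring.inclusion (hle j))).toAlgebra
  let : Algebra S Ω := ((algebraMap T Ω).comp (algebraMap S T)).toAlgebra
  let : Algebra S' Ω := ((algebraMap T Ω).comp (algebraMap S' T)).toAlgebra
  have : IsScalarTower S T Ω := .of_algebraMap_eq fun _ ↦ rfl
  have : IsScalarTower S' T Ω := .of_algebraMap_eq fun _ ↦ rfl
  let φ : L →ₐ[S] Ω := { ψ with commutes' := hψ }
  have : FaithfulSMul S L := by
    rw [faithfulSMul_iff_algebraMap_injective, IsScalarTower.algebraMap_eq S (FractionRing S) L]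
    exact (algebraMap (FractionRing S) L).injective.comp (IsFractionRing.injective S _)
  have : IsScalarTower S S' T := .of_algebraMap_eq fun p ↦
    (map_map (Subring.inclusion hij) (Subring.inclusion (hle j)) p).symm
  have : IsScalarTower S S' Ω := .of_algebraMap_eq fun p ↦ by
    rw [IsScalarTower.algebraMap_apply S T Ω, IsScalarTower.algebraMap_apply S' T Ω,
      IsScalarTower.algebraMap_apply S S' T]
  let W := Submodule.span S' (Set.range b)
  have : Module.Finite S' W := .span_of_finite S' (Set.finite_range b)
  have : Module.Finite S W := .trans S' W
  have hW : (W.restrictScalars S).FG :=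
    Module.Finite.iff_fg.1 (inferInstanceAs (Module.Finite S W))
  refine (hpruefer i).finite_integralClosure_s15 φ (W.restrictScalars S) hW (fun x hx ↦ ?_)
    fun a ha ↦ ?_
  · obtain ⟨s, rfl⟩ := (Submodule.mem_span_range_iff_exists_fun S').1 hx
    refine IsIntegral.sum _ fun k _ ↦ ?_
    rw [Algebra.smul_def]
    exact .mul (Algebra.IsIntegral.isIntegral (R := S) (s k)).algebraMap (isIntegral_trans _ (hb k))
  · obtain ⟨s, hs⟩ := hj _ ⟨a, ha, rfl⟩
    refine (Submodule.mem_span_range_iff_exists_fun S').2 ⟨s, ?_⟩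
    refine (Finset.sum_congr rfl fun k _ ↦ ?_).trans hs.symm
    exact (algebraMap_smul T (s k) (b k)).symm
end
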